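/- Let N ≥ 2, m ≥ 1, and let (f, g) be a density pair on ℝ^N for which there exists M ≥ 1 with M^{−1} ≤ f(x) ≤ M and M^{−1} ≤ g(x) ≤ M for every x ∈ ℝ^N, and assume that g converges at infinity to a finite limit a > 0, i.e. g(x) → a as |x| → +∞. Let 𝓔 be a nondegenerate m-cluster of finite perimeter and finite volume which is isoperimetric. Then 𝓔 is essentially bounded: there exists R > 0 such that Leb(E_i ∖ B(0,R)) = 0 for every 1 ≤ i ≤ m. -/

import Mathlib

open MeasureTheory Metric Set Filter

noncomputable section

abbrev Pt (N : ℕ) := EuclideanSpace ℝ (Fin N)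

variable {N : ℕ}

/-- The density ratio of `E` at `x` tends to `l` as the radius tends to `0⁺`. -/
def densTendsto (E : Set (Pt N)) (x : Pt N) (l : ENNReal) : Prop :=
  Tendsto (fun r : ℝ => volume (E ∩ ball x r) / volume (ball x r))
    (nhdsWithin 0 (Ioi 0)) (nhds l)

/-- The essential boundary of a set. -/
def essBdry (E : Set (Pt N)) : Set (Pt N) :=
  {x | ¬ densTendsto E x 0 ∧ ¬ densTendsto E x 1}

/-- Weighted volume (as an extended nonnegative real). -/
def wVolE (f : Pt N → ℝ) (E : Set (Pt N)) : ENNReal :=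
  ∫⁻ x in E, ENNReal.ofReal (f x) ∂(μH[(N : ℝ)])

/-- Weighted volume. -/
def wVol (f : Pt N → ℝ) (E : Set (Pt N)) : ℝ := (wVolE f E).toReal

/-- Weighted perimeter. -/
def wPer (g : Pt N → ℝ) (E : Set (Pt N)) : ℝ :=
  (∫⁻ x in essBdry E, ENNReal.ofReal (g x) ∂(μH[(N : ℝ) - 1])).toReal

/-- A density pair: lower semicontinuous, positive, locally bounded functions. -/
def IsDensityPair (f g : Pt N → ℝ) : Prop :=
  LowerSemicontinuous f ∧ LowerSemicontinuous g ∧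
  (∀ x, 0 < f x) ∧ (∀ x, 0 < g x) ∧
  ∀ K : Set (Pt N), IsCompact K → ∃ C : ℝ, ∀ x ∈ K, f x ≤ C ∧ g x ≤ C

/-- `g` is locally `α`-Hölder. -/
def LocallyHolder (α : ℝ) (g : Pt N → ℝ) : Prop :=
  ∀ K : Set (Pt N), IsCompact K → ∃ C : ℝ, ∀ y ∈ K, ∀ z ∈ K, |g y - g z| ≤ C * dist y z ^ α

/-- An `m`-cluster: measurable, essentially pairwise disjoint chambers. -/
def IsCluster {m : ℕ} (E : Fin m → Set (Pt N)) : Prop :=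
  (∀ i, MeasurableSet (E i)) ∧ ∀ i j, i ≠ j → volume (E i ∩ E j) = 0

/-- The chambers of a cluster including the exterior chamber `E₀`. -/
def chamber {m : ℕ} (E : Fin m → Set (Pt N)) (i : Fin (m + 1)) : Set (Pt N) :=
  if h : i = 0 then (⋃ j, E j)ᶜ else E (i.pred h)

/-- The weighted perimeter of a cluster. -/
def clPer (g : Pt N → ℝ) {m : ℕ} (E : Fin m → Set (Pt N)) : ℝ :=
  ((∑ i, wPer g (E i)) + wPer g (⋃ i, E i)) / 2

/-- The cluster has finite perimeter. -/
def FinPerCluster {m : ℕ} (E : Fin m → Set (Pt N)) : Prop :=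
  ∀ i, μH[(N : ℝ) - 1] (essBdry (E i)) < ⊤

/-- The cluster has finite weighted volume. -/
def FinVolCluster (f : Pt N → ℝ) {m : ℕ} (E : Fin m → Set (Pt N)) : Prop :=
  ∀ i, wVolE f (E i) < ⊤

/-- Nondegeneracy: all chambers including the exterior one have positive Lebesgue measure. -/
def Nondegenerate {m : ℕ} (E : Fin m → Set (Pt N)) : Prop :=
  0 < volume ((⋃ i, E i)ᶜ) ∧ ∀ i, 0 < volume (E i)

/-- The `ε`–`ε^β` property for clusters with constants `(rbar, εbar, Cper)`. -/
def EpsEpsBeta (f g : Pt N → ℝ) {m : ℕ} (E : Fin m → Set (Pt N))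
    (β rbar εbar Cper : ℝ) : Prop :=
  ∀ ε : EuclideanSpace ℝ (Fin m), ‖ε‖ < εbar → ∀ w : Pt N,
    ∃ F : Fin m → Set (Pt N), IsCluster F ∧
      (∃ (c : Fin (m * (m + 1) / 2 + 1) → Pt N) (ρ : Fin (m * (m + 1) / 2 + 1) → ℝ),
        (∀ k, ρ k ≤ rbar) ∧
        (∀ k, Disjoint (ball (c k) (ρ k)) (ball w rbar)) ∧
        (⋃ i, symmDiff (E i) (F i)) ⊆ ⋃ k, ball (c k) (ρ k)) ∧
      (∀ i, wVol f (F i) = wVol f (E i) + ε i) ∧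
      clPer g F ≤ clPer g E + Cper * ‖ε‖ ^ β

/-- An isoperimetric (minimal) cluster. -/
def IsIsoperimetric (f g : Pt N → ℝ) {m : ℕ} (E : Fin m → Set (Pt N)) : Prop :=
  ∀ F : Fin m → Set (Pt N), IsCluster F → FinPerCluster F →
    (∀ i, wVol f (F i) = wVol f (E i)) → clPer g E ≤ clPer g F

section

open scoped ENNReal NNReal Topology

variable {n : ℕ}

/-- The points of zero density of `E`. -/
def zeroDens (E : Set (Pt N)) : Set (Pt N) := {x | densTendsto E x 0}

/-- The points around which `E` fills at most the fraction `ε` of every ball of radius less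
than `δ`. -/
def thinPts (E : Set (Pt N)) (ε : ℝ≥0∞) (δ : ℝ) : Set (Pt N) :=
  {x | ∀ r ∈ Ioo 0 δ, volume (E ∩ ball x r) ≤ ε * volume (ball x r)}

lemma ae_eq_set_of_iff {α : Type*} [MeasurableSpace α] {μ : Measure α} {s t : Set α}
    (h : ∀ᵐ x ∂μ, x ∈ s ↔ x ∈ t) : s =ᵐ[μ] t := by
  filter_upwards [h] with x hx
  exact propext hx

lemma volume_ball_ne_zero (x : Pt N) {r : ℝ} (hr : 0 < r) : volume (ball x r) ≠ 0 :=
  (measure_ball_pos _ x hr).ne'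

lemma volume_ball_ne_top (x : Pt N) (r : ℝ) : volume (ball x r) ≠ ⊤ :=
  measure_ball_lt_top.ne

lemma mem_zeroDens_iff {E : Set (Pt N)} {x : Pt N} :
    x ∈ zeroDens E ↔ ∀ ε : ℝ≥0∞, 0 < ε → ∃ δ > (0 : ℝ), x ∈ thinPts E ε δ := by
  simp only [zeroDens, densTendsto, mem_ofPred_eq, ENNReal.tendsto_nhds_zero]
  refine forall₂_congr fun ε hε => ?_
  rw [Filter.eventually_iff, mem_nhdsGT_iff_exists_Ioo_subset]
  refine exists_congr fun δ => and_congr Iff.rfl ?_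
  refine forall₂_congr fun r hr => ?_
  simp only [mem_ofPred_eq]
  rw [ENNReal.div_le_iff (volume_ball_ne_zero x hr.1) (volume_ball_ne_top x r)]

lemma densTendsto_one_iff {E : Set (Pt N)} (hE : MeasurableSet E) {x : Pt N} :
    densTendsto E x 1 ↔ x ∈ zeroDens Eᶜ := by
  have key : ∀ F : Set (Pt N), MeasurableSet F → ∀ᶠ r : ℝ in 𝓝[>] 0,
      1 - volume (F ∩ ball x r) / volume (ball x r) =
        volume (Fᶜ ∩ ball x r) / volume (ball x r) := by
    intro F hF
    filter_upwards [self_mem_nhdsWithin] with r hr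
    have h0 := volume_ball_ne_zero x (r := r) hr
    have h1 := volume_ball_ne_top x r
    have h2 : volume (F ∩ ball x r) + volume (Fᶜ ∩ ball x r) = volume (ball x r) := by
      rw [inter_comm F, inter_comm Fᶜ, ← sdiff_eq, measure_inter_add_sdiff _ hF]
    have h3 : volume (F ∩ ball x r) / volume (ball x r)
        + volume (Fᶜ ∩ ball x r) / volume (ball x r) = 1 := by
      rw [← ENNReal.add_div, h2, ENNReal.div_self h0 h1]
    rw [← h3]
    refine ENNReal.add_sub_cancel_left ?_
    exact ((ENNReal.div_le_of_le_mul (by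
      rw [one_mul]; exact measure_mono inter_subset_right)).trans_lt ENNReal.one_lt_top).ne
  have sub : ∀ (u : ℝ → ℝ≥0∞) (l : ℝ≥0∞), Tendsto u (𝓝[>] 0) (𝓝 l) →
      Tendsto (fun r => 1 - u r) (𝓝[>] 0) (𝓝 (1 - l)) := fun u l h =>
    ENNReal.Tendsto.sub tendsto_const_nhds h (Or.inl ENNReal.one_ne_top)
  constructor
  · intro h
    have := (sub _ _ h).congr' (key E hE)
    simpa [zeroDens, densTendsto] using this
  · intro h
    have := (sub _ _ h).congr' (key Eᶜ hE.compl)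
    simpa [zeroDens, densTendsto] using this

lemma essBdry_eq {E : Set (Pt N)} (hE : MeasurableSet E) :
    essBdry E = (zeroDens E ∪ zeroDens Eᶜ)ᶜ := by
  ext x
  simp only [essBdry, mem_ofPred_eq, densTendsto_one_iff hE, compl_union, mem_inter_iff,
    mem_compl_iff]
  rfl

lemma thinPts_mono {E F : Set (Pt N)} {x : Pt N} {U : Set (Pt N)} (hU : IsOpen U) (hx : x ∈ U)
    (h : ∀ᵐ y, y ∈ E → y ∈ U → y ∈ F) : ∃ δ₀ > (0:ℝ), ∀ ε δ, x ∈ thinPts F ε δ →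
      x ∈ thinPts E ε (min δ δ₀) := by
  obtain ⟨δ₀, h0, hb⟩ := Metric.isOpen_iff.1 hU x hx
  refine ⟨δ₀, h0, fun ε δ hF r hr => ?_⟩
  refine le_trans (measure_mono_ae ?_) (hF r ⟨hr.1, hr.2.trans_le (min_le_left _ _)⟩)
  filter_upwards [h] with y hy hyE
  have : y ∈ U := hb (ball_subset_ball (hr.2.le.trans (min_le_right _ _)) hyE.2)
  exact ⟨hy hyE.1 this, hyE.2⟩

lemma zeroDens_local {E F : Set (Pt N)} {x : Pt N} {U : Set (Pt N)} (hU : IsOpen U) (hx : x ∈ U)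
    (h : ∀ᵐ y, y ∈ E → y ∈ U → y ∈ F) (hF : x ∈ zeroDens F) : x ∈ zeroDens E := by
  rw [mem_zeroDens_iff] at hF ⊢
  obtain ⟨δ₀, h0, hb⟩ := thinPts_mono hU hx h
  intro ε hε
  obtain ⟨δ, hδ, hx⟩ := hF ε hε
  exact ⟨min δ δ₀, lt_min hδ h0, hb _ _ hx⟩

lemma zeroDens_anti {E F : Set (Pt N)} (h : E ⊆ F) : zeroDens F ⊆ zeroDens E := fun _ hx =>
  zeroDens_local isOpen_univ (mem_univ _)
    (Eventually.of_forall fun _ hy _ => h hy) hx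

lemma zeroDens_union {E F : Set (Pt N)} {x : Pt N} (hE : x ∈ zeroDens E) (hF : x ∈ zeroDens F) :
    x ∈ zeroDens (E ∪ F) := by
  have := Tendsto.add hE hF
  simp only [add_zero] at this
  refine tendsto_of_tendsto_of_tendsto_of_le_of_le tendsto_const_nhds this
    (fun _ => zero_le) fun r => ?_
  simp only
  rw [← ENNReal.add_div, union_inter_distrib_right]
  gcongr
  exact measure_union_le _ _

lemma zeroDens_biUnion {ι : Type*} (s : Finset ι) {E : ι → Set (Pt N)} {x : Pt N}
    (h : ∀ i ∈ s, x ∈ zeroDens (E i)) : x ∈ zeroDens (⋃ i ∈ s, E i) := by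
  classical
  induction s using Finset.induction_on with
  | empty => simp [zeroDens, densTendsto]
  | insert a s ha ih =>
    rw [Finset.set_biUnion_insert]
    exact zeroDens_union (h a (Finset.mem_insert_self _ _))
      (ih fun i hi => h i (Finset.mem_insert_of_mem hi))

lemma notMem_zeroDens_compl {E : Set (Pt N)} {x : Pt N} (hE : x ∈ zeroDens E) :
    x ∉ zeroDens Eᶜ := by
  intro hc
  have := zeroDens_union hE hc
  rw [union_compl_self, mem_zeroDens_iff] at this
  obtain ⟨δ, hδ, h⟩ := this (1 / 2) (by norm_num)
  have h2 := h (δ / 2) ⟨by linarith, by linarith⟩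
  rw [univ_inter] at h2
  have h0 := volume_ball_ne_zero x (r := δ / 2) (by linarith)
  have h1 := volume_ball_ne_top x (δ / 2)
  have h3 : (1 : ℝ≥0∞) ≤ 1 / 2 := by
    rw [← ENNReal.mul_le_mul_iff_left h0 h1, one_mul]; exact h2
  rw [ENNReal.le_div_iff_mul_le (by simp) (by simp)] at h3
  norm_num at h3

lemma ae_mem_zeroDens_compl {E : Set (Pt N)} (hE : MeasurableSet E) :
    ∀ᵐ x, x ∈ E → x ∈ zeroDens Eᶜ := by
  have := Besicovitch.ae_tendsto_measure_inter_div_of_measurableSet (volume : Measure (Pt N))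
    hE.compl
  filter_upwards [this] with x hx hxE
  have hx' : Tendsto (fun r => volume (Eᶜ ∩ closedBall x r) / volume (closedBall x r)) (𝓝[>] 0)
      (𝓝 0) := by simpa [hxE] using hx
  refine hx'.congr' ?_
  filter_upwards [self_mem_nhdsWithin] with r hr
  rcases Nat.eq_zero_or_pos N with rfl | hN
  · have h1 : ball x r = univ := by
      ext y; simp [Subsingleton.elim y x, mem_Ioi.1 hr]
    have h2 : closedBall x r = univ := by
      ext y; simp [Subsingleton.elim y x, (mem_Ioi.1 hr).le]
    rw [h1, h2]
  · have : Nonempty (Fin N) := ⟨⟨0, hN⟩⟩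
    rw [Measure.addHaar_closedBall_eq_addHaar_ball]
    congr 1
    refine measure_congr ?_
    have hs : volume (sphere x r) = 0 := Measure.addHaar_sphere _ _ _
    refine ae_eq_set_of_iff ?_
    filter_upwards [measure_eq_zero_iff_ae_notMem.1 hs] with y hy
    rw [← ball_union_sphere, mem_inter_iff, mem_inter_iff, mem_union]
    tauto

lemma isClosed_thinPts (E : Set (Pt N)) {ε : ℝ≥0∞} {δ : ℝ} : IsClosed (thinPts E ε δ) := by
  rw [← isOpen_compl_iff, Metric.isOpen_iff]
  intro x hx
  simp only [thinPts, mem_compl_iff, mem_ofPred_eq, not_forall, not_le, exists_prop] at hx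
  obtain ⟨r, hr, hlt⟩ := hx
  have hmono : Monotone fun k : ℕ => E ∩ ball x (r - 1 / ((k : ℝ) + 1)) := by
    intro i j hij
    refine inter_subset_inter_right _ (ball_subset_ball ?_)
    have : 1 / ((j : ℝ) + 1) ≤ 1 / ((i : ℝ) + 1) := Nat.one_div_le_one_div hij
    linarith
  have hU : E ∩ ball x r = ⋃ k : ℕ, E ∩ ball x (r - 1 / ((k : ℝ) + 1)) := by
    rw [← inter_iUnion]
    congr 1
    ext y
    simp only [mem_ball, mem_iUnion]
    constructor
    · intro h
      obtain ⟨k, hk⟩ := exists_nat_one_div_lt (sub_pos.2 h)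
      exact ⟨k, by linarith⟩
    · rintro ⟨k, hk⟩
      have : (0:ℝ) < 1 / ((k : ℝ) + 1) := by positivity
      linarith
  rw [hU, hmono.measure_iUnion, lt_iSup_iff] at hlt
  obtain ⟨k, hk⟩ := hlt
  refine ⟨1 / ((k : ℝ) + 1), by positivity, fun y hy hyt => ?_⟩
  have h1 := hyt r hr
  have h2 : volume (ball y r) = volume (ball x r) := by
    rw [Measure.addHaar_ball_center, Measure.addHaar_ball_center _ x]
  rw [h2] at h1
  refine absurd (hk.trans_le (le_trans (measure_mono (inter_subset_inter_right _ ?_)) h1))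
    (lt_irrefl _)
  intro w hw
  rw [mem_ball] at *
  have := dist_triangle w x y
  rw [dist_comm x y] at this
  linarith

lemma zeroDens_eq_iInter (E : Set (Pt N)) : zeroDens E =
    ⋂ p : ℕ, ⋃ q : ℕ, thinPts E (ENNReal.ofReal (1 / ((p : ℝ) + 1))) (1 / ((q : ℝ) + 1)) := by
  ext x
  simp only [mem_iInter, mem_iUnion, mem_zeroDens_iff]
  constructor
  · intro h p
    obtain ⟨δ, hδ, hx⟩ := h (ENNReal.ofReal (1 / ((p : ℝ) + 1)))
      (ENNReal.ofReal_pos.2 (by positivity))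
    obtain ⟨q, hq⟩ := exists_nat_one_div_lt hδ
    exact ⟨q, fun r hr => hx r ⟨hr.1, hr.2.trans hq⟩⟩
  · intro h ε hε
    have : ∃ p : ℕ, ENNReal.ofReal (1 / ((p : ℝ) + 1)) ≤ ε := by
      rcases eq_or_ne ε ⊤ with rfl | ht
      · exact ⟨0, le_top⟩
      · obtain ⟨p, hp⟩ := exists_nat_one_div_lt (ENNReal.toReal_pos hε.ne' ht)
        exact ⟨p, ENNReal.ofReal_le_of_le_toReal hp.le⟩
    obtain ⟨p, hp⟩ := this
    obtain ⟨q, hq⟩ := h p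
    refine ⟨1 / ((q : ℝ) + 1), by positivity, fun r hr => (hq r hr).trans ?_⟩
    gcongr

lemma measurableSet_zeroDens (E : Set (Pt N)) : MeasurableSet (zeroDens E) := by
  rw [zeroDens_eq_iInter]
  exact MeasurableSet.iInter fun p => MeasurableSet.iUnion fun q =>
    (isClosed_thinPts E).measurableSet

lemma measurableSet_essBdry {E : Set (Pt N)} (hE : MeasurableSet E) :
    MeasurableSet (essBdry E) := by
  rw [essBdry_eq hE]
  exact ((measurableSet_zeroDens _).union (measurableSet_zeroDens _)).compl

lemma densTendsto_congr {E F : Set (Pt N)} (h : E =ᵐ[volume] F) (x : Pt N) (l : ℝ≥0∞) :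
    densTendsto E x l ↔ densTendsto F x l := by
  unfold densTendsto
  have : (fun r : ℝ => volume (E ∩ ball x r) / volume (ball x r)) =
      fun r : ℝ => volume (F ∩ ball x r) / volume (ball x r) := by
    ext r
    rw [measure_congr (h.inter (ae_eq_refl (ball x r)))]
  rw [this]

lemma essBdry_congr {E F : Set (Pt N)} (h : E =ᵐ[volume] F) : essBdry E = essBdry F := by
  ext x
  simp only [essBdry, mem_ofPred_eq, densTendsto_congr h]

lemma essBdry_compl {E : Set (Pt N)} (hE : MeasurableSet E) : essBdry Eᶜ = essBdry E := by
  rw [essBdry_eq hE, essBdry_eq hE.compl, compl_compl, union_comm]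

/-- The point with `k`-th coordinate `s` and remaining coordinates `z`. -/
def lineAt (k : Fin (n + 1)) (s : ℝ) (z : Fin n → ℝ) : Pt (n + 1) :=
  WithLp.toLp 2 (Fin.insertNth (α := fun _ => ℝ) k s z)

/-- The projection forgetting the `k`-th coordinate. -/
def shadow (k : Fin (n + 1)) (x : Pt (n + 1)) : Fin n → ℝ := fun i => x (k.succAbove i)

@[simp] lemma lineAt_same (k : Fin (n + 1)) (s : ℝ) (z : Fin n → ℝ) : lineAt k s z k = s := by
  simp [lineAt]

@[simp] lemma lineAt_succAbove (k : Fin (n + 1)) (s : ℝ) (z : Fin n → ℝ) (i : Fin n) :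
    lineAt k s z (k.succAbove i) = z i := by
  simp [lineAt]

@[simp] lemma shadow_lineAt (k : Fin (n + 1)) (s : ℝ) (z : Fin n → ℝ) :
    shadow k (lineAt k s z) = z := by
  ext i; simp [shadow]

@[simp] lemma lineAt_shadow (k : Fin (n + 1)) (x : Pt (n + 1)) :
    lineAt k (x k) (shadow k x) = x := by
  ext j
  rcases Fin.eq_self_or_eq_succAbove k j with rfl | ⟨i, rfl⟩ <;> simp [shadow]

lemma eq_lineAt_iff {k : Fin (n + 1)} {x : Pt (n + 1)} {s : ℝ} {z : Fin n → ℝ} :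
    x = lineAt k s z ↔ x k = s ∧ shadow k x = z := by
  constructor
  · rintro rfl; simp
  · rintro ⟨rfl, rfl⟩; simp

lemma shadow_lipschitz (k : Fin (n + 1)) : LipschitzWith 1 (shadow (n := n) k) := by
  refine LipschitzWith.of_dist_le_mul fun x y => ?_
  rw [NNReal.coe_one, one_mul, dist_pi_le_iff dist_nonneg]
  intro i
  have := PiLp.norm_apply_le (x - y) (k.succAbove i)
  simpa [shadow, dist_eq_norm] using this

lemma abs_coord_sub_le (k : Fin N) (x y : Pt N) : |x k - y k| ≤ dist x y := by
  have := PiLp.norm_apply_le (x - y) k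
  simpa [dist_eq_norm] using this

lemma dist_le_of_coord {x y : Pt (n + 1)} {r : ℝ} (k : Fin (n + 1)) (h1 : |x k - y k| ≤ r)
    (h2 : dist (shadow k x) (shadow k y) ≤ r) : dist x y ≤ √(n + 1) * r := by
  have hr : 0 ≤ r := (abs_nonneg _).trans h1
  have : ∀ j, dist (x j) (y j) ≤ r := by
    intro j
    rcases Fin.eq_self_or_eq_succAbove k j with rfl | ⟨i, rfl⟩
    · exact h1
    · exact (dist_le_pi_dist (shadow k x) (shadow k y) i).trans h2
  rw [EuclideanSpace.dist_eq]
  calc √(∑ i, dist (x i) (y i) ^ 2) ≤ √(∑ _i : Fin (n + 1), r ^ 2) := by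
        gcongr with i; exact this i
    _ = √(n + 1) * r := by
        rw [Finset.sum_const, Finset.card_univ, Fintype.card_fin, nsmul_eq_mul,
          Real.sqrt_mul (by positivity), Real.sqrt_sq hr]
        push_cast; rfl

/-- Splitting off the `k`-th coordinate. -/
def lineEquiv (k : Fin (n + 1)) : ℝ × (Fin n → ℝ) ≃ᵐ Pt (n + 1) :=
  (MeasurableEquiv.piFinSuccAbove (fun _ => ℝ) k).symm.trans
    (MeasurableEquiv.toLp 2 (Fin (n + 1) → ℝ))

lemma lineEquiv_apply (k : Fin (n + 1)) (p : ℝ × (Fin n → ℝ)) :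
    lineEquiv k p = lineAt k p.1 p.2 := rfl

lemma measurePreserving_lineEquiv (k : Fin (n + 1)) :
    MeasurePreserving (lineEquiv (n := n) k) (volume.prod volume) volume :=
  (PiLp.volume_preserving_toLp (Fin (n + 1))).comp
    (volume_preserving_piFinSuccAbove (fun _ => ℝ) k).symm

lemma measurable_lineAt (k : Fin (n + 1)) :
    Measurable fun p : ℝ × (Fin n → ℝ) => lineAt k p.1 p.2 := (lineEquiv k).measurable

lemma measurable_lineAt_left (k : Fin (n + 1)) (z : Fin n → ℝ) :
    Measurable fun s => lineAt k s z :=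
  (measurable_lineAt k).comp (measurable_id.prodMk measurable_const)

lemma measurable_lineAt_right (k : Fin (n + 1)) (s : ℝ) :
    Measurable fun z : Fin n → ℝ => lineAt k s z :=
  (measurable_lineAt k).comp (measurable_const.prodMk measurable_id)

lemma measurable_shadow (k : Fin (n + 1)) : Measurable (shadow (n := n) k) :=
  (shadow_lipschitz k).continuous.measurable

lemma lintegral_line (k : Fin (n + 1)) {F : Pt (n + 1) → ℝ≥0∞} (hF : Measurable F) :
    ∫⁻ x, F x = ∫⁻ z, ∫⁻ s, F (lineAt k s z) := by
  rw [← (measurePreserving_lineEquiv k).lintegral_comp hF]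
  exact lintegral_prod_symm' _ (hF.comp (lineEquiv k).measurable)

lemma lintegral_slice (k : Fin (n + 1)) {F : Pt (n + 1) → ℝ≥0∞} (hF : Measurable F) :
    ∫⁻ x, F x = ∫⁻ s, ∫⁻ z, F (lineAt k s z) := by
  rw [← (measurePreserving_lineEquiv k).lintegral_comp hF]
  exact lintegral_prod _ (hF.comp (lineEquiv k).measurable).aemeasurable

lemma volume_eq_line (k : Fin (n + 1)) {A : Set (Pt (n + 1))} (hA : MeasurableSet A) :
    volume A = ∫⁻ z, volume {s | lineAt k s z ∈ A} := by
  rw [← lintegral_indicator_one hA, lintegral_line k (measurable_one.indicator hA)]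
  refine lintegral_congr fun z => ?_
  exact lintegral_indicator_one (hA.preimage (measurable_lineAt_left k z))

lemma volume_eq_slice (k : Fin (n + 1)) {A : Set (Pt (n + 1))} (hA : MeasurableSet A) :
    volume A = ∫⁻ s, volume {z | lineAt k s z ∈ A} := by
  rw [← lintegral_indicator_one hA, lintegral_slice k (measurable_one.indicator hA)]
  refine lintegral_congr fun z => ?_
  exact lintegral_indicator_one (hA.preimage (measurable_lineAt_right k z))

lemma measurable_volume_line (k : Fin (n + 1)) {A : Set (Pt (n + 1))} (hA : MeasurableSet A) :
    Measurable fun z => volume {s | lineAt k s z ∈ A} :=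
  measurable_measure_prodMk_right (hA.preimage (lineEquiv k).measurable)

lemma measurable_volume_slice (k : Fin (n + 1)) {A : Set (Pt (n + 1))} (hA : MeasurableSet A) :
    Measurable fun s => volume {z | lineAt k s z ∈ A} :=
  measurable_measure_prodMk_left (hA.preimage (lineEquiv k).measurable)

lemma ae_line (k : Fin (n + 1)) {p : Pt (n + 1) → Prop} (h : ∀ᵐ x, p x) :
    ∀ᵐ z, ∀ᵐ s, p (lineAt k s z) := by
  have h1 := (measurePreserving_lineEquiv k).quasiMeasurePreserving.ae h
  have h2 := (Measure.measurePreserving_swap (μ := (volume : Measure (Fin n → ℝ)))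
    (ν := (volume : Measure ℝ))).quasiMeasurePreserving.ae h1
  exact Measure.ae_ae_of_ae_prod h2

lemma ae_slice (k : Fin (n + 1)) {p : Pt (n + 1) → Prop} (h : ∀ᵐ x, p x) :
    ∀ᵐ s, ∀ᵐ z, p (lineAt k s z) :=
  Measure.ae_ae_of_ae_prod ((measurePreserving_lineEquiv k).quasiMeasurePreserving.ae h)

lemma hausdorff_pi_eq : (μH[(n : ℝ)] : Measure (Fin n → ℝ)) = volume := by
  have := hausdorffMeasure_pi_real (ι := Fin n)
  rwa [Fintype.card_fin] at this

lemma volume_shadow_le (k : Fin (n + 1)) (A : Set (Pt (n + 1))) :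
    volume (shadow k '' A) ≤ μH[(n : ℝ)] A := by
  rw [← hausdorff_pi_eq]
  have := (shadow_lipschitz k).hausdorffMeasure_image_le (d := n) (by positivity) A
  simpa using this

lemma exists_hausdorff_slice_le (n : ℕ) : ∃ C : ℝ≥0∞, C ≠ ⊤ ∧ ∀ (k : Fin (n + 1)) (s : ℝ)
    (D : Set (Fin n → ℝ)), μH[(n : ℝ)] (lineAt k s '' D) ≤ C * volume D := by
  have h := PiLp.lipschitzWith_toLp 2 (fun _ : Fin (n + 1) => ℝ)
  generalize hK : ((Fintype.card (Fin (n + 1)) : ℝ≥0) ^ (1 / 2 : ℝ≥0∞).toReal) = K at h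
  refine ⟨(K : ℝ≥0∞) ^ (n : ℝ), by simp, fun k s D => ?_⟩
  have h2 : LipschitzWith 1 fun z : Fin n → ℝ => Fin.insertNth (α := fun _ => ℝ) k s z := by
    refine LipschitzWith.of_dist_le_mul fun x y => ?_
    rw [NNReal.coe_one, one_mul, dist_pi_le_iff dist_nonneg]
    intro j
    rcases Fin.eq_self_or_eq_succAbove k j with rfl | ⟨i, rfl⟩
    · simp
    · simpa using dist_le_pi_dist x y i
  have h3 : LipschitzWith K (lineAt (n := n) k s) := by
    have := h.comp h2
    rwa [mul_one] at this
  rw [← hausdorff_pi_eq]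
  exact h3.hausdorffMeasure_image_le (by positivity) D

lemma exists_hausdorff_eq_smul (N : ℕ) : ∃ κ : ℝ≥0∞, κ ≠ 0 ∧ κ ≠ ⊤ ∧
    (μH[(N : ℝ)] : Measure (Pt N)) = κ • volume := by
  have : (μH[(N : ℝ)] : Measure (Pt N)).IsAddHaarMeasure := by
    have := isAddHaarMeasure_hausdorffMeasure (E := Pt N)
    rwa [finrank_euclideanSpace_fin] at this
  have h := Measure.isAddLeftInvariant_eq_smul (μH[(N : ℝ)] : Measure (Pt N))
    (volume : Measure (Pt N))
  refine ⟨_, ?_, ?_, h⟩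
  · simpa using (Measure.addHaarScalarFactor_pos_of_isAddHaarMeasure _ _).ne'
  · simp

lemma volume_preimage_le {K : ℝ≥0} {Ψ : Pt N → Pt N} (hΨ : AntilipschitzWith K Ψ)
    (A : Set (Pt N)) : volume (Ψ ⁻¹' A) ≤ (K : ℝ≥0∞) ^ N * volume A := by
  obtain ⟨κ, h0, ht, h⟩ := exists_hausdorff_eq_smul N
  have := hΨ.hausdorffMeasure_preimage_le (d := N) (by positivity) A
  rw [h] at this
  simp only [Measure.smul_apply, smul_eq_mul, ENNReal.rpow_natCast] at this
  rw [mul_left_comm] at this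
  exact (ENNReal.mul_le_mul_iff_right h0 ht).1 this

lemma exists_first_exit_right {C : Set ℝ} (hC : IsClosed C) {p b : ℝ} (hp : p ∈ C) (hb : b ∉ C)
    (hpb : p < b) : ∃ y ∈ C, p ≤ y ∧ y < b ∧ ∀ t ∈ Ioo y b, t ∉ C := by
  have hcomp : IsCompact (C ∩ Icc p b) := isCompact_Icc.inter_left hC
  obtain ⟨y, hy, hmax⟩ := hcomp.exists_isGreatest ⟨p, hp, le_rfl, hpb.le⟩
  refine ⟨y, hy.1, hy.2.1, lt_of_le_of_ne hy.2.2 (fun h => hb (h ▸ hy.1)), fun t ht htC => ?_⟩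
  exact absurd (hmax ⟨htC, hy.2.1.trans ht.1.le, ht.2.le⟩) (not_le.2 ht.1)

lemma exists_first_exit_left {C : Set ℝ} (hC : IsClosed C) {p b : ℝ} (hp : p ∈ C) (hb : b ∉ C)
    (hpb : b < p) : ∃ y ∈ C, y ≤ p ∧ b < y ∧ ∀ t ∈ Ioo b y, t ∉ C := by
  have hcomp : IsCompact (C ∩ Icc b p) := isCompact_Icc.inter_left hC
  obtain ⟨y, hy, hmin⟩ := hcomp.exists_isLeast ⟨p, hp, hpb.le, le_rfl⟩
  refine ⟨y, hy.1, hy.2.2, lt_of_le_of_ne hy.2.1 (fun h => hb (h ▸ hy.1)), fun t ht htC => ?_⟩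
  exact absurd (hmin ⟨htC, ht.1.le, ht.2.le.trans hy.2.2⟩) (not_le.2 ht.2)

lemma one_sided_of_interior {A B I U : Set ℝ} {a b : ℝ} (hcov : Icc a b ⊆ A ∪ B)
    (hIB : Disjoint I B) (hU : IsOpen U)
    (hne : (U ∩ (closure (A ∩ Icc a b) ∩ closure (B ∩ Icc a b))).Nonempty)
    (hsub : U ∩ (closure (A ∩ Icc a b) ∩ closure (B ∩ Icc a b)) ⊆ I) :
    ∃ y ∈ I, ∃ t > 0, Ioo y (y + t) ⊆ B ∨ Ioo (y - t) y ⊆ B := by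
  obtain ⟨p, hpU, hpA, hpB⟩ := hne
  obtain ⟨ρ, hρ, hball⟩ := Metric.isOpen_iff.1 hU p hpU
  obtain ⟨b0, hb0, hd⟩ := Metric.mem_closure_iff.1 hpB ρ hρ
  have hK : closure (A ∩ Icc a b) ⊆ Icc a b :=
    closure_minimal inter_subset_right isClosed_Icc
  have hb0U : b0 ∈ U := hball (by rwa [mem_ball, dist_comm])
  have hb0A : b0 ∉ closure (A ∩ Icc a b) := fun h =>
    hIB.le_bot ⟨hsub ⟨hb0U, h, subset_closure hb0⟩, hb0.1⟩
  have hin : ∀ t ∈ Icc a b, t ∉ closure (A ∩ Icc a b) → t ∈ B := fun t ht hn =>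
    (hcov ht).resolve_left fun h => hn (subset_closure ⟨h, ht⟩)
  rw [Real.dist_eq] at hd
  have hd' := abs_lt.1 hd
  have hpK := hK hpA
  rcases lt_trichotomy p b0 with h | h | h
  · obtain ⟨y, hy, h1, h2, h3⟩ := exists_first_exit_right isClosed_closure hpA hb0A h
    have hsubB : Ioo y b0 ⊆ B := fun t ht =>
      hin t ⟨(hpK.1.trans h1).trans ht.1.le, ht.2.le.trans hb0.2.2⟩ (h3 t ht)
    have hyB : y ∈ closure (B ∩ Icc a b) := by
      have : y ∈ closure (Ioo y b0) := by rw [closure_Ioo h2.ne]; exact ⟨le_rfl, h2.le⟩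
      exact closure_mono (t := B ∩ Icc a b) (fun t ht =>
        ⟨hsubB ht, (hpK.1.trans h1).trans ht.1.le, ht.2.le.trans hb0.2.2⟩) this
    refine ⟨y, hsub ⟨hball ?_, hy, hyB⟩, b0 - y, by linarith, Or.inl ?_⟩
    · rw [mem_ball, Real.dist_eq, abs_lt]; constructor <;> linarith
    · rwa [add_sub_cancel]
  · exact absurd (h ▸ hpA) hb0A
  · obtain ⟨y, hy, h1, h2, h3⟩ := exists_first_exit_left isClosed_closure hpA hb0A h
    have hsubB : Ioo b0 y ⊆ B := fun t ht =>
      hin t ⟨hb0.2.1.trans ht.1.le, (ht.2.le.trans h1).trans hpK.2⟩ (h3 t ht)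
    have hyB : y ∈ closure (B ∩ Icc a b) := by
      have : y ∈ closure (Ioo b0 y) := by rw [closure_Ioo h2.ne]; exact ⟨h2.le, le_rfl⟩
      exact closure_mono (t := B ∩ Icc a b) (fun t ht =>
        ⟨hsubB ht, hb0.2.1.trans ht.1.le, (ht.2.le.trans h1).trans hpK.2⟩) this
    refine ⟨y, hsub ⟨hball ?_, hy, hyB⟩, y - b0, by linarith, Or.inr ?_⟩
    · rw [mem_ball, Real.dist_eq, abs_lt]; constructor <;> linarith
    · rwa [sub_sub_cancel]

/-- A Baire category argument: two sets covering an interval, each contained in a countable union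
of closed sets separated from the other one, meet along a one-sided interval. -/
lemma exists_one_sided {A B : Set ℝ} {a b : ℝ} {I O : ℕ → Set ℝ} (hcov : Icc a b ⊆ A ∪ B)
    (hA : (Icc a b ∩ A).Nonempty) (hB : (Icc a b ∩ B).Nonempty)
    (hI : ∀ q, IsClosed (I q)) (hO : ∀ q, IsClosed (O q)) (hAI : A ⊆ ⋃ q, I q)
    (hBO : B ⊆ ⋃ q, O q) (hIB : ∀ q, Disjoint (I q) B) (hOA : ∀ q, Disjoint (O q) A) :
    (∃ q, ∃ y ∈ I q, ∃ t > 0, Ioo y (y + t) ⊆ B ∨ Ioo (y - t) y ⊆ B) ∨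
    (∃ q, ∃ y ∈ O q, ∃ t > 0, Ioo y (y + t) ⊆ A ∨ Ioo (y - t) y ⊆ A) := by
  set Z := closure (A ∩ Icc a b) ∩ closure (B ∩ Icc a b) with hZ
  have hZc : IsClosed Z := isClosed_closure.inter isClosed_closure
  have hZK : Z ⊆ Icc a b := inter_subset_left.trans
    (closure_minimal inter_subset_right isClosed_Icc)
  have hZne : Z.Nonempty := by
    have := isPreconnected_closed_iff.1 (isPreconnected_Icc (a := a) (b := b))
      (closure (A ∩ Icc a b)) (closure (B ∩ Icc a b)) isClosed_closure isClosed_closure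
      (fun t ht => (hcov ht).imp (fun h => subset_closure ⟨h, ht⟩)
        (fun h => subset_closure ⟨h, ht⟩))
      (hA.mono fun t ht => ⟨ht.1, subset_closure ⟨ht.2, ht.1⟩⟩)
      (hB.mono fun t ht => ⟨ht.1, subset_closure ⟨ht.2, ht.1⟩⟩)
    exact this.mono inter_subset_right
  have : Nonempty Z := hZne.to_subtype
  have : CompleteSpace Z := hZc.completeSpace_coe
  obtain ⟨i, hi⟩ := nonempty_interior_of_iUnion_of_closed
    (X := Z) (ι := ℕ ⊕ ℕ) (f := fun i => Subtype.val ⁻¹' (Sum.elim I O i))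
    (by
      rintro (q | q)
      · exact (hI q).preimage continuous_subtype_val
      · exact (hO q).preimage continuous_subtype_val)
    (by
      refine eq_univ_of_forall fun x => ?_
      rcases hcov (hZK x.2) with h | h
      · obtain ⟨q, hq⟩ := mem_iUnion.1 (hAI h)
        exact mem_iUnion.2 ⟨Sum.inl q, hq⟩
      · obtain ⟨q, hq⟩ := mem_iUnion.1 (hBO h)
        exact mem_iUnion.2 ⟨Sum.inr q, hq⟩)
  obtain ⟨x, hx⟩ := hi
  obtain ⟨V, hVsub, hV, hxV⟩ := mem_interior.1 hx
  obtain ⟨U, hU, rfl⟩ := isOpen_induced_iff.1 hV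
  have hne : (U ∩ Z).Nonempty := ⟨x, hxV, x.2⟩
  rcases i with q | q
  · left
    exact ⟨q, one_sided_of_interior hcov (hIB q) hU hne fun t ht => @hVsub ⟨t, ht.2⟩ ht.1⟩
  · right
    refine ⟨q, one_sided_of_interior (a := a) (b := b) (by rwa [union_comm]) (hOA q) hU ?_ ?_⟩
    · rwa [inter_comm (closure _)]
    · rw [inter_comm (closure _)]
      exact fun t ht => @hVsub ⟨t, ht.2⟩ ht.1

lemma zeroDens_disjoint_thinPts {E : Set (Pt N)} {c δ : ℝ} (hc : c ≤ 1 / 4) (hδ : 0 < δ)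
    {x : Pt N} (hx : x ∈ zeroDens E) : x ∉ thinPts Eᶜ (ENNReal.ofReal c) δ := by
  intro ht
  obtain ⟨δ', hδ', h'⟩ := mem_zeroDens_iff.1 hx (ENNReal.ofReal (1 / 4)) (by simp)
  have hr : 0 < min δ δ' / 2 := by positivity
  have h1 := ht (min δ δ' / 2) ⟨hr, by linarith [min_le_left δ δ']⟩
  have h2 := h' (min δ δ' / 2) ⟨hr, by linarith [min_le_right δ δ']⟩
  set V := volume (ball x (min δ δ' / 2)) with hV
  have h3 : V ≤ ENNReal.ofReal (1 / 2) * V := by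
    calc V ≤ volume (E ∩ ball x (min δ δ' / 2)) + volume (Eᶜ ∩ ball x (min δ δ' / 2)) := by
          refine (measure_mono ?_).trans (measure_union_le _ _)
          intro y hy
          by_cases hyE : y ∈ E
          · exact Or.inl ⟨hyE, hy⟩
          · exact Or.inr ⟨hyE, hy⟩
      _ ≤ ENNReal.ofReal (1 / 4) * V + ENNReal.ofReal (1 / 4) * V :=
          add_le_add h2 (h1.trans (by gcongr))
      _ = ENNReal.ofReal (1 / 2) * V := by
          rw [← add_mul, ← ENNReal.ofReal_add (by norm_num) (by norm_num)]; norm_num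
  have h0 := volume_ball_ne_zero x hr
  have ht := volume_ball_ne_top x (min δ δ' / 2)
  have h4 : (1 : ℝ≥0∞) ≤ ENNReal.ofReal (1 / 2) := by
    rw [← ENNReal.mul_le_mul_iff_left h0 ht, one_mul]; exact h3
  rw [ENNReal.one_le_ofReal] at h4
  norm_num at h4

/-- A dimensional threshold for the thinness of sets in the crossing argument. -/
lemma exists_thin_const (n : ℕ) : ∃ c : ℝ, 0 < c ∧ c ≤ 1 / 4 ∧
    ENNReal.ofReal c * volume (ball (0 : Pt (n + 1)) (3 * √(n + 1))) ≤ ENNReal.ofReal (1 / 4) := by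
  set V := (volume (ball (0 : Pt (n + 1)) (3 * √(n + 1)))).toReal with hV
  have hVe : volume (ball (0 : Pt (n + 1)) (3 * √(n + 1))) = ENNReal.ofReal V :=
    (ENNReal.ofReal_toReal (volume_ball_ne_top _ _)).symm
  have hV0 : 0 ≤ V := ENNReal.toReal_nonneg
  refine ⟨1 / (4 * (V + 1)), by positivity, ?_, ?_⟩
  · apply one_div_le_one_div_of_le <;> linarith
  · rw [hVe, ← ENNReal.ofReal_mul (by positivity)]
    apply ENNReal.ofReal_le_ofReal
    rw [div_mul_eq_mul_div, div_le_div_iff₀ (by positivity) (by norm_num)]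
    linarith

/-- A set meeting at least half of a small cube cannot have, above each point of it, a long
segment inside `D` next to a point where `D` is thin. -/
lemma thin_segment_cube {D : Set (Pt (n + 1))} (hD : MeasurableSet D) (k : Fin (n + 1))
    {c δ ρ σ h : ℝ} (hσ : σ = 1 ∨ σ = -1) (hρ : 0 < ρ)
    (hc : ENNReal.ofReal c * volume (ball (0 : Pt (n + 1)) (3 * √(n + 1))) ≤
      ENNReal.ofReal (1 / 4)) (hδ : 3 * √(n + 1) * ρ < δ)
    {z0 z1 : Fin n → ℝ} {s1 : ℝ} (hz1 : z1 ∈ closedBall z0 ρ) (hs1 : |σ * s1 - h| ≤ ρ)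
    (hthin : lineAt k s1 z1 ∈ thinPts D (ENNReal.ofReal c) δ)
    {G : Set (Fin n → ℝ)} (hG : ∀ z ∈ G, ∀ᵐ s, σ * s ∈ Ioo h (h + ρ) → lineAt k s z ∈ D) :
    volume (G ∩ closedBall z0 ρ) ≤ ENNReal.ofReal (1 / 4) * volume (closedBall z0 ρ) := by
  set J : Set ℝ := {s | σ * s ∈ Ioo h (h + ρ)} with hJ
  have hJm : MeasurableSet J := measurableSet_Ioo.preimage (measurable_const_mul σ)
  have hJv : volume J = ENNReal.ofReal ρ := by
    rcases hσ with rfl | rfl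
    · have : J = Ioo h (h + ρ) := by ext s; simp [hJ]
      rw [this, Real.volume_Ioo]; congr 1; ring
    · have : J = Ioo (-(h + ρ)) (-h) := by
        ext s; simp only [hJ, mem_ofPred_eq, mem_Ioo]
        constructor <;> rintro ⟨h1, h2⟩ <;> constructor <;> linarith
      rw [this, Real.volume_Ioo]; congr 1; ring
  set Q : Set (Pt (n + 1)) := D ∩ {x | x k ∈ J ∧ shadow k x ∈ closedBall z0 ρ} with hQ
  have hQm : MeasurableSet Q := by
    refine hD.inter (MeasurableSet.inter (hJm.preimage ?_)
      (measurableSet_closedBall.preimage (measurable_shadow k)))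
    fun_prop
  have hlow : ENNReal.ofReal ρ * volume (G ∩ closedBall z0 ρ) ≤ volume Q := by
    rw [volume_eq_line k hQm]
    refine le_trans ?_ (mul_meas_ge_le_lintegral (measurable_volume_line k hQm) (ENNReal.ofReal ρ))
    gcongr
    rintro z ⟨hzG, hzB⟩
    change ENNReal.ofReal ρ ≤ volume {s | lineAt k s z ∈ Q}
    rw [← hJv]
    refine measure_mono_ae ?_
    filter_upwards [hG z hzG] with s hs hsJ
    refine ⟨hs hsJ, ?_, by simpa using hzB⟩
    rw [lineAt_same]
    exact hsJ
  have hsubQ : Q ⊆ D ∩ ball (lineAt k s1 z1) (3 * √(n + 1) * ρ) := by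
    rintro x ⟨hxD, hxJ, hxB⟩
    refine ⟨hxD, ?_⟩
    have h1 : |x k - s1| ≤ 2 * ρ := by
      have h2 : |σ * x k - σ * s1| ≤ 2 * ρ := by
        have := abs_le.1 hs1
        have h3 : h < σ * x k ∧ σ * x k < h + ρ := hxJ
        rw [abs_le]; constructor <;> linarith [h3.1, h3.2]
      rw [← mul_sub, abs_mul] at h2
      rcases hσ with rfl | rfl <;> simpa using h2
    have h2 : dist (shadow k x) z1 ≤ 2 * ρ := by
      have := dist_triangle_right (shadow k x) z1 z0
      rw [mem_closedBall] at hz1 hxB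
      linarith
    have h3 := dist_le_of_coord (x := x) (y := lineAt k s1 z1) (r := 2 * ρ) k (by simpa using h1)
      (by simpa using h2)
    have h4 : 0 < √((n : ℝ) + 1) := Real.sqrt_pos.2 (by positivity)
    rw [mem_ball]
    nlinarith [mul_pos h4 hρ]
  have h4 : 0 < √((n : ℝ) + 1) := Real.sqrt_pos.2 (by positivity)
  have hup : volume Q ≤ ENNReal.ofReal (1 / 4) * ENNReal.ofReal (ρ ^ (n + 1)) := by
    refine (measure_mono hsubQ).trans ((hthin _ ⟨by positivity, hδ⟩).trans ?_)
    rw [mul_comm _ ρ, Measure.addHaar_ball_mul _ _ hρ.le, finrank_euclideanSpace_fin]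
    calc _ = (ENNReal.ofReal c * volume (ball (0 : Pt (n + 1)) (3 * √(n + 1)))) *
          ENNReal.ofReal (ρ ^ (n + 1)) := by ring
      _ ≤ _ := by gcongr
  have hcb : volume (closedBall z0 ρ) = ENNReal.ofReal ((2 * ρ) ^ n) := by
    rw [Real.volume_pi_closedBall _ hρ.le, Fintype.card_fin]
  have h5 := hlow.trans hup
  have hρ0 : ENNReal.ofReal ρ ≠ 0 := by simpa using hρ
  rw [pow_succ', ENNReal.ofReal_mul hρ.le, mul_left_comm,
    ENNReal.mul_le_mul_iff_right hρ0 ENNReal.ofReal_ne_top] at h5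
  refine h5.trans ?_
  rw [hcb]
  gcongr
  linarith

lemma ae_line_notMem {E : Set (Pt (n + 1))} (hE : MeasurableSet E) (k : Fin (n + 1)) :
    ∀ᵐ z, ∀ᵐ s, lineAt k s z ∈ zeroDens E → lineAt k s z ∉ E := by
  refine ae_line k (p := fun x => x ∈ zeroDens E → x ∉ E) ?_
  filter_upwards [ae_mem_zeroDens_compl hE] with x hx h0 hxE
  exact notMem_zeroDens_compl h0 (hx hxE)

lemma null_thin_segment {E : Set (Pt (n + 1))} (hE : MeasurableSet E) (k : Fin (n + 1))
    {c δ σ : ℝ} (hσ : σ = 1 ∨ σ = -1) (hδ : 0 < δ)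
    (hc : ENNReal.ofReal c * volume (ball (0 : Pt (n + 1)) (3 * √(n + 1))) ≤
      ENNReal.ofReal (1 / 4)) :
    ∀ᵐ z, ¬ ∃ s, lineAt k s z ∈ thinPts Eᶜ (ENNReal.ofReal c) δ ∧
      ∀ t ∈ Ioo 0 δ, lineAt k (s + σ * t) z ∈ zeroDens E := by
  have hσσ : σ * σ = 1 := by rcases hσ with rfl | rfl <;> norm_num
  set P : (Fin n → ℝ) → ℝ → Prop := fun z s => lineAt k s z ∈ thinPts Eᶜ (ENNReal.ofReal c) δ ∧
      ∀ t ∈ Ioo 0 δ, lineAt k (s + σ * t) z ∈ zeroDens E with hP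
  set G' : Set (Fin n → ℝ) := {z | ∀ᵐ s, lineAt k s z ∈ zeroDens E → lineAt k s z ∉ E} with hG'
  set w := δ / 2 with hw
  have hw0 : 0 < w := by positivity
  have hnull : ∀ j : ℤ, ∀ᵐ z, z ∈ G' → ¬ ∃ s, σ * s ∈ Ico (j * w) ((j + 1) * w) ∧ P z s := by
    intro j
    set G : Set (Fin n → ℝ) := {z | z ∈ G' ∧ ∃ s, σ * s ∈ Ico (j * w) ((j + 1) * w) ∧ P z s}
      with hG
    have hG0 : volume G = 0 := by
      by_contra hne
      have hd := Besicovitch.ae_tendsto_measure_inter_div (volume : Measure (Fin n → ℝ)) G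
      have : (ae (volume.restrict G)).NeBot := by
        rw [ae_neBot]; intro h; apply hne; rwa [Measure.restrict_eq_zero] at h
      obtain ⟨z0, hz0⟩ := hd.exists
      have hev : ∀ᶠ ρ in 𝓝[>] (0:ℝ), ENNReal.ofReal (1 / 4) <
          volume (G ∩ closedBall z0 ρ) / volume (closedBall z0 ρ) :=
        hz0.eventually (lt_mem_nhds (by
          rw [← ENNReal.ofReal_one]; exact (ENNReal.ofReal_lt_ofReal_iff one_pos).2 (by norm_num)))
      have h4 : 0 < √((n : ℝ) + 1) := Real.sqrt_pos.2 (by positivity)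
      have hsm : ∀ᶠ ρ in 𝓝[>] (0:ℝ), ρ < min w (δ / (3 * √(n + 1))) :=
        mem_nhdsWithin_of_mem_nhds (Iio_mem_nhds (by positivity))
      obtain ⟨ρ, ⟨h1, h2⟩, hρ⟩ := ((hev.and hsm).and self_mem_nhdsWithin).exists
      have hρ0 : 0 < ρ := hρ
      have hρw : ρ < w := h2.trans_le (min_le_left _ _)
      have hρδ : 3 * √(n + 1) * ρ < δ := by
        have := h2.trans_le (min_le_right _ _)
        rw [lt_div_iff₀ (by positivity)] at this
        linarith
      set S : Set ℝ := {u | ∃ z ∈ G ∩ closedBall z0 ρ, ∃ s, σ * s = u ∧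
        σ * s ∈ Ico (j * w) ((j + 1) * w) ∧ P z s} with hS
      have hne' : (G ∩ closedBall z0 ρ).Nonempty := by
        rw [nonempty_iff_ne_empty]; intro he
        rw [he] at h1; simp at h1
      have hSne : S.Nonempty := by
        obtain ⟨z, hz⟩ := hne'
        obtain ⟨s, hs⟩ := hz.1.2
        exact ⟨σ * s, z, hz, s, rfl, hs⟩
      have hSb : BddAbove S := ⟨(j + 1) * w, by
        rintro _ ⟨z, _, s, rfl, hs, _⟩; exact hs.2.le⟩
      obtain ⟨u, hu, hlt⟩ := exists_lt_of_lt_csSup hSne (sub_lt_self (sSup S) hρ0)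
      obtain ⟨z1, hz1, s1, rfl, hs1, hP1⟩ := hu
      have hle := le_csSup hSb ⟨z1, hz1, s1, rfl, hs1, hP1⟩
      have := thin_segment_cube hE.compl k (c := c) (δ := δ) (ρ := ρ) (σ := σ) (h := sSup S)
        hσ hρ0 hc hρδ hz1.2 (s1 := s1) (by rw [abs_le]; constructor <;> linarith) hP1.1
        (G := G ∩ closedBall z0 ρ) (by
          intro z hz
          obtain ⟨s, hs, hPs⟩ := hz.1.2
          have hsle := le_csSup hSb ⟨z, hz, s, rfl, hs, hPs⟩
          have hSle : sSup S ≤ (j + 1) * w := csSup_le hSne (by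
            rintro _ ⟨z, _, s, rfl, hs, _⟩; exact hs.2.le)
          filter_upwards [hz.1.1] with s' hs' hI
          refine hs' ?_
          have := hPs.2 (σ * s' - σ * s) ⟨by linarith [hI.1], by
            have := hI.2; have := hs.1; nlinarith⟩
          rwa [← mul_sub, ← mul_assoc, hσσ, one_mul, add_sub_cancel] at this)
      rw [inter_assoc, inter_self] at this
      refine absurd h1 (not_lt.2 (ENNReal.div_le_of_le_mul this))
    filter_upwards [measure_eq_zero_iff_ae_notMem.1 hG0] with z hz hz' hex
    exact hz ⟨hz', hex⟩
  filter_upwards [ae_line_notMem hE k, ae_all_iff.2 hnull] with z hz hz2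
  rintro ⟨s, hs⟩
  refine hz2 ⌊σ * s / w⌋ hz ⟨s, ⟨?_, ?_⟩, hs⟩
  · have := Int.floor_le (σ * s / w)
    rwa [le_div_iff₀ hw0] at this
  · have := Int.lt_floor_add_one (σ * s / w)
    rwa [div_lt_iff₀ hw0] at this

lemma continuous_lineAt (k : Fin (n + 1)) (z : Fin n → ℝ) : Continuous fun s => lineAt k s z := by
  refine (PiLp.continuous_toLp 2 _).comp ?_
  exact Continuous.finInsertNth k continuous_id continuous_const

/-- On almost every line, a density-one point and a density-zero point of `E` are separated by a
point of the essential boundary. -/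
lemma ae_line_crossing {E : Set (Pt (n + 1))} (hE : MeasurableSet E) (k : Fin (n + 1)) :
    ∀ᵐ z, ∀ s₁ s₂, lineAt k s₁ z ∈ zeroDens Eᶜ → lineAt k s₂ z ∈ zeroDens E →
      ∃ s ∈ uIcc s₁ s₂, lineAt k s z ∈ essBdry E := by
  obtain ⟨c, hc0, hc4, hc⟩ := exists_thin_const n
  have key : ∀ F : Set (Pt (n + 1)), MeasurableSet F → ∀ᵐ z, ∀ q : ℕ, ∀ σ : ℝ, (σ = 1 ∨ σ = -1) →
      ¬ ∃ s, lineAt k s z ∈ thinPts Fᶜ (ENNReal.ofReal c) (1 / ((q : ℝ) + 1)) ∧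
      ∀ t ∈ Ioo 0 (1 / ((q : ℝ) + 1)), lineAt k (s + σ * t) z ∈ zeroDens F := by
    intro F hF
    refine ae_all_iff.2 fun q => ?_
    have h1 := null_thin_segment hF k (σ := 1) (Or.inl rfl)
      (δ := 1 / ((q : ℝ) + 1)) (by positivity) hc
    have h2 := null_thin_segment hF k (σ := -1) (Or.inr rfl)
      (δ := 1 / ((q : ℝ) + 1)) (by positivity) hc
    filter_upwards [h1, h2] with z hz1 hz2 σ hσ
    rcases hσ with rfl | rfl
    · exact hz1
    · exact hz2
  have key2 : ∀ F : Set (Pt (n + 1)), ∀ z : Fin n → ℝ, (∀ q : ℕ, ∀ σ : ℝ, (σ = 1 ∨ σ = -1) →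
      ¬ ∃ s, lineAt k s z ∈ thinPts Fᶜ (ENNReal.ofReal c) (1 / ((q : ℝ) + 1)) ∧
      ∀ t ∈ Ioo 0 (1 / ((q : ℝ) + 1)), lineAt k (s + σ * t) z ∈ zeroDens F) →
      ¬ ∃ q : ℕ, ∃ y ∈ {s | lineAt k s z ∈ thinPts Fᶜ (ENNReal.ofReal c) (1 / ((q : ℝ) + 1))},
        ∃ t > 0, Ioo y (y + t) ⊆ {s | lineAt k s z ∈ zeroDens F} ∨
          Ioo (y - t) y ⊆ {s | lineAt k s z ∈ zeroDens F} := by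
    rintro F z h ⟨q, y, hy, t, ht, hsub⟩
    obtain ⟨p, hp⟩ := exists_nat_one_div_lt (lt_min ht (by positivity : 0 < 1 / ((q : ℝ) + 1)))
    have hth : lineAt k y z ∈ thinPts Fᶜ (ENNReal.ofReal c) (1 / ((p : ℝ) + 1)) := fun r hr =>
      hy r ⟨hr.1, hr.2.trans (hp.trans_le (min_le_right _ _))⟩
    have hpt := hp.trans_le (min_le_left _ _)
    rcases hsub with hsub | hsub
    · exact h p 1 (Or.inl rfl) ⟨y, hth, fun u hu => hsub ⟨by linarith [hu.1], by linarith [hu.2]⟩⟩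
    · exact h p (-1) (Or.inr rfl)
        ⟨y, hth, fun u hu => hsub ⟨by linarith [hu.2], by linarith [hu.1]⟩⟩
  filter_upwards [key E hE, key Eᶜ hE.compl] with z hz1 hz2 s₁ s₂ hs₁ hs₂
  by_contra! hno
  have hcl : ∀ (F : Set (Pt (n + 1))) (q : ℕ),
      IsClosed {s | lineAt k s z ∈ thinPts F (ENNReal.ofReal c) (1 / ((q : ℝ) + 1))} := fun F q =>
    (isClosed_thinPts F).preimage (continuous_lineAt k z)
  have hcovq : ∀ F : Set (Pt (n + 1)), {s | lineAt k s z ∈ zeroDens F} ⊆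
      ⋃ q : ℕ, {s | lineAt k s z ∈ thinPts F (ENNReal.ofReal c) (1 / ((q : ℝ) + 1))} := by
    intro F s hs
    obtain ⟨δ, hδ, h⟩ := mem_zeroDens_iff.1 hs (ENNReal.ofReal c) (by simpa using hc0)
    obtain ⟨q, hq⟩ := exists_nat_one_div_lt hδ
    exact mem_iUnion.2 ⟨q, fun r hr => h r ⟨hr.1, hr.2.trans hq⟩⟩
  have hdis : ∀ (F : Set (Pt (n + 1))) (q : ℕ),
      Disjoint {s | lineAt k s z ∈ thinPts Fᶜ (ENNReal.ofReal c) (1 / ((q : ℝ) + 1))}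
        {s | lineAt k s z ∈ zeroDens F} := fun F q =>
    disjoint_left.2 fun s h1 h2 => zeroDens_disjoint_thinPts hc4 (by positivity) h2 h1
  have hdis' := hdis Eᶜ
  rw [compl_compl] at hdis'
  rcases exists_one_sided (A := {s | lineAt k s z ∈ zeroDens Eᶜ})
    (B := {s | lineAt k s z ∈ zeroDens E}) (a := min s₁ s₂) (b := max s₁ s₂)
    (fun s hs => by
      have := hno s hs
      rw [essBdry_eq hE, mem_compl_iff, not_not] at this
      exact this.symm)
    ⟨s₁, ⟨min_le_left _ _, le_max_left _ _⟩, hs₁⟩ ⟨s₂, ⟨min_le_right _ _, le_max_right _ _⟩, hs₂⟩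
    (hcl Eᶜ) (hcl E) (hcovq Eᶜ) (hcovq E) (hdis E) hdis' with h | h
  · exact key2 E z hz1 h
  · exact key2 Eᶜ z hz2 (by rwa [compl_compl])

/-- Almost every line in a given direction meets a set of finite `n`-dimensional measure in
finitely many points. -/
lemma ae_line_finite {A : Set (Pt (n + 1))} (hA : MeasurableSet A) (hfin : μH[(n : ℝ)] A ≠ ⊤)
    (k : Fin (n + 1)) : ∀ᵐ z, {s | lineAt k s z ∈ A}.Finite := by
  set B : ℕ → ℤ → Set (Pt (n + 1)) := fun p j => A ∩ {x | ⌊((p : ℝ) + 1) * x k⌋ = j} with hB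
  have hcoord : Measurable fun x : Pt (n + 1) => x k := by fun_prop
  have hBm : ∀ p j, MeasurableSet (B p j) := fun p j =>
    hA.inter ((measurableSet_singleton j).preimage
      (Int.measurable_floor.comp (hcoord.const_mul ((p : ℝ) + 1))))
  set S : ℕ → ℤ → Set (Fin n → ℝ) := fun p j => toMeasurable volume (shadow k '' B p j) with hS
  set F : ℕ → (Fin n → ℝ) → ℝ≥0∞ := fun p z => ∑' j, (S p j).indicator 1 z with hF
  have hSm : ∀ p j, MeasurableSet (S p j) := fun p j => measurableSet_toMeasurable _ _
  have hFm : ∀ p, Measurable (F p) := fun p =>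
    Measurable.tsum fun j => measurable_one.indicator (hSm p j)
  have hbd : ∀ p, ∫⁻ z, F p z ≤ μH[(n : ℝ)] A := by
    intro p
    rw [lintegral_tsum fun j => (measurable_one.indicator (hSm p j)).aemeasurable]
    calc ∑' j, ∫⁻ z, (S p j).indicator 1 z = ∑' j, volume (shadow k '' B p j) := by
          congr 1; ext j
          rw [lintegral_indicator_one (hSm p j), measure_toMeasurable]
      _ ≤ ∑' j, μH[(n : ℝ)] (B p j) := ENNReal.tsum_le_tsum fun j => volume_shadow_le k _
      _ = μH[(n : ℝ)] (⋃ j, B p j) := by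
          refine (measure_iUnion ?_ (hBm p)).symm
          intro i j hij
          exact disjoint_left.2 fun x hi hj => hij (hi.2.symm.trans hj.2)
      _ ≤ μH[(n : ℝ)] A := measure_mono (iUnion_subset fun j => inter_subset_left)
  have hlim : ∀ᵐ z, liminf (fun p => F p z) atTop < ⊤ := by
    refine ae_lt_top (Measurable.liminf hFm) (ne_top_of_le_ne_top hfin ?_)
    refine (lintegral_liminf_le hFm).trans ?_
    refine liminf_le_of_le (by isBoundedDefault) fun b hb => ?_
    obtain ⟨p, hp⟩ := hb.exists
    exact hp.trans (hbd p)
  filter_upwards [hlim] with z hz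
  by_contra hinf
  have hinf : {s | lineAt k s z ∈ A}.Infinite := hinf
  have hge : ∀ K : ℕ, (K : ℝ≥0∞) ≤ liminf (fun p => F p z) atTop := by
    intro K
    obtain ⟨t, htA, htK⟩ := hinf.exists_subset_card_eq K
    refine le_liminf_of_le (by isBoundedDefault) ?_
    have hsep : ∀ᶠ p : ℕ in atTop, ∀ s ∈ t, ∀ s' ∈ t, s ≠ s' →
        ⌊((p : ℝ) + 1) * s⌋ ≠ ⌊((p : ℝ) + 1) * s'⌋ := by
      rw [Filter.eventually_all_finset]
      intro s hs
      rw [Filter.eventually_all_finset]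
      intro s' hs'
      by_cases hne : s = s'
      · exact Eventually.of_forall fun p h => absurd hne h
      have hpos : 0 < |s - s'| := abs_pos.2 (sub_ne_zero.2 hne)
      have htend : Tendsto (fun p : ℕ => (p : ℝ) * |s - s'|) atTop atTop :=
        tendsto_natCast_atTop_atTop.atTop_mul_const hpos
      filter_upwards [htend.eventually_ge_atTop 1] with p hp _ heq
      have h1 := Int.abs_sub_lt_one_of_floor_eq_floor heq
      rw [← mul_sub, abs_mul, abs_of_pos (by positivity : (0:ℝ) < (p : ℝ) + 1)] at h1
      linarith
    filter_upwards [hsep] with p hp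
    have hinj : Set.InjOn (fun s : ℝ => ⌊((p : ℝ) + 1) * s⌋) t := fun s hs s' hs' h => by
      by_contra hne; exact hp s hs s' hs' hne h
    calc (K : ℝ≥0∞) = ((t.image fun s : ℝ => ⌊((p : ℝ) + 1) * s⌋).card : ℝ≥0∞) := by
          rw [Finset.card_image_of_injOn hinj, htK]
      _ = ∑ j ∈ t.image fun s : ℝ => ⌊((p : ℝ) + 1) * s⌋, 1 := by simp
      _ = ∑ j ∈ t.image fun s : ℝ => ⌊((p : ℝ) + 1) * s⌋, (S p j).indicator 1 z := by
          refine Finset.sum_congr rfl fun j hj => ?_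
          obtain ⟨s, hs, rfl⟩ := Finset.mem_image.1 hj
          have : z ∈ S p ⌊((p : ℝ) + 1) * s⌋ := subset_toMeasurable _ _
            ⟨lineAt k s z, ⟨htA hs, by simp⟩, by simp⟩
          rw [indicator_of_mem this]; rfl
      _ ≤ F p z := ENNReal.sum_le_tsum _
  have : liminf (fun p => F p z) atTop = ⊤ := by
    refine ENNReal.eq_top_of_forall_nnreal_le fun r => ?_
    obtain ⟨K, hK⟩ := exists_nat_ge r
    refine le_trans ?_ (hge K)
    exact_mod_cast hK
  exact hz.ne this

/-- The base points of the lines in direction `k` meeting `F` in positive length. -/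
def lineShadow (k : Fin (n + 1)) (F : Set (Pt (n + 1))) : Set (Fin n → ℝ) :=
  {z | volume {s | lineAt k s z ∈ F} ≠ 0}

lemma measurableSet_lineShadow (k : Fin (n + 1)) {F : Set (Pt (n + 1))} (hF : MeasurableSet F) :
    MeasurableSet (lineShadow k F) :=
  ((measurableSet_singleton 0).preimage (measurable_volume_line k hF)).compl

lemma ae_shadow_mem_lineShadow (k : Fin (n + 1)) {F : Set (Pt (n + 1))} (hF : MeasurableSet F) :
    ∀ᵐ x, x ∈ F → shadow k x ∈ lineShadow k F := by
  set B := F ∩ shadow k ⁻¹' (lineShadow k F)ᶜ with hB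
  have hBm : MeasurableSet B :=
    hF.inter ((measurableSet_lineShadow k hF).compl.preimage (measurable_shadow k))
  have h0 : volume B = 0 := by
    rw [volume_eq_line k hBm, lintegral_eq_zero_iff (measurable_volume_line k hBm)]
    refine Eventually.of_forall fun z => ?_
    by_cases hz : z ∈ lineShadow k F
    · have : {s | lineAt k s z ∈ B} = ∅ := by
        ext s; simp [hB, hz]
      simp [this]
    · have h1 : volume {s | lineAt k s z ∈ F} = 0 := not_not.1 hz
      exact measure_mono_null (fun s hs => hs.1) h1
  filter_upwards [measure_eq_zero_iff_ae_notMem.1 h0] with x hx hxF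
  by_contra hn
  exact hx ⟨hxF, hn⟩

/-- A Loomis–Whitney type inequality. -/
lemma volume_rpow_le_sum_lineShadow (hn : 1 ≤ n) {F : Set (Pt (n + 1))} (hF : MeasurableSet F) :
    volume F ^ ((n : ℝ) / (n + 1)) ≤ ∑ k, volume (lineShadow k F) := by
  have hn0 : (0 : ℝ) < n := by exact_mod_cast hn
  have hconj : ((Fintype.card (Fin (n + 1)) : ℕ) : ℝ).HolderConjugate (((n : ℝ) + 1) / n) := by
    rw [Fintype.card_fin, Real.holderConjugate_iff]
    push_cast
    refine ⟨by linarith, ?_⟩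
    field_simp
    ring
  set sh : Fin (n + 1) → (Fin (n + 1) → ℝ) → (Fin n → ℝ) := fun k x i => x (k.succAbove i) with hsh
  have hshm : ∀ k, Measurable (sh k) := fun k => by fun_prop
  set φ : Fin (n + 1) → (Fin (n + 1) → ℝ) → ℝ≥0∞ := fun k x =>
    (lineShadow k F).indicator 1 (sh k x) * (Icc (0:ℝ) 1).indicator 1 (x k) with hφ
  have hLm : ∀ k, Measurable ((lineShadow k F).indicator (1 : (Fin n → ℝ) → ℝ≥0∞)) := fun k =>
    measurable_one.indicator (measurableSet_lineShadow k hF)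
  have hIm : Measurable ((Icc (0:ℝ) 1).indicator (1 : ℝ → ℝ≥0∞)) :=
    measurable_one.indicator measurableSet_Icc
  have hφm : ∀ k, Measurable (φ k) := fun k =>
    ((hLm k).comp (hshm k)).mul (hIm.comp (measurable_pi_apply k))
  have hmain := lintegral_prod_lintegral_pow_le (fun _ : Fin (n + 1) => (volume : Measure ℝ))
    hconj (f := fun x => ∑ k, φ k x) (Finset.measurable_fun_sum _ fun k _ => hφm k)
  have hIone : ∫⁻ s : ℝ, (Icc (0:ℝ) 1).indicator (1 : ℝ → ℝ≥0∞) s = 1 := by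
    rw [lintegral_indicator_one measurableSet_Icc]; simp
  have hR : ∫⁻ x, ∑ k, φ k x ∂(Measure.pi fun _ : Fin (n + 1) => (volume : Measure ℝ)) =
      ∑ k, volume (lineShadow k F) := by
    rw [lintegral_finsetSum _ fun k _ => hφm k]
    refine Finset.sum_congr rfl fun k _ => ?_
    rw [← volume_pi, ← (volume_preserving_piFinSuccAbove (fun _ => ℝ) k).symm.lintegral_comp (hφm k)]
    rw [Measure.volume_eq_prod]
    refine (lintegral_prod_symm' (fun p => φ k
      ((MeasurableEquiv.piFinSuccAbove (fun _ => ℝ) k).symm p))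
      ((hφm k).comp (MeasurableEquiv.measurable _))).trans ?_
    rw [← lintegral_indicator_one (measurableSet_lineShadow k hF)]
    refine lintegral_congr fun z => ?_
    have : ∀ s : ℝ, φ k ((MeasurableEquiv.piFinSuccAbove (fun _ => ℝ) k).symm (s, z)) =
        (lineShadow k F).indicator 1 z * (Icc (0:ℝ) 1).indicator 1 s := by
      intro s
      have : (MeasurableEquiv.piFinSuccAbove (fun _ => ℝ) k).symm (s, z) =
          Fin.insertNth (α := fun _ => ℝ) k s z := rfl
      simp [hφ, hsh, this]
    simp_rw [this]
    rw [lintegral_const_mul _ hIm, hIone, mul_one]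
  rw [hR] at hmain
  have hL : volume F ≤ ∫⁻ x, ∏ i, (∫⁻ xi, (fun x => ∑ k, φ k x) (Function.update x i xi)) ^
      ((1 : ℝ) / ((Fintype.card (Fin (n + 1)) : ℝ) - 1))
      ∂(Measure.pi fun _ : Fin (n + 1) => (volume : Measure ℝ)) := by
    have hFp := (PiLp.volume_preserving_toLp (Fin (n + 1))).measure_preimage hF.nullMeasurableSet
    have hF' : MeasurableSet (WithLp.toLp 2 ⁻¹' F : Set (Fin (n + 1) → ℝ)) :=
      hF.preimage (PiLp.volume_preserving_toLp (Fin (n + 1))).measurable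
    rw [← hFp, ← lintegral_indicator_one hF', volume_pi]
    refine lintegral_mono_ae ?_
    rw [← volume_pi]
    have hae := ae_all_iff.2 fun k => (PiLp.volume_preserving_toLp
      (Fin (n + 1))).quasiMeasurePreserving.ae (ae_shadow_mem_lineShadow k hF)
    filter_upwards [hae] with x hx
    by_cases hxF : WithLp.toLp 2 x ∈ F
    · have hxF' : x ∈ (WithLp.toLp 2 ⁻¹' F : Set (Fin (n + 1) → ℝ)) := hxF
      rw [indicator_of_mem hxF', Pi.one_apply]
      refine Finset.one_le_prod' fun i _ => ?_
      refine ENNReal.one_le_rpow ?_ (by rw [Fintype.card_fin]; push_cast; simpa using hn0)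
      rw [← hIone]
      refine lintegral_mono fun s => ?_
      refine le_trans ?_ (Finset.single_le_sum (f := fun k => φ k (Function.update x i s))
        (fun _ _ => zero_le) (Finset.mem_univ i))
      have hm : sh i (Function.update x i s) ∈ lineShadow i F := by
        have : sh i (Function.update x i s) = shadow i (WithLp.toLp 2 x) := by
          ext j; simp [hsh, shadow]
        rw [this]; exact hx i hxF
      simp [hφ, indicator_of_mem hm]
    · have : x ∉ (WithLp.toLp 2 ⁻¹' F : Set (Fin (n + 1) → ℝ)) := hxF
      rw [indicator_of_notMem this]; exact zero_le
  have := hL.trans hmain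
  calc volume F ^ ((n : ℝ) / (n + 1)) ≤
      ((∑ k, volume (lineShadow k F)) ^ (((n : ℝ) + 1) / n)) ^ ((n : ℝ) / (n + 1)) := by gcongr
    _ = _ := by
      rw [← ENNReal.rpow_mul, div_mul_div_cancel₀ hn0.ne', div_self (by positivity),
        ENNReal.rpow_one]

/-- The open half-space `R < σ * x k`. -/
def halfSp (k : Fin N) (σ R : ℝ) : Set (Pt N) := {x | R < σ * x k}

lemma isOpen_halfSp (k : Fin N) (σ R : ℝ) : IsOpen (halfSp k σ R) :=
  isOpen_lt continuous_const (by fun_prop)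

lemma measurableSet_halfSp (k : Fin N) (σ R : ℝ) : MeasurableSet (halfSp k σ R) :=
  (isOpen_halfSp k σ R).measurableSet

lemma halfSp_anti (k : Fin N) (σ : ℝ) {R R' : ℝ} (h : R ≤ R') :
    halfSp k σ R' ⊆ halfSp k σ R := fun _ hx => lt_of_le_of_lt h hx

lemma line_halfSp (e k : Fin (n + 1)) {σ : ℝ} (hσ : σ = 1 ∨ σ = -1) (R : ℝ) (z : Fin n → ℝ) :
    OrdConnected {s | lineAt e s z ∈ halfSp k σ R} ∧
    ({s | lineAt e s z ∈ halfSp k σ R}.Nonempty → volume {s | lineAt e s z ∈ halfSp k σ R} = ⊤) := by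
  rcases Fin.eq_self_or_eq_succAbove e k with rfl | ⟨i, rfl⟩
  · simp only [halfSp, mem_ofPred_eq, lineAt_same]
    rcases hσ with rfl | rfl
    · have : {s : ℝ | R < 1 * s} = Ioi R := by ext; simp
      rw [this]
      exact ⟨ordConnected_Ioi, fun _ => Real.volume_Ioi⟩
    · have : {s : ℝ | R < -1 * s} = Iio (-R) := by ext s; simp [lt_neg]
      rw [this]
      exact ⟨ordConnected_Iio, fun _ => Real.volume_Iio⟩
  · simp only [halfSp, mem_ofPred_eq, lineAt_succAbove]
    by_cases h : R < σ * z i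
    · simp [h, ordConnected_univ]
    · simp [h, ordConnected_empty]

lemma lineShadow_ae_le_shadow {S : Set (Pt (n + 1))} (hS : MeasurableSet S) (hfin : volume S ≠ ⊤)
    (e k : Fin (n + 1)) {σ : ℝ} (hσ : σ = 1 ∨ σ = -1) (R : ℝ) :
    ∀ᵐ z, z ∈ lineShadow e (S ∩ halfSp k σ R) → z ∈ shadow e '' (essBdry S ∩ halfSp k σ R) := by
  have h1 : ∀ᵐ z, ∀ᵐ s, lineAt e s z ∈ S → lineAt e s z ∈ zeroDens Sᶜ :=
    ae_line e (p := fun x => x ∈ S → x ∈ zeroDens Sᶜ) (ae_mem_zeroDens_compl hS)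
  have h2 : ∀ᵐ z, ∀ᵐ s, lineAt e s z ∈ Sᶜ → lineAt e s z ∈ zeroDens S := by
    refine ae_line e (p := fun x => x ∈ Sᶜ → x ∈ zeroDens S) ?_
    have := ae_mem_zeroDens_compl hS.compl
    rwa [compl_compl] at this
  have h3 : ∀ᵐ z, volume {s | lineAt e s z ∈ S} < ⊤ := by
    refine ae_lt_top (measurable_volume_line e hS) ?_
    rwa [← volume_eq_line e hS]
  filter_upwards [h1, h2, h3, ae_line_crossing hS e] with z h1 h2 h3 hcr hz
  obtain ⟨hoc, htop⟩ := line_halfSp e k hσ R z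
  have : ∃ s₁, lineAt e s₁ z ∈ halfSp k σ R ∧ lineAt e s₁ z ∈ zeroDens Sᶜ := by
    by_contra! hno
    refine hz (measure_mono_null ?_ (ae_iff.1 h1))
    intro s hs
    simp only [mem_ofPred_eq, Classical.not_imp]
    exact ⟨hs.1, hno s hs.2⟩
  obtain ⟨s₁, hs₁, hs₁'⟩ := this
  have : ∃ s₂, lineAt e s₂ z ∈ halfSp k σ R ∧ lineAt e s₂ z ∈ zeroDens S := by
    by_contra! hno
    have hle : volume {s | lineAt e s z ∈ halfSp k σ R} ≤ volume {s | lineAt e s z ∈ S} := by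
      refine measure_mono_ae ?_
      filter_upwards [h2] with s hs hsH
      by_contra hsS
      exact hno s hsH (hs hsS)
    rw [htop ⟨s₁, hs₁⟩] at hle
    exact absurd h3 (not_lt.2 hle)
  obtain ⟨s₂, hs₂, hs₂'⟩ := this
  obtain ⟨s, hs, hsb⟩ := hcr s₁ s₂ hs₁' hs₂'
  exact ⟨lineAt e s z, ⟨hsb, hoc.uIcc_subset hs₁ hs₂ hs⟩, by simp⟩

lemma volume_lineShadow_le {S : Set (Pt (n + 1))} (hS : MeasurableSet S) (hfin : volume S ≠ ⊤)
    (e k : Fin (n + 1)) {σ : ℝ} (hσ : σ = 1 ∨ σ = -1) (R : ℝ) :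
    volume (lineShadow e (S ∩ halfSp k σ R)) ≤ μH[(n : ℝ)] (essBdry S ∩ halfSp k σ R) :=
  (measure_mono_ae (lineShadow_ae_le_shadow hS hfin e k hσ R)).trans (volume_shadow_le e _)

/-- The isoperimetric inequality in a half-space, with a non-sharp constant. -/
lemma isoperimetric_halfSp (hn : 1 ≤ n) {S : Set (Pt (n + 1))} (hS : MeasurableSet S)
    (hfin : volume S ≠ ⊤) (k : Fin (n + 1)) {σ : ℝ} (hσ : σ = 1 ∨ σ = -1) (R : ℝ) :
    volume (S ∩ halfSp k σ R) ^ ((n : ℝ) / (n + 1)) ≤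
      (n + 1) * μH[(n : ℝ)] (essBdry S ∩ halfSp k σ R) := by
  refine (volume_rpow_le_sum_lineShadow hn (hS.inter (measurableSet_halfSp k σ R))).trans ?_
  refine (Finset.sum_le_sum fun e _ => volume_lineShadow_le hS hfin e k hσ R).trans ?_
  simp

section Labellings

set_option linter.unusedSectionVars false

variable {L : Type*} [Fintype L] [DecidableEq L]

/-- A labelling whose cells are measurable. -/
def MeasLab (c : Pt N → L) : Prop := ∀ l, MeasurableSet (c ⁻¹' {l})

/-- The points at which the label `l` has full density. -/
def purePts (c : Pt N → L) (l : L) : Set (Pt N) := zeroDens (c ⁻¹' {l})ᶜ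

/-- The essential boundary of the cell of label `l`. -/
def cellBdry (c : Pt N → L) (l : L) : Set (Pt N) := essBdry (c ⁻¹' {l})

/-- The total weighted boundary of a labelling, every interface being counted twice. -/
def totalPer (γ : Measure (Pt N)) (c : Pt N → L) : ℝ≥0∞ := ∑ l, γ (cellBdry c l)

lemma MeasLab.preimage {c : Pt N → L} (hc : MeasLab c) (S : Set L) : MeasurableSet (c ⁻¹' S) := by
  have : c ⁻¹' S = ⋃ l ∈ S, c ⁻¹' {l} := by ext; simp
  rw [this]
  exact MeasurableSet.biUnion S.to_countable fun l _ => hc l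

lemma MeasLab.measurableSet_cellBdry {c : Pt N → L} (hc : MeasLab c) (l : L) :
    MeasurableSet (cellBdry c l) := measurableSet_essBdry (hc l)

lemma mem_cellBdry {c : Pt N → L} (hc : MeasLab c) {l : L} {x : Pt N} :
    x ∈ cellBdry c l ↔ x ∉ zeroDens (c ⁻¹' {l}) ∧ x ∉ purePts c l := by
  rw [cellBdry, essBdry_eq (hc l), compl_union]; rfl

lemma zeroDens_of_pure {c : Pt N → L} {l l' : L} (h : l ≠ l') {x : Pt N} (hx : x ∈ purePts c l) :
    x ∈ zeroDens (c ⁻¹' {l'}) :=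
  zeroDens_anti (fun y (hy : c y = l') (hy' : c y = l) => h (hy'.symm.trans hy)) hx

lemma purePts_unique {c : Pt N → L} {l l' : L} {x : Pt N} (hx : x ∈ purePts c l)
    (hx' : x ∈ purePts c l') : l = l' := by
  by_contra h
  exact notMem_zeroDens_compl (zeroDens_of_pure h hx) hx'

lemma notMem_cellBdry_of_pure {c : Pt N → L} (hc : MeasLab c) {l : L} (l' : L) {x : Pt N}
    (hx : x ∈ purePts c l) : x ∉ cellBdry c l' := by
  rw [mem_cellBdry hc]
  rintro ⟨h1, h2⟩
  by_cases h : l = l'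
  · exact h2 (h ▸ hx)
  · exact h1 (zeroDens_of_pure h hx)

lemma zeroDens_preimage {c : Pt N → L} {S : Set L} {x : Pt N}
    (h : ∀ l ∈ S, x ∈ zeroDens (c ⁻¹' {l})) : x ∈ zeroDens (c ⁻¹' S) := by
  classical
  refine zeroDens_anti (F := ⋃ l ∈ S.toFinset, c ⁻¹' {l}) (fun y hy => ?_)
    (zeroDens_biUnion _ fun l hl => h l (by simpa using hl))
  simpa using hy

lemma exists_pure {c : Pt N → L} (hc : MeasLab c) {x : Pt N} (h : ∀ l, x ∉ cellBdry c l) :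
    ∃ l, x ∈ purePts c l := by
  by_contra! hno
  have h1 : ∀ l, x ∈ zeroDens (c ⁻¹' {l}) := fun l => by
    by_contra h2
    exact h l ((mem_cellBdry hc).2 ⟨h2, hno l⟩)
  have h2 : x ∈ zeroDens (c ⁻¹' univ) := zeroDens_preimage fun l _ => h1 l
  have h3 : x ∈ zeroDens (c ⁻¹' univ)ᶜ := by simp [zeroDens, densTendsto]
  exact notMem_zeroDens_compl h2 h3

lemma exists_ne_cellBdry {c : Pt N → L} (hc : MeasLab c) {l : L} {x : Pt N}
    (h : x ∈ cellBdry c l) : ∃ l' ≠ l, x ∈ cellBdry c l' := by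
  by_contra! hno
  refine ((mem_cellBdry hc).1 h).2 ?_
  change x ∈ zeroDens (c ⁻¹' {l})ᶜ
  rw [← preimage_compl]
  refine zeroDens_preimage fun l' hl' => ?_
  by_contra h2
  refine hno l' hl' ((mem_cellBdry hc).2 ⟨h2, fun h3 => ?_⟩)
  exact notMem_cellBdry_of_pure hc l h3 h

lemma essBdry_preimage_subset {c : Pt N → L} (hc : MeasLab c) (S : Set L) :
    essBdry (c ⁻¹' S) ⊆ ⋃ l ∈ S, cellBdry c l := by
  intro x hx
  by_contra hno
  simp only [mem_iUnion, not_exists] at hno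
  rw [essBdry_eq (hc.preimage S), mem_compl_iff, mem_union, not_or] at hx
  by_cases h : ∃ l ∈ S, x ∈ purePts c l
  · obtain ⟨l, hl, hxl⟩ := h
    refine hx.2 (zeroDens_anti ?_ hxl)
    exact compl_subset_compl.2 (preimage_mono (singleton_subset_iff.2 hl))
  · push Not at h
    refine hx.1 (zeroDens_preimage fun l hl => ?_)
    by_contra h2
    exact hno l hl ((mem_cellBdry hc).2 ⟨h2, h l hl⟩)

lemma essBdry_preimage_subset_compl {c : Pt N → L} (hc : MeasLab c) (S : Set L) :
    essBdry (c ⁻¹' S) ⊆ ⋃ l ∈ Sᶜ, cellBdry c l := by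
  rw [← essBdry_compl (hc.preimage S), ← preimage_compl]
  exact essBdry_preimage_subset hc Sᶜ

lemma zeroDens_local_iff {E F U : Set (Pt N)} {x : Pt N} (hU : IsOpen U) (hx : x ∈ U)
    (h : ∀ᵐ y, y ∈ U → (y ∈ E ↔ y ∈ F)) : x ∈ zeroDens E ↔ x ∈ zeroDens F :=
  ⟨zeroDens_local hU hx (h.mono fun _ hy h1 h2 => (hy h2).2 h1),
    zeroDens_local hU hx (h.mono fun _ hy h1 h2 => (hy h2).1 h1)⟩

lemma essBdry_local {E F U : Set (Pt N)} (hE : MeasurableSet E) (hF : MeasurableSet F)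
    (hU : IsOpen U) (h : ∀ᵐ y, y ∈ U → (y ∈ E ↔ y ∈ F)) : essBdry E ∩ U = essBdry F ∩ U := by
  ext x
  refine and_congr_left fun hx => ?_
  rw [essBdry_eq hE, essBdry_eq hF, mem_compl_iff, mem_compl_iff, mem_union, mem_union,
    zeroDens_local_iff hU hx h, zeroDens_local_iff hU hx (E := Eᶜ) (F := Fᶜ)]
  exact h.mono fun y hy hyU => not_congr (hy hyU)

lemma purePts_of_zeroDens {c c' : Pt N → L} {l : L} {x : Pt N} (hx : x ∈ purePts c l)
    (h : x ∈ zeroDens {y | c' y ≠ c y}) : x ∈ purePts c' l := by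
  refine zeroDens_anti ?_ (zeroDens_union hx h)
  intro y hy
  by_cases hcy : c' y = c y
  · left; intro (h2 : c y = l); exact hy (hcy.trans h2)
  · exact Or.inr hcy

lemma ae_mem_purePts {c : Pt N → L} (hc : MeasLab c) : ∀ᵐ x, x ∈ purePts c (c x) := by
  filter_upwards [ae_all_iff.2 fun l => ae_mem_zeroDens_compl (hc l)] with x hx
  exact hx (c x) rfl

/-- The labelling obtained by giving the label `j` to the points of `U` with label in `S`. -/
def mergeLab (c : Pt N → L) (U : Set (Pt N)) (S : Finset L) (j : L) : Pt N → L :=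
  open Classical in fun x => if x ∈ U ∧ c x ∈ S then j else c x

lemma mergeLab_of_notMem {c : Pt N → L} {U : Set (Pt N)} {S : Finset L} {j : L} {x : Pt N}
    (h : x ∉ U ∨ c x ∉ S) : mergeLab c U S j x = c x := by
  unfold mergeLab; rw [if_neg]; tauto

lemma mergeLab_of_mem {c : Pt N → L} {U : Set (Pt N)} {S : Finset L} {j : L} {x : Pt N}
    (h : x ∈ U) (h2 : c x ∈ S) : mergeLab c U S j x = j := by
  unfold mergeLab; rw [if_pos ⟨h, h2⟩]

lemma mergeLab_preimage_of_mem {c : Pt N → L} {U : Set (Pt N)} {S : Finset L} {j l : L}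
    (hj : j ∉ S) (hl : l ∈ S) : mergeLab c U S j ⁻¹' {l} = c ⁻¹' {l} \ U := by
  ext x
  have hne : j ≠ l := fun h => hj (h ▸ hl)
  by_cases hx : x ∈ U
  · by_cases hs : c x ∈ S
    · simp [mergeLab_of_mem hx hs, hne, hx]
    · have : c x ≠ l := fun h => hs (h ▸ hl)
      simp [mergeLab_of_notMem (Or.inr hs), this]
  · simp [mergeLab_of_notMem (Or.inl hx), hx]

lemma mergeLab_preimage_of_notMem {c : Pt N → L} {U : Set (Pt N)} {S : Finset L} {j l : L}
    (hj : l ≠ j) (hl : l ∉ S) : mergeLab c U S j ⁻¹' {l} = c ⁻¹' {l} := by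
  ext x
  by_cases hx : x ∈ U ∧ c x ∈ S
  · have : c x ≠ l := fun h => hl (h ▸ hx.2)
    simp [mergeLab_of_mem hx.1 hx.2, this, hj.symm]
  · simp [mergeLab_of_notMem (not_and_or.1 hx)]

lemma mergeLab_preimage_self {c : Pt N → L} {U : Set (Pt N)} {S : Finset L} {j : L} :
    mergeLab c U S j ⁻¹' {j} = c ⁻¹' {j} ∪ (c ⁻¹' S ∩ U) := by
  ext x
  by_cases hx : x ∈ U ∧ c x ∈ S
  · simp [mergeLab_of_mem hx.1 hx.2, hx.1, hx.2]
  · simp only [mem_preimage, mem_singleton_iff, mergeLab_of_notMem (not_and_or.1 hx), mem_union,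
      mem_inter_iff, Finset.mem_coe]
    tauto

lemma MeasLab.merge {c : Pt N → L} (hc : MeasLab c) {U : Set (Pt N)} (hU : MeasurableSet U)
    {S : Finset L} {j : L} (hj : j ∉ S) : MeasLab (mergeLab c U S j) := by
  intro l
  by_cases hl : l ∈ S
  · rw [mergeLab_preimage_of_mem hj hl]; exact (hc l).diff hU
  · by_cases hlj : l = j
    · rw [hlj, mergeLab_preimage_self]; exact (hc j).union ((hc.preimage _).inter hU)
    · rw [mergeLab_preimage_of_notMem hlj hl]; exact hc l

lemma measure_le_three {γ : Measure (Pt N)} {U V : Set (Pt N)} (hU : MeasurableSet U)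
    (hV : MeasurableSet V) (hUV : Disjoint U V) (A : Set (Pt N)) :
    γ A = γ (A ∩ U) + γ (A ∩ V) + γ (A ∩ (U ∪ V)ᶜ) := by
  rw [← measure_inter_add_sdiff A (hU.union hV), ← measure_inter_add_sdiff (A ∩ (U ∪ V)) hU]
  congr 2
  · congr 1; ext x; simp; tauto
  · congr 1; ext x
    have hd : x ∈ U → x ∉ V := fun h => disjoint_left.1 hUV h
    simp only [Set.mem_sdiff, mem_inter_iff, mem_union]
    tauto

/-- Merging labels inside an open set removes the interfaces between them and creates new
boundary only along the frontier. -/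
lemma totalPer_merge_le {γ : Measure (Pt N)} {c : Pt N → L} (hc : MeasLab c) {U V : Set (Pt N)}
    (hU : IsOpen U) (hV : IsOpen V) (hUV : Disjoint U V) {S : Finset L} {j : L} (hj : j ∉ S) :
    totalPer γ (mergeLab c U S j) + γ (essBdry (c ⁻¹' S) ∩ cellBdry c j ∩ U) ≤
      totalPer γ c + ∑ l, γ (cellBdry (mergeLab c U S j) l ∩ (U ∪ V)ᶜ) := by
  set c' := mergeLab c U S j with hc'
  have hm : MeasLab c' := hc.merge hU.measurableSet hj
  have hVeq : ∀ l, cellBdry c' l ∩ V = cellBdry c l ∩ V := fun l =>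
    essBdry_local (hm l) (hc l) hV (Eventually.of_forall fun y hy => by
      simp [hc', mergeLab_of_notMem (Or.inl (disjoint_right.1 hUV hy))])
  have hUS : ∀ l ∈ S, cellBdry c' l ∩ U = ∅ := fun l hl => by
    have : cellBdry c' l ∩ U = essBdry (∅ : Set (Pt N)) ∩ U :=
      essBdry_local (hm l) MeasurableSet.empty hU (Eventually.of_forall fun y hy => by
        rw [hc', mergeLab_preimage_of_mem hj hl]; simp [hy])
    rw [this, essBdry_eq MeasurableSet.empty]
    simp [zeroDens, densTendsto]
  have hUo : ∀ l ∉ S, l ≠ j → cellBdry c' l ∩ U = cellBdry c l ∩ U := fun l hl hlj => by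
    rw [cellBdry, hc', mergeLab_preimage_of_notMem hlj hl]; rfl
  have hUj : cellBdry c' j ∩ U = essBdry (c ⁻¹' (insert j S : Finset L)) ∩ U :=
    essBdry_local (hm j) (hc.preimage _) hU (Eventually.of_forall fun y hy => by
      rw [hc', mergeLab_preimage_self]; simp [hy])
  have hjkey : γ (cellBdry c' j ∩ U) + γ (essBdry (c ⁻¹' S) ∩ cellBdry c j ∩ U) ≤
      ∑ l ∈ insert j S, γ (cellBdry c l ∩ U) := by
    rw [Finset.sum_insert hj]
    set W : Set (Pt N) := ⋃ l ∈ S, cellBdry c l with hW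
    have hWm : MeasurableSet W :=
      Finset.measurableSet_biUnion _ fun l _ => hc.measurableSet_cellBdry l
    have h1 : γ (cellBdry c' j ∩ U) ≤ γ ((cellBdry c j ∩ U) ∪ (W ∩ U)) := by
      rw [hUj, ← union_inter_distrib_right]
      refine measure_mono (inter_subset_inter_left _ ?_)
      refine (essBdry_preimage_subset hc _).trans ?_
      simp [hW]
    have h2 : γ (essBdry (c ⁻¹' S) ∩ cellBdry c j ∩ U) ≤ γ ((cellBdry c j ∩ U) ∩ (W ∩ U)) := by
      refine measure_mono fun x hx => ⟨⟨hx.1.2, hx.2⟩, ?_, hx.2⟩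
      have := essBdry_preimage_subset hc _ hx.1.1
      simpa [hW] using this
    calc _ ≤ γ ((cellBdry c j ∩ U) ∪ (W ∩ U)) + γ ((cellBdry c j ∩ U) ∩ (W ∩ U)) :=
          add_le_add h1 h2
      _ = γ (cellBdry c j ∩ U) + γ (W ∩ U) :=
          measure_union_add_inter _ (hWm.inter hU.measurableSet)
      _ ≤ _ := by
          gcongr
          rw [hW, iUnion₂_inter]
          exact measure_biUnion_finset_le _ _
  have hUsum : ∑ l, γ (cellBdry c' l ∩ U) + γ (essBdry (c ⁻¹' S) ∩ cellBdry c j ∩ U) ≤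
      ∑ l, γ (cellBdry c l ∩ U) := by
    rw [← Finset.sum_add_sum_compl (insert j S), ← Finset.sum_add_sum_compl (insert j S)
      (fun l => γ (cellBdry c l ∩ U)), Finset.sum_insert hj]
    rw [Finset.sum_eq_zero (s := S) fun l hl => by rw [hUS l hl, measure_empty]]
    rw [add_zero, add_right_comm]
    refine add_le_add hjkey (Finset.sum_le_sum fun l hl => ?_)
    simp only [Finset.mem_compl, Finset.mem_insert, not_or] at hl
    rw [hUo l hl.2 hl.1]
  have e1 : totalPer γ c' = ∑ l, γ (cellBdry c' l ∩ U) + ∑ l, γ (cellBdry c l ∩ V) +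
      ∑ l, γ (cellBdry c' l ∩ (U ∪ V)ᶜ) := by
    rw [← Finset.sum_add_distrib, ← Finset.sum_add_distrib]
    refine Finset.sum_congr rfl fun l _ => ?_
    rw [← hVeq l]
    exact measure_le_three hU.measurableSet hV.measurableSet hUV _
  have e2 : ∑ l, γ (cellBdry c l ∩ U) + ∑ l, γ (cellBdry c l ∩ V) ≤ totalPer γ c := by
    rw [← Finset.sum_add_distrib]
    refine Finset.sum_le_sum fun l _ => ?_
    rw [measure_le_three hU.measurableSet hV.measurableSet hUV (cellBdry c l)]
    exact le_self_add
  rw [e1]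
  calc _ = (∑ l, γ (cellBdry c' l ∩ U) + γ (essBdry (c ⁻¹' S) ∩ cellBdry c j ∩ U)) +
        ∑ l, γ (cellBdry c l ∩ V) + ∑ l, γ (cellBdry c' l ∩ (U ∪ V)ᶜ) := by ring
    _ ≤ (∑ l, γ (cellBdry c l ∩ U) + ∑ l, γ (cellBdry c l ∩ V)) +
        ∑ l, γ (cellBdry c' l ∩ (U ∪ V)ᶜ) := by gcongr
    _ ≤ _ := by gcongr

/-- Volume and perimeter measures comparable to the Lebesgue and Hausdorff measures, the
perimeter measure being asymptotically a multiple of the Hausdorff measure. -/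
structure Weights (ν γ : Measure (Pt (n + 1))) (M : ℝ≥0∞) : Prop where
  ne_top : M ≠ ⊤
  one_le : 1 ≤ M
  vol_le : ∀ A, ν A ≤ M * volume A
  le_vol : ∀ A, volume A ≤ M * ν A
  per_le : ∀ A, γ A ≤ M * μH[(n : ℝ)] A
  le_per : ∀ A, μH[(n : ℝ)] A ≤ M * γ A
  far : ∀ δ : ℝ≥0∞, δ ≠ 0 → ∃ R₀ : ℝ, ∃ b ≤ M, ∀ A, MeasurableSet A → A ⊆ (ball 0 R₀)ᶜ →
    b * μH[(n : ℝ)] A ≤ γ A ∧ γ A ≤ (b + δ) * μH[(n : ℝ)] A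

/-- Inside `W`, any amount `ε ≤ v₀` of volume can be moved from the label `a` to the label `b`
at perimeter cost at most `η * ε ^ (n / (n + 1))`. -/
def CanTransfer (ν γ : Measure (Pt (n + 1))) (c : Pt (n + 1) → L) (W : Set (Pt (n + 1)))
    (a b : L) (η v₀ : ℝ≥0∞) : Prop :=
  ∀ ε ≤ v₀, ∀ c' : Pt (n + 1) → L, MeasLab c' → (∀ x ∈ W, c' x = c x) →
    ∃ c'' : Pt (n + 1) → L, MeasLab c'' ∧ (∀ x ∉ W, c'' x = c' x) ∧
      ν (c'' ⁻¹' {a}) + ε = ν (c' ⁻¹' {a}) ∧ ν (c'' ⁻¹' {b}) = ν (c' ⁻¹' {b}) + ε ∧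
      (∀ l, l ≠ a → l ≠ b → ν (c'' ⁻¹' {l}) = ν (c' ⁻¹' {l})) ∧
      totalPer γ c'' ≤ totalPer γ c' + η * ε ^ ((n : ℝ) / (n + 1))

lemma CanTransfer.mono {ν γ : Measure (Pt (n + 1))} {c : Pt (n + 1) → L}
    {W W' : Set (Pt (n + 1))} {a b : L} {η η' v₀ v₀' : ℝ≥0∞} (h : CanTransfer ν γ c W a b η v₀)
    (hW : W ⊆ W') (hη : η ≤ η') (hv : v₀' ≤ v₀) : CanTransfer ν γ c W' a b η' v₀' := by
  intro ε hε c' hc' hcc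
  obtain ⟨c'', h1, h2, h3, h4, h5, h6⟩ := h ε (hε.trans hv) c' hc' fun x hx => hcc x (hW hx)
  exact ⟨c'', h1, fun x hx => h2 x fun h => hx (hW h), h3, h4, h5, h6.trans (by gcongr)⟩

lemma CanTransfer.comp {ν γ : Measure (Pt (n + 1))} {c : Pt (n + 1) → L}
    {W₁ W₂ : Set (Pt (n + 1))} {a b d : L} {η₁ η₂ v₀ : ℝ≥0∞}
    (h₁ : CanTransfer ν γ c W₁ a b η₁ v₀) (h₂ : CanTransfer ν γ c W₂ b d η₂ v₀)
    (hW : Disjoint W₁ W₂) (hv : v₀ ≠ ⊤) (hab : a ≠ b) (hbd : b ≠ d) (had : a ≠ d) :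
    CanTransfer ν γ c (W₁ ∪ W₂) a d (η₁ + η₂) v₀ := by
  intro ε hε c' hc' hcc
  obtain ⟨c₁, m1, e1, va1, vb1, vo1, p1⟩ := h₁ ε hε c' hc' fun x hx => hcc x (Or.inl hx)
  obtain ⟨c₂, m2, e2, vb2, vd2, vo2, p2⟩ := h₂ ε hε c₁ m1 fun x hx => by
    rw [e1 x (disjoint_right.1 hW hx), hcc x (Or.inr hx)]
  have hεt : ε ≠ ⊤ := ne_top_of_le_ne_top hv hε
  refine ⟨c₂, m2, fun x hx => ?_, ?_, ?_, fun l hla hld => ?_, ?_⟩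
  · rw [mem_union, not_or] at hx
    rw [e2 x hx.2, e1 x hx.1]
  · rw [vo2 a hab had, va1]
  · rw [vd2, vo1 d had.symm hbd.symm]
  · by_cases hlb : l = b
    · subst hlb
      exact (ENNReal.add_left_inj hεt).1 (vb2.trans vb1)
    · rw [vo2 l hlb hld, vo1 l hla hlb]
  · rw [add_mul, ← add_assoc]
    exact p2.trans (by gcongr)

/-- Volume is moved from one label to several others in disjoint regions. -/
lemma exists_restore {ν γ : Measure (Pt (n + 1))} {c : Pt (n + 1) → L}
    {W : L → Set (Pt (n + 1))} {a : L} {η v₀ v : ℝ≥0∞} {A : Finset L} (ha : a ∉ A)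
    (hW : (A : Set L).PairwiseDisjoint W) (h : ∀ l ∈ A, CanTransfer ν γ c (W l) a l η v₀)
    (hv : v ≤ v₀) {d : L → ℝ≥0∞} (hd : ∀ l ∈ A, d l ≤ v) {c' : Pt (n + 1) → L} (hc' : MeasLab c')
    (hcc : ∀ l ∈ A, ∀ x ∈ W l, c' x = c x) :
    ∃ c'' : Pt (n + 1) → L, MeasLab c'' ∧ (∀ x, (∀ l ∈ A, x ∉ W l) → c'' x = c' x) ∧
      ν (c'' ⁻¹' {a}) + ∑ l ∈ A, d l = ν (c' ⁻¹' {a}) ∧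
      (∀ l ∈ A, ν (c'' ⁻¹' {l}) = ν (c' ⁻¹' {l}) + d l) ∧
      (∀ l ∉ A, l ≠ a → ν (c'' ⁻¹' {l}) = ν (c' ⁻¹' {l})) ∧
      totalPer γ c'' ≤ totalPer γ c' + A.card * (η * v ^ ((n : ℝ) / (n + 1))) := by
  induction A using Finset.induction_on with
  | empty => exact ⟨c', hc', fun _ _ => rfl, by simp, by simp, fun _ _ _ => rfl, by simp⟩
  | insert l A hl ih =>
    simp only [Finset.mem_insert, not_or, forall_eq_or_imp] at ha h hd hcc
    rw [Finset.coe_insert, pairwiseDisjoint_insert_of_notMem (by simpa using hl)] at hW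
    obtain ⟨c₁, m1, e1, va1, vA1, vo1, p1⟩ := ih ha.2 hW.1 h.2 hd.2 hcc.2
    have hagree : ∀ x ∈ W l, c₁ x = c x := fun x hx => by
      rw [e1 x fun l' hl' hx' => disjoint_left.1 (hW.2 l' hl') hx hx', hcc.1 x hx]
    obtain ⟨c₂, m2, e2, va2, vb2, vo2, p2⟩ := h.1 (d l) (hd.1.trans hv) c₁ m1 hagree
    refine ⟨c₂, m2, fun x hx => ?_, ?_, ?_, fun l' hl' hla => ?_, ?_⟩
    · simp only [Finset.mem_insert, forall_eq_or_imp] at hx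
      rw [e2 x hx.1, e1 x hx.2]
    · rw [Finset.sum_insert hl, ← add_assoc, va2, va1]
    · intro l' hl'
      rcases Finset.mem_insert.1 hl' with rfl | hl'
      · rw [vb2, vo1 l' hl (Ne.symm ha.1)]
      · have h1 : l' ≠ a := fun h => ha.2 (h ▸ hl')
        have h2 : l' ≠ l := fun h => hl (h ▸ hl')
        rw [vo2 l' h1 h2, vA1 l' hl']
    · rw [Finset.mem_insert, not_or] at hl'
      rw [vo2 l' hla hl'.1, vo1 l' hl'.2 hla]
    · rw [Finset.card_insert_of_notMem hl, Nat.cast_add, Nat.cast_one, add_mul, one_mul,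
        ← add_assoc]
      refine p2.trans ?_
      gcongr
      exact hd.1

/-- Minimality of a labelling: the label `z` is the exterior one. -/
def MinLab (ν γ : Measure (Pt (n + 1))) (z : L) (c : Pt (n + 1) → L) : Prop :=
  ∀ c' : Pt (n + 1) → L, MeasLab c' → (∀ l ≠ z, ν (c' ⁻¹' {l}) = ν (c ⁻¹' {l})) →
    totalPer γ c ≤ totalPer γ c'

lemma merge_bound {ν γ : Measure (Pt (n + 1))} {z : L} {c : Pt (n + 1) → L} (hc : MeasLab c)
    (hmin : MinLab ν γ z c) (hfin : totalPer γ c ≠ ⊤) {U V : Set (Pt (n + 1))} (hU : IsOpen U)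
    (hV : IsOpen V) (hUV : Disjoint U V) {S : Finset L} {j : L} (hj : j ∉ S)
    {W : L → Set (Pt (n + 1))} {η v₀ v : ℝ≥0∞} (hW : (S : Set L).PairwiseDisjoint W)
    (h : ∀ l ∈ S, CanTransfer ν γ c (W l) j l η v₀) (hWU : ∀ l ∈ S, Disjoint (W l) U)
    (hv : v ≤ v₀) (hvt : v ≠ ⊤) (hd : ν (c ⁻¹' S ∩ U) ≤ v) :
    γ (essBdry (c ⁻¹' S) ∩ cellBdry c j ∩ U) ≤
      ∑ l, γ (cellBdry (mergeLab c U S j) l ∩ (U ∪ V)ᶜ) +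
        S.card * (η * v ^ ((n : ℝ) / (n + 1))) := by
  have key := totalPer_merge_le (γ := γ) hc hU hV hUV hj
  have hsub : ∀ l ∈ S, c ⁻¹' {l} ∩ U ⊆ c ⁻¹' S ∩ U := fun l hl =>
    inter_subset_inter_left _ (preimage_mono (by simpa using hl))
  obtain ⟨c₂, m2, -, va2, vA2, vo2, p2⟩ := exists_restore hj hW h hv
    (d := fun l => ν (c ⁻¹' {l} ∩ U)) (fun l hl => (measure_mono (hsub l hl)).trans hd)
    (hc.merge hU.measurableSet hj) (fun l hl x hx =>
      mergeLab_of_notMem (Or.inl (disjoint_left.1 (hWU l hl) hx)))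
  have hSum : ∑ l ∈ S, ν (c ⁻¹' {l} ∩ U) = ν (c ⁻¹' S ∩ U) := by
    rw [← measure_biUnion_finset]
    · congr 1; ext x; simp
    · intro l _ l' _ hne
      exact (disjoint_singleton.2 hne).preimage c |>.mono inter_subset_left inter_subset_left
    · exact fun l _ => (hc l).inter hU.measurableSet
  have hm := hmin c₂ m2 fun l _ => by
    by_cases hl : l ∈ S
    · rw [vA2 l hl, mergeLab_preimage_of_mem hj hl, add_comm]
      exact measure_inter_add_sdiff _ hU.measurableSet
    · by_cases hlj : l = j
      · subst hlj
        rw [hSum, mergeLab_preimage_self, measure_union _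
          ((hc.preimage _).inter hU.measurableSet)] at va2
        · exact (ENNReal.add_left_inj (ne_top_of_le_ne_top hvt hd)).1 va2
        · refine disjoint_left.2 fun x (hx : c x = l) hx' => hj ?_
          have : c x ∈ S := hx'.1
          rwa [hx] at this
      · rw [vo2 l hl hlj, mergeLab_preimage_of_notMem hlj hl]
  refine (ENNReal.add_le_add_iff_left hfin).1 ?_
  calc totalPer γ c + _ ≤ (totalPer γ (mergeLab c U S j) + S.card * (η * v ^ ((n : ℝ) / (n + 1)))) +
        γ (essBdry (c ⁻¹' S) ∩ cellBdry c j ∩ U) := by gcongr; exact hm.trans p2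
    _ = (totalPer γ (mergeLab c U S j) + γ (essBdry (c ⁻¹' S) ∩ cellBdry c j ∩ U)) +
        S.card * (η * v ^ ((n : ℝ) / (n + 1))) := by ring
    _ ≤ _ := by rw [← add_assoc]; gcongr

lemma exists_level {X : Type*} [MeasurableSpace X] {μ : Measure X} [IsFiniteMeasure μ] {u : X → ℝ}
    (hu : Measurable u) (hu0 : ∀ x, 0 ≤ u x) (hlev : ∀ s, μ {x | u x = s} = 0) {s₁ : ℝ}
    (hs₁ : 0 < s₁) {ε : ℝ≥0∞} (hε0 : ε ≠ 0) (hε : ε ≤ μ {x | u x < s₁}) :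
    ∃ s, 0 < s ∧ s ≤ s₁ ∧ μ {x | u x < s} = ε := by
  set T : Set ℝ := {s | s ≤ s₁ ∧ μ {x | u x < s} ≤ ε} with hT
  have h0T : (0 : ℝ) ∈ T := ⟨hs₁.le, by
    have : {x | u x < 0} = ∅ := by ext x; simpa using hu0 x
    rw [this, measure_empty]; exact zero_le⟩
  have hbdd : BddAbove T := ⟨s₁, fun s hs => hs.1⟩
  set s := sSup T with hs
  have hss₁ : s ≤ s₁ := csSup_le ⟨0, h0T⟩ fun s hs => hs.1
  have hs0 : 0 ≤ s := le_csSup hbdd h0T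
  have hle : μ {x | u x < s} ≤ ε := by
    have : {x | u x < s} ⊆ ⋃ p : ℕ, {x | u x < s - 1 / ((p : ℝ) + 1)} := by
      intro x (hx : u x < s)
      obtain ⟨p, hp⟩ := exists_nat_one_div_lt (sub_pos.2 hx)
      exact mem_iUnion.2 ⟨p, by change u x < _; linarith⟩
    refine (measure_mono this).trans ?_
    rw [Monotone.measure_iUnion]
    · refine iSup_le fun p => ?_
      have hp : s - 1 / ((p : ℝ) + 1) < s := sub_lt_self _ (by positivity)
      obtain ⟨t, ht, hst⟩ := exists_lt_of_lt_csSup ⟨0, h0T⟩ hp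
      exact (measure_mono fun x (hx : u x < _) => hx.trans hst).trans ht.2
    · intro p q hpq x (hx : u x < _)
      exact lt_of_lt_of_le hx (sub_le_sub_left (Nat.one_div_le_one_div hpq) s)
  have hge : ε ≤ μ {x | u x ≤ s} := by
    by_cases h : s = s₁
    · rw [h]; exact hε.trans (measure_mono fun x (hx : u x < s₁) => hx.le)
    · have hlt : s < s₁ := lt_of_le_of_ne hss₁ h
      have : {x | u x ≤ s} = ⋂ p : ℕ, {x | u x < s + (s₁ - s) / ((p : ℝ) + 1)} := by
        ext x
        simp only [mem_iInter]
        constructor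
        · intro (hx : u x ≤ s) p
          have : 0 < (s₁ - s) / ((p : ℝ) + 1) := by have := sub_pos.2 hlt; positivity
          change u x < _
          linarith
        · intro hx
          refine le_of_forall_pos_lt_add (α := ℝ) fun δ hδ => ?_
          obtain ⟨p, hp⟩ := exists_nat_one_div_lt (div_pos hδ (sub_pos.2 hlt))
          have h2 : u x < s + (s₁ - s) / ((p : ℝ) + 1) := hx p
          rw [lt_div_iff₀ (sub_pos.2 hlt)] at hp
          have : 1 / ((p : ℝ) + 1) * (s₁ - s) = (s₁ - s) / ((p : ℝ) + 1) := by ring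
          linarith
      rw [this, Antitone.measure_iInter]
      · refine le_iInf fun p => ?_
        by_contra! hcon
        have hpos : 0 < (s₁ - s) / ((p : ℝ) + 1) := by have := sub_pos.2 hlt; positivity
        have hle1 : (s₁ - s) / ((p : ℝ) + 1) ≤ s₁ - s :=
          div_le_self (sub_pos.2 hlt).le (by linarith [Nat.cast_nonneg (α := ℝ) p])
        have : s + (s₁ - s) / ((p : ℝ) + 1) ∈ T := ⟨by linarith, hcon.le⟩
        have := le_csSup hbdd this
        linarith
      · intro p q hpq x (hx : u x < _)
        refine lt_of_lt_of_le hx ?_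
        have := (sub_pos.2 hlt).le
        gcongr
      · exact fun p => (measurableSet_lt hu measurable_const).nullMeasurableSet
      · exact ⟨0, measure_ne_top _ _⟩
  have hspos : 0 < s := by
    refine lt_of_le_of_ne hs0 fun h => hε0 ?_
    have h2 : {x | u x ≤ s} = {x | u x = 0} := by
      ext x
      exact ⟨fun hx => le_antisymm (hx.trans h.symm.le) (hu0 x), fun hx => (Eq.le hx).trans hs0⟩
    rw [h2, hlev 0] at hge
    exact le_antisymm hge zero_le
  refine ⟨s, hspos, hss₁, le_antisymm hle (hge.trans ?_)⟩
  have : {x | u x ≤ s} ⊆ {x | u x < s} ∪ {x | u x = s} := fun x (hx : u x ≤ s) =>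
    hx.lt_or_eq
  refine (measure_mono this).trans ((measure_union_le _ _).trans ?_)
  rw [hlev s, add_zero]

/-- The distance to `y` in the maximum norm. -/
def cubeDist (y x : Pt N) : ℝ := dist (WithLp.ofLp x) (WithLp.ofLp y)

lemma continuous_cubeDist (y : Pt N) : Continuous (cubeDist y) := by
  unfold cubeDist
  fun_prop

lemma cubeDist_le_dist (y x : Pt N) : cubeDist y x ≤ dist x y :=
  (dist_pi_le_iff dist_nonneg).2 fun i => abs_coord_sub_le i x y

lemma abs_coord_le_cubeDist (y x : Pt N) (i : Fin N) : |x i - y i| ≤ cubeDist y x :=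
  dist_le_pi_dist (WithLp.ofLp x) (WithLp.ofLp y) i

lemma dist_le_cubeDist (y x : Pt (n + 1)) : dist x y ≤ √(n + 1) * cubeDist y x := by
  refine dist_le_of_coord 0 (abs_coord_le_cubeDist y x 0) ?_
  exact (dist_pi_le_iff dist_nonneg).2 fun i => abs_coord_le_cubeDist y x _

lemma exists_coord_eq_cubeDist (y x : Pt (n + 1)) : ∃ i, |x i - y i| = cubeDist y x := by
  by_contra! h
  have : cubeDist y x < cubeDist y x :=
    (dist_pi_lt_iff (lt_of_le_of_lt (abs_nonneg _)
      (lt_of_le_of_ne (abs_coord_le_cubeDist y x 0) (h 0)))).2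
      fun i => lt_of_le_of_ne (abs_coord_le_cubeDist y x i) (h i)
  exact lt_irrefl _ this

lemma volume_coord_eq (i : Fin (n + 1)) (t : ℝ) : volume {x : Pt (n + 1) | x i = t} = 0 := by
  have hm : MeasurableSet {x : Pt (n + 1) | x i = t} :=
    (measurableSet_singleton t).preimage (by fun_prop : Measurable fun x : Pt (n + 1) => x i)
  rw [volume_eq_line i hm]
  simp

lemma cubeDist_level_subset (y : Pt (n + 1)) (s : ℝ) : {x | cubeDist y x = s} ⊆
    ⋃ i, ({x | x i = y i + s} ∪ {x | x i = y i - s}) := by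
  intro x (hx : cubeDist y x = s)
  obtain ⟨i, hi⟩ := exists_coord_eq_cubeDist y x
  refine mem_iUnion.2 ⟨i, ?_⟩
  rw [hx] at hi
  have hs : 0 ≤ s := hi ▸ abs_nonneg _
  rcases (abs_eq hs).1 hi with h | h
  · left; change x i = _; linarith
  · right; change x i = _; linarith

lemma volume_cubeDist_eq (y : Pt (n + 1)) (s : ℝ) : volume {x | cubeDist y x = s} = 0 := by
  refine measure_mono_null (cubeDist_level_subset y s) (measure_iUnion_null fun i => ?_)
  exact measure_union_null (volume_coord_eq _ _) (volume_coord_eq _ _)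

lemma exists_hausdorff_cubeDist_le (n : ℕ) : ∃ C : ℝ≥0∞, C ≠ ⊤ ∧ ∀ (y : Pt (n + 1)) (s : ℝ),
    μH[(n : ℝ)] {x | cubeDist y x = s} ≤ C * ENNReal.ofReal s ^ n := by
  obtain ⟨C₀, h0, h⟩ := exists_hausdorff_slice_le n
  refine ⟨(n + 1) * (2 * (C₀ * 2 ^ n)), ?_, fun y s => ?_⟩
  · finiteness
  rcases lt_or_ge s 0 with hs | hs
  · have : {x | cubeDist y x = s} = ∅ := by
      ext x; simp only [mem_ofPred_eq, mem_empty_iff_false, iff_false]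
      exact fun hx => absurd (hx ▸ dist_nonneg) (not_le.2 hs)
    rw [this, measure_empty]; exact zero_le
  have hD : ∀ (i : Fin (n + 1)) (t : ℝ),
      μH[(n : ℝ)] ({x | cubeDist y x = s} ∩ {x | x i = t}) ≤ C₀ * (2 ^ n * ENNReal.ofReal s ^ n) := by
    intro i t
    have hsub : {x | cubeDist y x = s} ∩ {x | x i = t} ⊆
        lineAt i t '' closedBall (shadow i y) s := by
      rintro x ⟨hx, hxt⟩
      refine ⟨shadow i x, ?_, (eq_lineAt_iff.2 ⟨hxt, rfl⟩).symm⟩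
      rw [mem_closedBall, dist_pi_le_iff hs]
      exact fun j => (abs_coord_le_cubeDist y x _).trans (le_of_eq hx)
    refine (measure_mono hsub).trans ((h i t _).trans ?_)
    rw [Real.volume_pi_closedBall _ hs, Fintype.card_fin, ENNReal.ofReal_pow (by positivity),
      ENNReal.ofReal_mul (by positivity), mul_pow, ENNReal.ofReal_ofNat]
  have hsub : {x | cubeDist y x = s} ⊆ ⋃ i, (({x | cubeDist y x = s} ∩ {x | x i = y i + s}) ∪
      ({x | cubeDist y x = s} ∩ {x | x i = y i - s})) := by
    intro x hx
    obtain ⟨i, hi⟩ := mem_iUnion.1 (cubeDist_level_subset y s hx)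
    exact mem_iUnion.2 ⟨i, hi.imp (fun h => ⟨hx, h⟩) fun h => ⟨hx, h⟩⟩
  calc _ ≤ ∑ i : Fin (n + 1), (C₀ * (2 ^ n * ENNReal.ofReal s ^ n) +
        C₀ * (2 ^ n * ENNReal.ofReal s ^ n)) := by
        refine (measure_mono hsub).trans ((measure_iUnion_fintype_le _ _).trans ?_)
        exact Finset.sum_le_sum fun i _ => (measure_union_le _ _).trans (add_le_add (hD _ _) (hD _ _))
    _ = _ := by
        rw [Finset.sum_const, Finset.card_univ, Fintype.card_fin, nsmul_eq_mul]
        push_cast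
        ring

/-- Near a point of pure label `a`, volume can be moved from `a` to any other label. -/
lemma exists_canTransfer_of_pure (n : ℕ) (L : Type*) [Fintype L] [DecidableEq L] {M : ℝ≥0∞}
    (hM : M ≠ ⊤) : ∃ C : ℝ≥0∞, C ≠ ⊤ ∧ ∀ (ν γ : Measure (Pt (n + 1))), Weights ν γ M →
      ∀ (c : Pt (n + 1) → L), MeasLab c → ∀ (a b : L), a ≠ b → ∀ y ∈ purePts c a, ∀ s₀ : ℝ, 0 < s₀ →
      ∃ v₀, v₀ ≠ 0 ∧ v₀ ≠ ⊤ ∧ CanTransfer ν γ c (ball y s₀) a b C v₀ := by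
  obtain ⟨C₁, hC₁, hsph⟩ := exists_hausdorff_cubeDist_le n
  set ω := volume (ball (0 : Pt (n + 1)) 1) with hω
  have hω0 : ω ≠ 0 := volume_ball_ne_zero _ one_pos
  have hωt : ω ≠ ⊤ := volume_ball_ne_top _ _
  set C₂ : ℝ≥0∞ := 2 * M * ω⁻¹ with hC₂
  have hC₂t : C₂ ≠ ⊤ := by finiteness
  set β : ℝ := (n : ℝ) / (n + 1) with hβ
  have hβ0 : 0 ≤ β := by positivity
  refine ⟨Fintype.card L * (M * C₁) * C₂ ^ β, by finiteness, ?_⟩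
  intro ν γ hw c hc a b hab y hy s₀ hs₀
  obtain ⟨δ, hδ, hthin⟩ := mem_zeroDens_iff.1 hy (1 / 2) (by simp)
  set s₁ : ℝ := min (δ / 2) (s₀ / (2 * √(n + 1))) with hs₁
  have hsq : 0 < √((n : ℝ) + 1) := by positivity
  have hs₁0 : 0 < s₁ := by positivity
  have hcube : ∀ s ≤ s₁, {x | cubeDist y x ≤ s} ⊆ ball y s₀ := by
    intro s hs x (hx : cubeDist y x ≤ s)
    rw [mem_ball]
    have h1 : s₁ ≤ s₀ / (2 * √(n + 1)) := min_le_right _ _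
    calc dist x y ≤ √(n + 1) * cubeDist y x := dist_le_cubeDist y x
      _ ≤ √(n + 1) * (s₀ / (2 * √(n + 1))) := by gcongr; linarith
      _ = s₀ / 2 := by field_simp
      _ < s₀ := by linarith
  have hlow : ∀ s, 0 < s → s ≤ s₁ →
      ENNReal.ofReal s ^ (n + 1) ≤ C₂ * ν (c ⁻¹' {a} ∩ {x | cubeDist y x < s}) := by
    intro s hs hss
    have hball : volume (ball y s) = ENNReal.ofReal s ^ (n + 1) * ω := by
      rw [Measure.addHaar_ball _ _ hs.le, finrank_euclideanSpace_fin, ENNReal.ofReal_pow hs.le]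
    have h1 : volume ((c ⁻¹' {a})ᶜ ∩ ball y s) ≤ 1 / 2 * volume (ball y s) :=
      hthin s ⟨hs, by have := min_le_left (δ / 2) (s₀ / (2 * √(n + 1))); linarith⟩
    have h2 : volume (ball y s) ≤ volume (c ⁻¹' {a} ∩ ball y s) + 1 / 2 * volume (ball y s) := by
      calc volume (ball y s) = volume (ball y s ∩ c ⁻¹' {a}) + volume (ball y s \ c ⁻¹' {a}) :=
            (measure_inter_add_sdiff _ (hc a)).symm
        _ ≤ _ := by
            rw [inter_comm]
            gcongr
            rwa [sdiff_eq, inter_comm]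
    have h3 : volume (ball y s) ≤ 2 * volume (c ⁻¹' {a} ∩ ball y s) := by
      have h4 : 1 / 2 * volume (ball y s) + 1 / 2 * volume (ball y s) = volume (ball y s) := by
        rw [← add_mul, one_div, ENNReal.inv_two_add_inv_two, one_mul]
      have h5 : 1 / 2 * volume (ball y s) ≤ volume (c ⁻¹' {a} ∩ ball y s) := by
        refine (ENNReal.add_le_add_iff_right (a := 1 / 2 * volume (ball y s)) ?_).1 (h4.le.trans h2)
        exact ENNReal.mul_ne_top (by simp) (volume_ball_ne_top _ _)
      rw [← h4, two_mul]
      exact add_le_add h5 h5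
    have h6 : volume (c ⁻¹' {a} ∩ ball y s) ≤ M * ν (c ⁻¹' {a} ∩ {x | cubeDist y x < s}) := by
      refine (hw.le_vol _).trans ?_
      gcongr
      exact fun x hx => (cubeDist_le_dist y x).trans_lt hx
    have h7 : ENNReal.ofReal s ^ (n + 1) * ω ≤
        2 * (M * ν (c ⁻¹' {a} ∩ {x | cubeDist y x < s})) := by
      rw [← hball]; exact h3.trans (by gcongr)
    calc ENNReal.ofReal s ^ (n + 1) = ENNReal.ofReal s ^ (n + 1) * ω * ω⁻¹ := by
          rw [mul_assoc, ENNReal.mul_inv_cancel hω0 hωt, mul_one]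
      _ ≤ 2 * (M * ν (c ⁻¹' {a} ∩ {x | cubeDist y x < s})) * ω⁻¹ := by gcongr
      _ = _ := by rw [hC₂]; ring
  set v₀ := ν (c ⁻¹' {a} ∩ {x | cubeDist y x < s₁}) with hv₀
  have hv₀t : v₀ ≠ ⊤ := by
    have hsub : c ⁻¹' {a} ∩ {x | cubeDist y x < s₁} ⊆ ball y s₀ :=
      fun x hx => hcube s₁ le_rfl (show cubeDist y x ≤ s₁ from le_of_lt hx.2)
    refine ne_top_of_le_ne_top (ENNReal.mul_ne_top hM (volume_ball_ne_top y s₀)) ?_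
    exact (hw.vol_le _).trans (by gcongr)
  refine ⟨v₀, fun h => ?_, hv₀t, ?_⟩
  · have := hlow s₁ hs₁0 le_rfl
    rw [← hv₀, h, mul_zero, nonpos_iff_eq_zero, pow_eq_zero_iff (by simp)] at this
    exact absurd (ENNReal.ofReal_eq_zero.1 this) (not_le.2 hs₁0)
  intro ε hε c' hc' hcc
  by_cases hε0 : ε = 0
  · exact ⟨c', hc', fun _ _ => rfl, by simp [hε0], by simp [hε0], fun _ _ _ => rfl, le_self_add⟩
  have hum : Measurable (cubeDist y) := (continuous_cubeDist y).measurable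
  have hrest : ∀ s, (ν.restrict (c ⁻¹' {a} ∩ {x | cubeDist y x < s₁})) {x | cubeDist y x < s} =
      ν (c ⁻¹' {a} ∩ {x | cubeDist y x < s₁} ∩ {x | cubeDist y x < s}) := fun s => by
    rw [Measure.restrict_apply (measurableSet_lt hum measurable_const), inter_comm]
  have : IsFiniteMeasure (ν.restrict (c ⁻¹' {a} ∩ {x | cubeDist y x < s₁})) :=
    ⟨by rw [Measure.restrict_apply_univ]; exact hv₀t.lt_top⟩
  obtain ⟨s, hs, hss, hsε⟩ := exists_level
    (μ := ν.restrict (c ⁻¹' {a} ∩ {x | cubeDist y x < s₁})) (u := cubeDist y)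
    hum (fun x => dist_nonneg)
    (fun t => by
      refine Measure.absolutelyContinuous_of_le Measure.restrict_le_self ?_
      have := hw.vol_le {x | cubeDist y x = t}
      rwa [volume_cubeDist_eq, mul_zero, nonpos_iff_eq_zero] at this) hs₁0 hε0
    (by rw [hrest, inter_assoc, inter_self]; exact hε)
  have hss' : {x | cubeDist y x < s} ⊆ {x | cubeDist y x < s₁} := fun x hx => lt_of_lt_of_le hx hss
  rw [hrest, inter_assoc, inter_eq_self_of_subset_right hss'] at hsε
  set U := {x | cubeDist y x < s} with hUdef
  have hU : IsOpen U := isOpen_lt (continuous_cubeDist y) continuous_const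
  have hV : IsOpen {x | s < cubeDist y x} := isOpen_lt continuous_const (continuous_cubeDist y)
  have hUW : U ⊆ ball y s₀ := fun x (hx : cubeDist y x < s) =>
    hcube s hss (show cubeDist y x ≤ s from hx.le)
  have hba : b ∉ ({a} : Finset L) := by simpa using hab.symm
  have heq : c' ⁻¹' {a} ∩ U = c ⁻¹' {a} ∩ U := by
    ext x
    refine and_congr_left fun hx => ?_
    simp [hcc x (hUW hx)]
  have hεt : ε ≠ ⊤ := ne_top_of_le_ne_top hv₀t hε
  refine ⟨mergeLab c' U {a} b, hc'.merge hU.measurableSet hba, fun x hx =>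
    mergeLab_of_notMem (Or.inl fun h => hx (hUW h)), ?_, ?_, fun l hla hlb => ?_, ?_⟩
  · rw [mergeLab_preimage_of_mem hba (by simp), ← hsε, ← heq, add_comm]
    exact measure_inter_add_sdiff _ hU.measurableSet
  · rw [mergeLab_preimage_self, measure_union _ ((hc'.preimage _).inter hU.measurableSet)]
    · rw [← hsε, ← heq, Finset.coe_singleton]
    · refine disjoint_left.2 fun x (hx : c' x = b) hx' => hab ?_
      have : c' x = a := by simpa using hx'.1
      rw [← this, hx]
  · rw [mergeLab_preimage_of_notMem hlb (by simpa using hla)]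
  · refine le_self_add.trans ((totalPer_merge_le (γ := γ) hc' hU hV ?_ hba).trans ?_)
    · exact disjoint_left.2 fun x (hx : cubeDist y x < s) (hx' : s < cubeDist y x) => lt_asymm hx hx'
    refine add_le_add le_rfl ?_
    have hbd : ∀ l, γ (cellBdry (mergeLab c' U {a} b) l ∩ (U ∪ {x | s < cubeDist y x})ᶜ) ≤
        M * C₁ * ENNReal.ofReal s ^ n := fun l => by
      refine (hw.per_le _).trans ?_
      rw [mul_assoc]
      gcongr
      refine (measure_mono ?_).trans (hsph y s)
      rintro x ⟨-, hx⟩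
      simp only [hUdef, mem_compl_iff, mem_union, mem_ofPred_eq, not_or, not_lt] at hx
      exact le_antisymm hx.2 hx.1
    have hpow : ENNReal.ofReal s ^ n ≤ C₂ ^ β * ε ^ β := by
      have h1 := ENNReal.rpow_le_rpow (hlow s hs hss) hβ0
      rw [← hUdef, hsε, ENNReal.mul_rpow_of_nonneg _ _ hβ0, ← ENNReal.rpow_natCast,
        ← ENNReal.rpow_mul] at h1
      have : (((n + 1 : ℕ) : ℝ)) * β = n := by rw [hβ]; push_cast; field_simp
      rwa [this, ENNReal.rpow_natCast] at h1
    calc _ ≤ ∑ _l : L, M * C₁ * ENNReal.ofReal s ^ n := Finset.sum_le_sum fun l _ => hbd l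
      _ = Fintype.card L * (M * C₁ * ENNReal.ofReal s ^ n) := by
          rw [Finset.sum_const, Finset.card_univ, nsmul_eq_mul]
      _ ≤ Fintype.card L * (M * C₁ * (C₂ ^ β * ε ^ β)) := by gcongr
      _ = _ := by ring

/-- A nonincreasing tail integral satisfying a differential inequality with a power less than one
vanishes in finite time. -/
lemma exists_tail_eq_zero {φ : ℝ → ℝ≥0∞} {β : ℝ} (hβ0 : 0 ≤ β) (hβ1 : β < 1)
    {θ : ℝ≥0∞} (hθ : θ ≠ 0) {R₀ : ℝ} (hfin : ∫⁻ t in Ioi R₀, φ t ≠ ⊤)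
    (h : ∀ᵐ R, R₀ < R → θ * (∫⁻ t in Ioi R, φ t) ^ β ≤ φ R) : ∃ R, ∫⁻ t in Ioi R, φ t = 0 := by
  set V : ℝ → ℝ≥0∞ := fun R => ∫⁻ t in Ioi R, φ t with hV
  have hanti : ∀ R R', R ≤ R' → V R' ≤ V R := fun R R' hR =>
    lintegral_mono_set (Ioi_subset_Ioi hR)
  obtain ⟨t₀, ht₀, ht₀θ⟩ : ∃ t : ℝ, 0 < t ∧ ENNReal.ofReal t ≤ θ := by
    refine ⟨(min θ 1).toReal, ENNReal.toReal_pos ?_ ?_, ?_⟩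
    · exact (lt_min (pos_iff_ne_zero.2 hθ) one_pos).ne'
    · exact ne_top_of_le_ne_top ENNReal.one_ne_top (min_le_right _ _)
    · rw [ENNReal.ofReal_toReal (ne_top_of_le_ne_top ENNReal.one_ne_top (min_le_right _ _))]
      exact min_le_left _ _
  have hstep : ∀ R u : ℝ, R₀ ≤ R → 0 ≤ u → V R ≤ ENNReal.ofReal u →
      V (R + u ^ (1 - β) / t₀) ≤ ENNReal.ofReal (u / 2) := by
    intro R u hR hu hVu
    set a := u ^ (1 - β) / t₀ with ha
    have ha0 : 0 ≤ a := by positivity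
    by_contra! hcon
    have hsplit : V R = (∫⁻ t in Ioc R (R + a), φ t) + V (R + a) := by
      rw [hV]
      simp only
      rw [← lintegral_union measurableSet_Ioi, Ioc_union_Ioi_eq_Ioi (by linarith)]
      exact disjoint_left.2 fun t ht ht' => not_lt.2 ht.2 ht'
    have hlow : ENNReal.ofReal (u / 2) ≤ ∫⁻ t in Ioc R (R + a), φ t := by
      have h1 : ∫⁻ _ in Ioc R (R + a), ENNReal.ofReal t₀ * ENNReal.ofReal (u / 2) ^ β ≤
          ∫⁻ t in Ioc R (R + a), φ t := by
        refine lintegral_mono_ae ?_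
        rw [ae_restrict_iff' measurableSet_Ioc]
        filter_upwards [h] with t ht htI
        refine le_trans ?_ (ht (hR.trans_lt htI.1))
        gcongr
        exact hcon.le.trans (hanti _ _ htI.2)
      refine le_trans ?_ h1
      rw [lintegral_const, Measure.restrict_apply_univ, Real.volume_Ioc, add_sub_cancel_left,
        ENNReal.ofReal_rpow_of_nonneg (by positivity) hβ0, ← ENNReal.ofReal_mul ht₀.le,
        ← ENNReal.ofReal_mul (by positivity)]
      refine ENNReal.ofReal_le_ofReal ?_
      have e1 : t₀ * (u / 2) ^ β * a = u ^ (1 - β) * (u / 2) ^ β := by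
        rw [ha]; field_simp
      rw [e1]
      calc u / 2 = (u / 2) ^ (1 - β) * (u / 2) ^ β := by
            rw [← Real.rpow_add' (by positivity) (by simp)]; simp
        _ ≤ _ := by
            gcongr
            linarith
    have : ENNReal.ofReal u < V R := by
      rw [hsplit]
      calc ENNReal.ofReal u = ENNReal.ofReal (u / 2) + ENNReal.ofReal (u / 2) := by
            rw [← ENNReal.ofReal_add (by positivity) (by positivity), add_halves]
        _ < _ := ENNReal.add_lt_add_of_le_of_lt (by simp) hlow hcon
    exact absurd hVu (not_le.2 this)
  set q := (V R₀).toReal with hq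
  have hq0 : 0 ≤ q := ENNReal.toReal_nonneg
  set w : ℕ → ℝ := fun i => (q / 2 ^ i) ^ (1 - β) / t₀ with hw
  have hw0 : ∀ i, 0 ≤ w i := fun i => by positivity
  have hsum : Summable w := by
    have : w = fun i => (q ^ (1 - β) / t₀) * ((1 / 2 : ℝ) ^ (1 - β)) ^ i := by
      funext i
      rw [hw]
      simp only
      rw [← Real.rpow_mul_natCast (by norm_num), mul_comm (1 - β), Real.rpow_natCast_mul (by norm_num),
        div_eq_mul_one_div q, ← one_div_pow, Real.mul_rpow hq0 (by positivity)]
      ring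
    rw [this]
    refine (summable_geometric_of_lt_one (by positivity) ?_).mul_left _
    exact Real.rpow_lt_one (by norm_num) (by norm_num) (by linarith)
  have hind : ∀ p : ℕ, V (R₀ + ∑ i ∈ Finset.range p, w i) ≤ ENNReal.ofReal (q / 2 ^ p) := by
    intro p
    induction p with
    | zero => simp [hq, ENNReal.ofReal_toReal hfin, hV]
    | succ p ih =>
      have := hstep _ (q / 2 ^ p) (by linarith [Finset.sum_nonneg fun i (_ : i ∈ Finset.range p) => hw0 i])
        (by positivity) ih
      rw [Finset.sum_range_succ, ← add_assoc, pow_succ, ← div_div]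
      exact this
  refine ⟨R₀ + ∑' i, w i, ?_⟩
  have hle : ∀ p : ℕ, V (R₀ + ∑' i, w i) ≤ ENNReal.ofReal (q / 2 ^ p) := fun p =>
    (hanti _ _ (by gcongr; exact hsum.sum_le_tsum _ fun i _ => hw0 i)).trans (hind p)
  have hlim : Tendsto (fun p : ℕ => ENNReal.ofReal (q / 2 ^ p)) atTop (𝓝 0) := by
    rw [← ENNReal.ofReal_zero]
    refine ENNReal.tendsto_ofReal ?_
    have := (tendsto_pow_atTop_nhds_zero_of_lt_one (r := (1 / 2 : ℝ)) (by norm_num)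
      (by norm_num)).const_mul q
    simpa [div_eq_mul_inv] using this
  exact le_antisymm (ge_of_tendsto' hlim hle) zero_le

lemma ae_mul_sign {p : ℝ → Prop} {σ : ℝ} (hσ : σ = 1 ∨ σ = -1) (h : ∀ᵐ s, p s) :
    ∀ᵐ R, p (σ * R) := by
  rcases hσ with rfl | rfl
  · simpa using h
  · simpa using (Measure.measurePreserving_neg (volume : Measure ℝ)).quasiMeasurePreserving.ae h

/-- The measure of the slice of `A` by the hyperplane bounding the half-space. -/
def sliceVol (A : Set (Pt (n + 1))) (k : Fin (n + 1)) (σ R : ℝ) : ℝ≥0∞ :=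
  volume {z | lineAt k (σ * R) z ∈ A}

lemma volume_inter_halfSp {A : Set (Pt (n + 1))} (hA : MeasurableSet A) (k : Fin (n + 1)) {σ : ℝ}
    (hσ : σ = 1 ∨ σ = -1) (R : ℝ) :
    volume (A ∩ halfSp k σ R) = ∫⁻ t in Ioi R, sliceVol A k σ t := by
  rw [volume_eq_slice k (hA.inter (measurableSet_halfSp k σ R))]
  have h1 : ∀ s, volume {z : Fin n → ℝ | lineAt k s z ∈ A ∩ halfSp k σ R} =
      {s | R < σ * s}.indicator (fun s => volume {z : Fin n → ℝ | lineAt k s z ∈ A}) s := by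
    intro s
    by_cases hs : R < σ * s
    · rw [indicator_of_mem (by exact hs)]
      congr 1; ext z; simp [halfSp, hs]
    · rw [indicator_of_notMem (by exact hs)]
      convert measure_empty (μ := volume)
      ext z; simp [halfSp, hs]
  simp_rw [h1]
  have hm : MeasurableSet {s | R < σ * s} := measurableSet_lt measurable_const (by fun_prop)
  rcases hσ with rfl | rfl
  · simp only [one_mul, sliceVol]
    rw [← lintegral_indicator measurableSet_Ioi]
    rfl
  · rw [← (Measure.measurePreserving_neg (volume : Measure ℝ)).lintegral_comp
      ((measurable_volume_slice k hA).indicator hm), ← lintegral_indicator measurableSet_Ioi]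
    refine lintegral_congr fun s => ?_
    simp [indicator, sliceVol]

lemma exists_small_slice {A : Set (Pt (n + 1))} (hA : MeasurableSet A) (hfin : volume A ≠ ⊤)
    {k : Fin (n + 1)} {σ : ℝ} (hσ : σ = 1 ∨ σ = -1) (hpos : ∀ R, volume (A ∩ halfSp k σ R) ≠ 0)
    {θ : ℝ≥0∞} (hθ : θ ≠ 0) {p : ℝ → Prop} (hp : ∀ᵐ R, p R) (R₀ : ℝ) :
    ∃ R > R₀, p R ∧ sliceVol A k σ R ≤ θ * volume (A ∩ halfSp k σ R) ^ ((n : ℝ) / (n + 1)) := by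
  by_contra! hcon
  have hβ1 : (n : ℝ) / (n + 1) < 1 := by rw [div_lt_one (by positivity)]; linarith
  have hfin' : ∫⁻ t in Ioi R₀, sliceVol A k σ t ≠ ⊤ := by
    rw [← volume_inter_halfSp hA k hσ]
    exact ne_top_of_le_ne_top hfin (measure_mono inter_subset_left)
  obtain ⟨R, hR⟩ := exists_tail_eq_zero (φ := sliceVol A k σ) (by positivity) hβ1 hθ hfin' (by
    filter_upwards [hp] with R hpR hR
    rw [← volume_inter_halfSp hA k hσ]
    exact (hcon R hR hpR).le)
  exact hpos R (by rw [volume_inter_halfSp hA k hσ, hR])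

lemma exists_tail_le {A : Set (Pt (n + 1))} (hA : MeasurableSet A) (hfin : volume A ≠ ⊤)
    (k : Fin (n + 1)) (σ : ℝ) {v : ℝ≥0∞} (hv : v ≠ 0) :
    ∃ R₁ : ℝ, ∀ R ≥ R₁, volume (A ∩ halfSp k σ R) ≤ v := by
  have hlim : Tendsto (fun p : ℕ => volume (A ∩ halfSp k σ p)) atTop
      (𝓝 (volume (⋂ p : ℕ, A ∩ halfSp k σ p))) := by
    refine tendsto_measure_iInter_atTop
      (fun p => (hA.inter (measurableSet_halfSp k σ p)).nullMeasurableSet) ?_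
      ⟨0, ne_top_of_le_ne_top hfin (measure_mono inter_subset_left)⟩
    exact fun p q hpq => inter_subset_inter_right _ (halfSp_anti k σ (by exact_mod_cast hpq))
  have hempty : ⋂ p : ℕ, A ∩ halfSp k σ p = ∅ := by
    refine eq_empty_of_forall_notMem fun x hx => ?_
    obtain ⟨p, hp⟩ := exists_nat_gt (σ * x k)
    have : (p : ℝ) < σ * x k := (mem_iInter.1 hx p).2
    linarith
  rw [hempty, measure_empty] at hlim
  obtain ⟨p, hp⟩ := ((ENNReal.tendsto_nhds_zero.1 hlim) v (pos_iff_ne_zero.2 hv)).exists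
  exact ⟨p, fun R hR => (measure_mono (inter_subset_inter_right _ (halfSp_anti k σ hR))).trans hp⟩

/-- The new boundary created by a cut along a generic hyperplane is controlled by the slice. -/
lemma exists_slice_bound (n : ℕ) (L : Type*) [Fintype L] [DecidableEq L] {M : ℝ≥0∞} (hM : M ≠ ⊤) :
    ∃ K : ℝ≥0∞, K ≠ ⊤ ∧ ∀ (ν γ : Measure (Pt (n + 1))), Weights ν γ M →
      ∀ (c : Pt (n + 1) → L), MeasLab c → ∀ (S : Finset L) (j : L), j ∉ S → ∀ (k : Fin (n + 1)) (σ : ℝ),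
      (σ = 1 ∨ σ = -1) → ∀ᵐ R, ∑ l, γ (cellBdry (mergeLab c (halfSp k σ R) S j) l ∩
        (halfSp k σ R ∪ {x | σ * x k < R})ᶜ) ≤ K * sliceVol (c ⁻¹' S) k σ R := by
  obtain ⟨C, hC, hsl⟩ := exists_hausdorff_slice_le n
  refine ⟨Fintype.card L * (M * C), by finiteness, fun ν γ hw c hc S j hj k σ hσ => ?_⟩
  filter_upwards [ae_mul_sign hσ (ae_slice k (p := fun x => x ∈ purePts c (c x))
    (ae_mem_purePts hc))] with R hR
  have hbd : ∀ l, γ (cellBdry (mergeLab c (halfSp k σ R) S j) l ∩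
      (halfSp k σ R ∪ {x | σ * x k < R})ᶜ) ≤ M * C * sliceVol (c ⁻¹' S) k σ R := by
    intro l
    refine (hw.per_le _).trans ?_
    rw [mul_assoc]
    gcongr
    set D : Set (Fin n → ℝ) := {z | lineAt k (σ * R) z ∈ c ⁻¹' S ∨
      lineAt k (σ * R) z ∉ purePts c (c (lineAt k (σ * R) z))} with hD
    have hsub : cellBdry (mergeLab c (halfSp k σ R) S j) l ∩
        (halfSp k σ R ∪ {x | σ * x k < R})ᶜ ⊆ lineAt k (σ * R) '' D := by
      rintro x ⟨hx, hxR⟩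
      simp only [halfSp, mem_compl_iff, mem_union, mem_ofPred_eq, not_or, not_lt] at hxR
      have hxk : x k = σ * R := by
        have : σ * x k = R := le_antisymm hxR.1 hxR.2
        rw [← this]; rcases hσ with rfl | rfl <;> ring
      have hxe : lineAt k (σ * R) (shadow k x) = x := (eq_lineAt_iff.2 ⟨hxk, rfl⟩).symm
      refine ⟨shadow k x, ?_, hxe⟩
      rw [hD, mem_ofPred_eq, hxe]
      by_contra! hcon
      refine notMem_cellBdry_of_pure (hc.merge (measurableSet_halfSp k σ R) hj) l
        (purePts_of_zeroDens hcon.2 ?_) hx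
      refine zeroDens_anti (F := c ⁻¹' S) (fun y hy => ?_) (zeroDens_preimage fun l' hl' =>
        zeroDens_of_pure (fun h => hcon.1 ?_) hcon.2)
      · by_contra h
        exact hy (mergeLab_of_notMem (Or.inr h))
      · change c x ∈ S
        rw [h]; exact hl'
    refine (measure_mono hsub).trans ((hsl k _ D).trans ?_)
    gcongr
    refine measure_mono_ae ?_
    filter_upwards [hR] with z hz hzD
    exact hzD.resolve_right (not_not.2 hz)
  calc _ ≤ ∑ _l : L, M * C * sliceVol (c ⁻¹' S) k σ R := Finset.sum_le_sum fun l _ => hbd l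
    _ = _ := by rw [Finset.sum_const, Finset.card_univ, nsmul_eq_mul]; ring

/-- A minimal labelling with exterior label `z`, every label occurring. -/
structure MinimalLab (ν γ : Measure (Pt (n + 1))) (M : ℝ≥0∞) (z : L) (c : Pt (n + 1) → L) :
    Prop where
  weights : Weights ν γ M
  meas : MeasLab c
  min : MinLab ν γ z c
  per_ne_top : totalPer γ c ≠ ⊤
  vol_ne_zero : ∀ l, volume (c ⁻¹' {l}) ≠ 0
  vol_ne_top : ∀ l ≠ z, volume (c ⁻¹' {l}) ≠ ⊤

lemma exists_pos_le {ι : Type*} [Finite ι] (f : ι → ℝ≥0∞) (hf : ∀ i, f i ≠ 0) :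
    ∃ v, v ≠ 0 ∧ v ≠ ⊤ ∧ ∀ i, v ≤ f i := by
  have := Fintype.ofFinite ι
  refine ⟨min 1 (Finset.univ.inf f), ?_, ?_, fun i => ?_⟩
  · refine (lt_min one_pos ?_).ne'
    rw [Finset.lt_inf_iff ENNReal.zero_lt_top]
    exact fun i _ => pos_iff_ne_zero.2 (hf i)
  · exact ne_top_of_le_ne_top ENNReal.one_ne_top (min_le_left _ _)
  · exact (min_le_right _ _).trans (Finset.inf_le (Finset.mem_univ i))

lemma exists_disjoint_balls {X ι : Type*} [MetricSpace X] [Finite ι] {y : ι → X}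
    (hy : Function.Injective y) : ∃ s > (0 : ℝ), Pairwise fun i j => Disjoint (ball (y i) s)
      (ball (y j) s) := by
  have h : ∀ᶠ s : ℝ in 𝓝[>] 0, ∀ i j, i ≠ j → Disjoint (ball (y i) s) (ball (y j) s) := by
    refine eventually_all.2 fun i => eventually_all.2 fun j => ?_
    by_cases hij : i = j
    · exact Eventually.of_forall fun s h => absurd hij h
    · have hd : 0 < dist (y i) (y j) := dist_pos.2 fun h => hij (hy h)
      filter_upwards [mem_nhdsWithin_of_mem_nhds (Iio_mem_nhds (half_pos hd))] with s hs _
      refine ball_disjoint_ball ?_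
      have : s < dist (y i) (y j) / 2 := hs
      linarith
  obtain ⟨s, hs, hs0⟩ := (h.and self_mem_nhdsWithin).exists
  exact ⟨s, hs0, fun i j hij => hs i j hij⟩

lemma disjoint_ball_halfSp {k : Fin N} {σ : ℝ} (hσ : σ = 1 ∨ σ = -1) {R₁ R : ℝ} (hR : R₁ ≤ R) :
    Disjoint (ball (0 : Pt N) R₁) (halfSp k σ R) := by
  refine disjoint_left.2 fun x hx (hx' : R < σ * x k) => ?_
  have h1 := abs_coord_sub_le k x 0
  rw [mem_ball] at hx
  have h2 : σ * x k ≤ |x k| := by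
    rcases hσ with rfl | rfl
    · simpa using le_abs_self _
    · simpa using neg_le_abs _
  simp at h1 h2 hx
  linarith

lemma MinimalLab.exists_transfer_family {ν γ : Measure (Pt (n + 1))} {M : ℝ≥0∞} {z : L}
    {c : Pt (n + 1) → L} (h : MinimalLab ν γ M z c) :
    ∃ C v₀ : ℝ≥0∞, ∃ R₁ : ℝ, C ≠ ⊤ ∧ v₀ ≠ 0 ∧ v₀ ≠ ⊤ ∧ ∀ j, ∃ W : L → Set (Pt (n + 1)),
      Pairwise (fun l l' => Disjoint (W l) (W l')) ∧ (∀ l, W l ⊆ ball 0 R₁) ∧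
      ∀ l ≠ j, CanTransfer ν γ c (W l) j l C v₀ := by
  obtain ⟨C, hC, hins⟩ := exists_canTransfer_of_pure n L h.weights.ne_top
  have hpts : ∀ j, ∃ y : L → Pt (n + 1), Function.Injective y ∧ ∀ l, y l ∈ purePts c j := by
    intro j
    have hinf : (purePts c j).Infinite := by
      intro hf
      refine h.vol_ne_zero j (measure_mono_null_ae ?_ (hf.measure_zero volume))
      filter_upwards [ae_mem_purePts h.meas] with x hx (hxj : c x = j)
      exact hxj ▸ hx
    have e := hinf.natEmbedding
    let q : L ↪ purePts c j :=
      ((Fintype.equivFin L).toEmbedding.trans Fin.valEmbedding).trans e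
    exact ⟨fun l => q l, fun l l' hll => q.injective (Subtype.ext hll), fun l => (q l).2⟩
  choose y hyinj hypure using hpts
  choose s hs0 hsd using fun j => exists_disjoint_balls (hyinj j)
  have hv : ∀ p : L × L, ∃ v₀, v₀ ≠ 0 ∧ v₀ ≠ ⊤ ∧
      (p.1 ≠ p.2 → CanTransfer ν γ c (ball (y p.1 p.2) (s p.1)) p.1 p.2 C v₀) := by
    rintro ⟨j, l⟩
    by_cases hjl : j = l
    · exact ⟨1, one_ne_zero, ENNReal.one_ne_top, fun h => absurd hjl h⟩
    · obtain ⟨v₀, h1, h2, h3⟩ := hins ν γ h.weights c h.meas j l hjl (y j l) (hypure j l) (s j)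
        (hs0 j)
      exact ⟨v₀, h1, h2, fun _ => h3⟩
  choose v hv0 hvt hvT using hv
  obtain ⟨v₀, h1, h2, h3⟩ := exists_pos_le v hv0
  obtain ⟨B, hB⟩ := (Set.finite_range fun p : L × L => ‖y p.1 p.2‖ + s p.1).bddAbove
  refine ⟨C, v₀, B, hC, h1, h2, fun j => ⟨fun l => ball (y j l) (s j), hsd j, fun l => ?_,
    fun l hl => (hvT (j, l) hl.symm).mono subset_rfl le_rfl (h3 _)⟩⟩
  refine ball_subset_ball' ?_
  rw [dist_zero_right, add_comm]
  exact hB (mem_range_self (j, l))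

lemma MinimalLab.volume_preimage_ne_top {ν γ : Measure (Pt (n + 1))} {M : ℝ≥0∞} {z : L}
    {c : Pt (n + 1) → L} (h : MinimalLab ν γ M z c) {S : Finset L} (hz : z ∉ S) :
    volume (c ⁻¹' S) ≠ ⊤ := by
  have : c ⁻¹' S = ⋃ l ∈ S, c ⁻¹' {l} := by ext; simp
  rw [this]
  refine ne_top_of_le_ne_top ?_ (measure_biUnion_finset_le _ _)
  exact ENNReal.sum_ne_top.2 fun l hl => h.vol_ne_top l fun e => hz (e ▸ hl)

/-- At suitable arbitrarily large radii the boundary of a union of cells in the half-space is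
controlled by its volume there. -/
lemma MinimalLab.exists_perimeter_le {ν γ : Measure (Pt (n + 1))} {M : ℝ≥0∞} {z : L}
    {c : Pt (n + 1) → L} (h : MinimalLab ν γ M z c) {S : Finset L} (hz : z ∉ S)
    {k : Fin (n + 1)} {σ : ℝ} (hσ : σ = 1 ∨ σ = -1)
    (hpos : ∀ R, volume (c ⁻¹' S ∩ halfSp k σ R) ≠ 0) :
    ∃ C : ℝ≥0∞, C ≠ ⊤ ∧ ∀ R₀, ∃ R > R₀, μH[(n : ℝ)] (essBdry (c ⁻¹' S) ∩ halfSp k σ R) ≤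
      C * volume (c ⁻¹' S ∩ halfSp k σ R) ^ ((n : ℝ) / (n + 1)) := by
  obtain ⟨C₁, v₀, R₁, hC₁, hv0, hvt, hfam⟩ := h.exists_transfer_family
  obtain ⟨K, hK, hslice⟩ := exists_slice_bound n L h.weights.ne_top
  have hM := h.weights.ne_top
  set β : ℝ := (n : ℝ) / (n + 1) with hβ
  have hβ0 : 0 ≤ β := by positivity
  have hS := h.volume_preimage_ne_top hz
  have hSm : MeasurableSet (c ⁻¹' S) := h.meas.preimage _
  obtain ⟨R₂, hR₂⟩ := exists_tail_le hSm hS k σ (v := v₀ / M)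
    (ENNReal.div_pos hv0 hM).ne'
  refine ⟨M * (Fintype.card L * (K + S.card * (C₁ * M ^ β))), by finiteness, fun R₀ => ?_⟩
  have hae : ∀ᵐ R, ∀ j, j ∉ S → ∑ l, γ (cellBdry (mergeLab c (halfSp k σ R) S j) l ∩
      (halfSp k σ R ∪ {x | σ * x k < R})ᶜ) ≤ K * sliceVol (c ⁻¹' S) k σ R := by
    refine ae_all_iff.2 fun j => ?_
    by_cases hj : j ∈ S
    · exact Eventually.of_forall fun R h => absurd hj h
    · filter_upwards [hslice ν γ h.weights c h.meas S j hj k σ hσ] with R hR _ using hR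
  obtain ⟨R, hR, hRs, hsm⟩ := exists_small_slice hSm hS hσ hpos (one_ne_zero (α := ℝ≥0∞)) hae
    (max R₀ (max R₁ R₂))
  have hR₀ : R₀ < R := (le_max_left _ _).trans_lt hR
  have hR₁' : R₁ ≤ R := ((le_max_left _ _).trans (le_max_right _ _)).trans hR.le
  have hR₂' : R₂ ≤ R := ((le_max_right _ _).trans (le_max_right _ _)).trans hR.le
  refine ⟨R, hR₀, ?_⟩
  set V := volume (c ⁻¹' S ∩ halfSp k σ R) with hV
  have hMV : M * V ≤ v₀ := by
    calc M * V ≤ M * (v₀ / M) := by gcongr; exact hR₂ R hR₂'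
      _ ≤ v₀ := ENNReal.mul_div_le
  have hj : ∀ j ∈ Sᶜ, γ (essBdry (c ⁻¹' S) ∩ cellBdry c j ∩ halfSp k σ R) ≤
      (K + S.card * (C₁ * M ^ β)) * V ^ β := by
    intro j hj
    rw [Finset.mem_compl] at hj
    obtain ⟨W, hWd, hWb, hWT⟩ := hfam j
    have hV' : IsOpen {x : Pt (n + 1) | σ * x k < R} := isOpen_lt (by fun_prop) continuous_const
    refine (merge_bound h.meas h.min h.per_ne_top (isOpen_halfSp k σ R) hV' ?_ hj
      (fun l _ l' _ hl => hWd hl) (fun l hl => hWT l fun e => hj (e ▸ hl))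
      (fun l _ => (disjoint_ball_halfSp hσ hR₁').mono_left (hWb l)) hMV
      (ne_top_of_le_ne_top hvt hMV) (h.weights.vol_le _)).trans ?_
    · refine disjoint_left.2 fun x (hx : R < σ * x k) (hx' : σ * x k < R) => lt_asymm hx hx'
    · rw [add_mul]
      refine add_le_add ((hRs j hj).trans ?_) ?_
      · gcongr; rwa [one_mul] at hsm
      · rw [ENNReal.mul_rpow_of_nonneg _ _ hβ0, mul_assoc, mul_assoc]
  calc μH[(n : ℝ)] (essBdry (c ⁻¹' S) ∩ halfSp k σ R)
      ≤ M * γ (essBdry (c ⁻¹' S) ∩ halfSp k σ R) := h.weights.le_per _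
    _ ≤ M * ∑ j ∈ Sᶜ, γ (essBdry (c ⁻¹' S) ∩ cellBdry c j ∩ halfSp k σ R) := by
        gcongr
        refine (measure_mono ?_).trans (measure_biUnion_finset_le _ _)
        intro x hx
        have := essBdry_preimage_subset_compl h.meas _ hx.1
        simp only [mem_iUnion] at this ⊢
        obtain ⟨l, hl, hxl⟩ := this
        exact ⟨l, by simpa using hl, ⟨hx.1, hxl⟩, hx.2⟩
    _ ≤ M * ∑ j ∈ Sᶜ, (K + S.card * (C₁ * M ^ β)) * V ^ β := by
        gcongr with j hj'; exact hj j hj'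
    _ ≤ M * (Fintype.card L * ((K + S.card * (C₁ * M ^ β)) * V ^ β)) := by
        rw [Finset.sum_const, nsmul_eq_mul]
        gcongr
        exact Finset.card_le_univ _
    _ = _ := by ring

/-- If all labels can be filled arbitrarily cheaply from the exterior one, the cells have no
tails in the given direction. -/
lemma MinimalLab.exists_tail_eq_zero (hn : 1 ≤ n) {ν γ : Measure (Pt (n + 1))} {M : ℝ≥0∞} {z : L}
    {c : Pt (n + 1) → L} (h : MinimalLab ν γ M z c) {S : Finset L} (hz : z ∉ S)
    {k : Fin (n + 1)} {σ : ℝ} (hσ : σ = 1 ∨ σ = -1) {R₀ : ℝ}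
    (hS0 : ∀ l ∉ S, l ≠ z → volume (c ⁻¹' {l} ∩ halfSp k σ R₀) = 0)
    (hT : ∀ η : ℝ≥0∞, η ≠ 0 → ∃ R₁, ∃ W : L → Set (Pt (n + 1)), ∃ v₀ ≠ 0, v₀ ≠ ⊤ ∧
      (S : Set L).PairwiseDisjoint W ∧ (∀ l ∈ S, Disjoint (W l) (halfSp k σ R₁)) ∧
      ∀ l ∈ S, CanTransfer ν γ c (W l) z l η v₀) :
    ∃ R, volume (c ⁻¹' S ∩ halfSp k σ R) = 0 := by
  by_contra! hpos
  obtain ⟨K, hK, hslice⟩ := exists_slice_bound n L h.weights.ne_top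
  have hM := h.weights.ne_top
  set β : ℝ := (n : ℝ) / (n + 1) with hβ
  have hβ0 : 0 ≤ β := by positivity
  have hS := h.volume_preimage_ne_top hz
  have hSm : MeasurableSet (c ⁻¹' S) := h.meas.preimage _
  obtain ⟨η, hη0, -, hη⟩ := exists_pos_le (fun _ : Unit =>
    4⁻¹ / (M * (n + 1) * (S.card * M ^ β))) (fun _ => (ENNReal.div_pos (by simp) (by finiteness)).ne')
  obtain ⟨θ, hθ0, -, hθ⟩ := exists_pos_le (fun _ : Unit =>
    4⁻¹ / (M * (n + 1) * K)) (fun _ => (ENNReal.div_pos (by simp) (by finiteness)).ne')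
  obtain ⟨R₁, W, v₀, hv0, hvt, hWd, hWU, hWT⟩ := hT η hη0
  obtain ⟨R₂, hR₂⟩ := exists_tail_le hSm hS k σ (v := v₀ / M)
    (ENNReal.div_pos hv0 hM).ne'
  obtain ⟨R, hR, hRs, hsm⟩ := exists_small_slice hSm hS hσ hpos hθ0
    (hslice ν γ h.weights c h.meas S z hz k σ hσ) (max R₀ (max R₁ R₂))
  have hR₀ : R₀ ≤ R := (le_max_left _ _).trans hR.le
  have hR₁' : R₁ ≤ R := ((le_max_left _ _).trans (le_max_right _ _)).trans hR.le
  have hR₂' : R₂ ≤ R := ((le_max_right _ _).trans (le_max_right _ _)).trans hR.le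
  set V := volume (c ⁻¹' S ∩ halfSp k σ R) with hV
  have hMV : M * V ≤ v₀ := by
    calc M * V ≤ M * (v₀ / M) := by gcongr; exact hR₂ R hR₂'
      _ ≤ v₀ := ENNReal.mul_div_le
  have hV' : IsOpen {x : Pt (n + 1) | σ * x k < R} := isOpen_lt (by fun_prop) continuous_const
  have key := merge_bound h.meas h.min h.per_ne_top (isOpen_halfSp k σ R) hV'
    (disjoint_left.2 fun x (hx : R < σ * x k) (hx' : σ * x k < R) => lt_asymm hx hx') hz
    hWd hWT (fun l hl => (hWU l hl).mono_right (halfSp_anti k σ hR₁')) hMV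
    (ne_top_of_le_ne_top hvt hMV) (h.weights.vol_le _)
  have hloc : essBdry (c ⁻¹' S) ∩ halfSp k σ R = cellBdry c z ∩ halfSp k σ R := by
    rw [cellBdry, ← essBdry_compl (h.meas z)]
    refine essBdry_local hSm (h.meas z).compl (isOpen_halfSp k σ R) ?_
    have : ∀ᵐ y, ∀ l, l ∉ S → l ≠ z → y ∉ c ⁻¹' {l} ∩ halfSp k σ R₀ := by
      refine ae_all_iff.2 fun l => ?_
      by_cases hl : l ∉ S ∧ l ≠ z
      · filter_upwards [measure_eq_zero_iff_ae_notMem.1 (hS0 l hl.1 hl.2)] with y hy _ _ using hy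
      · exact Eventually.of_forall fun y h1 h2 => absurd ⟨h1, h2⟩ hl
    filter_upwards [this] with y hy hyU
    constructor
    · intro (h1 : c y ∈ S) (h2 : c y = z)
      exact hz (h2 ▸ h1)
    · intro (h1 : ¬ c y = z)
      by_contra h2
      exact hy (c y) h2 h1 ⟨rfl, halfSp_anti k σ hR₀ hyU⟩
  have hlow : V ^ β ≤ (n + 1) * (M * γ (essBdry (c ⁻¹' S) ∩ cellBdry c z ∩ halfSp k σ R)) := by
    have : essBdry (c ⁻¹' S) ∩ cellBdry c z ∩ halfSp k σ R = essBdry (c ⁻¹' S) ∩ halfSp k σ R := by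
      rw [inter_assoc, ← hloc, ← inter_assoc, inter_self]
    rw [this]
    refine (isoperimetric_halfSp hn hSm hS k hσ R).trans ?_
    gcongr
    exact h.weights.le_per _
  have hVt : V ≠ ⊤ := ne_top_of_le_ne_top hS (measure_mono inter_subset_left)
  have hVβt : V ^ β ≠ ⊤ := by finiteness
  have hVβ0 : V ^ β ≠ 0 := by
    intro h0
    rcases ENNReal.rpow_eq_zero_iff.1 h0 with h1 | h1
    · exact hpos R h1.1
    · exact hVt h1.1
  have h1 : M * (n + 1) * (S.card * M ^ β) * η ≤ 4⁻¹ := by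
    calc _ ≤ M * (n + 1) * (S.card * M ^ β) * (4⁻¹ / (M * (n + 1) * (S.card * M ^ β))) := by
          gcongr; exact hη ()
      _ ≤ _ := ENNReal.mul_div_le
  have h2 : M * (n + 1) * K * θ ≤ 4⁻¹ := by
    calc _ ≤ M * (n + 1) * K * (4⁻¹ / (M * (n + 1) * K)) := by
          gcongr; exact hθ ()
      _ ≤ _ := ENNReal.mul_div_le
  have h3 : V ^ β ≤ 2⁻¹ * V ^ β := by
    calc V ^ β ≤ (n + 1) * (M * (K * (θ * V ^ β) + S.card * (η * (M * V) ^ β))) := by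
          refine hlow.trans ?_
          gcongr
          exact key.trans (by gcongr; exact hRs.trans (by gcongr))
      _ = (M * (n + 1) * K * θ) * V ^ β + (M * (n + 1) * (S.card * M ^ β) * η) * V ^ β := by
          rw [ENNReal.mul_rpow_of_nonneg _ _ hβ0]; ring
      _ ≤ 4⁻¹ * V ^ β + 4⁻¹ * V ^ β := by gcongr
      _ = 2⁻¹ * V ^ β := by
          rw [← add_mul]
          congr 1
          have : (4 : ℝ≥0∞)⁻¹ = 2⁻¹ * 2⁻¹ := by
            rw [← ENNReal.mul_inv (by simp) (by simp)]; norm_num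
          rw [this, ← mul_add, ENNReal.inv_two_add_inv_two, mul_one]
  have h4 : 2⁻¹ * V ^ β < V ^ β := by
    rw [mul_comm, ← div_eq_mul_inv]
    exact ENNReal.half_lt_self hVβ0 hVβt
  exact absurd h3 (not_le.2 h4)

/-- A Lipschitz bump supported in a cylinder of radius `r` and half-height `2 * h`. -/
def bump (k : Fin (n + 1)) (z₁ : Fin n → ℝ) (c₀ h r : ℝ) (x : Pt (n + 1)) : ℝ :=
  max 0 (min (r - dist (shadow k x) z₁) (2 * h - |x k - c₀|))

/-- The vertical displacement by `-q` times the bump. -/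
def push (k : Fin (n + 1)) (z₁ : Fin n → ℝ) (c₀ h r q : ℝ) (x : Pt (n + 1)) : Pt (n + 1) :=
  x - (q * bump k z₁ c₀ h r x) • EuclideanSpace.single k (1 : ℝ)

lemma push_same (k : Fin (n + 1)) (z₁ : Fin n → ℝ) (c₀ h r q : ℝ) (x : Pt (n + 1)) :
    push k z₁ c₀ h r q x k = x k - q * bump k z₁ c₀ h r x := by
  simp [push]

lemma shadow_push (k : Fin (n + 1)) (z₁ : Fin n → ℝ) (c₀ h r q : ℝ) (x : Pt (n + 1)) :
    shadow k (push k z₁ c₀ h r q x) = shadow k x := by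
  ext i; simp [push, shadow]

lemma abs_bump_sub_le (k : Fin (n + 1)) (z₁ : Fin n → ℝ) (c₀ h r : ℝ) (x y : Pt (n + 1)) :
    |bump k z₁ c₀ h r x - bump k z₁ c₀ h r y| ≤
      max (dist (shadow k x) (shadow k y)) |x k - y k| := by
  unfold bump
  refine (abs_max_sub_max_le_max _ _ _ _).trans ?_
  rw [sub_self, abs_zero, max_eq_right (abs_nonneg _)]
  refine (abs_min_sub_min_le_max _ _ _ _).trans (max_le_max ?_ ?_)
  · rw [abs_le]
    have h1 := dist_triangle (shadow k x) (shadow k y) z₁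
    have h2 := dist_triangle (shadow k y) (shadow k x) z₁
    rw [dist_comm (shadow k y) (shadow k x)] at h2
    constructor <;> linarith
  · have h1 := abs_sub_abs_le_abs_sub (x k - c₀) (y k - c₀)
    have h2 := abs_sub_abs_le_abs_sub (y k - c₀) (x k - c₀)
    rw [show x k - c₀ - (y k - c₀) = x k - y k by ring] at h1
    rw [show y k - c₀ - (x k - c₀) = -(x k - y k) by ring, abs_neg] at h2
    rw [abs_le]
    constructor <;> linarith

lemma abs_bump_sub_le_dist (k : Fin (n + 1)) (z₁ : Fin n → ℝ) (c₀ h r : ℝ) (x y : Pt (n + 1)) :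
    |bump k z₁ c₀ h r x - bump k z₁ c₀ h r y| ≤ dist x y := by
  refine (abs_bump_sub_le k z₁ c₀ h r x y).trans (max_le ?_ (abs_coord_sub_le k x y))
  simpa using (shadow_lipschitz k).dist_le_mul x y

lemma bump_nonneg (k : Fin (n + 1)) (z₁ : Fin n → ℝ) (c₀ h r : ℝ) (x : Pt (n + 1)) :
    0 ≤ bump k z₁ c₀ h r x := le_max_left _ _

lemma continuous_bump (k : Fin (n + 1)) (z₁ : Fin n → ℝ) (c₀ h r : ℝ) :
    Continuous (bump k z₁ c₀ h r) := by
  have := (shadow_lipschitz (n := n) k).continuous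
  unfold bump
  fun_prop

lemma continuous_push_param (k : Fin (n + 1)) (z₁ : Fin n → ℝ) (c₀ h r : ℝ) (x : Pt (n + 1)) :
    Continuous fun q => push k z₁ c₀ h r q x := by
  unfold push; fun_prop

lemma dist_push_sub_le (k : Fin (n + 1)) (z₁ : Fin n → ℝ) (c₀ h r q : ℝ) (x y : Pt (n + 1)) :
    dist (push k z₁ c₀ h r q x) (push k z₁ c₀ h r q y) ≤ (1 + |q|) * dist x y ∧
    (1 - |q|) * dist x y ≤ dist (push k z₁ c₀ h r q x) (push k z₁ c₀ h r q y) := by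
  have hb := abs_bump_sub_le_dist k z₁ c₀ h r x y
  set u := bump k z₁ c₀ h r x with hu
  set v := bump k z₁ c₀ h r y with hv
  have hd : push k z₁ c₀ h r q x - push k z₁ c₀ h r q y =
      (x - y) - (q * (u - v)) • EuclideanSpace.single k (1 : ℝ) := by
    simp only [push, ← hu, ← hv]; module
  have hs : ‖(q * (u - v)) • EuclideanSpace.single k (1 : ℝ)‖ ≤ |q| * dist x y := by
    rw [norm_smul, PiLp.norm_single, norm_one, mul_one, Real.norm_eq_abs, abs_mul]
    gcongr
  rw [dist_eq_norm (push k z₁ c₀ h r q x), hd]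
  rw [dist_eq_norm] at hs ⊢
  have h1 := norm_sub_le (x - y) ((q * (u - v)) • EuclideanSpace.single k (1 : ℝ))
  have h2 := norm_sub_norm_le (x - y) ((q * (u - v)) • EuclideanSpace.single k (1 : ℝ))
  constructor <;> nlinarith

lemma push_lipschitz (k : Fin (n + 1)) (z₁ : Fin n → ℝ) (c₀ h r : ℝ) {q : ℝ} (hq : |q| ≤ 1 / 2) :
    LipschitzWith 2 (push k z₁ c₀ h r q) := by
  refine LipschitzWith.of_dist_le_mul fun x y => ?_
  refine (dist_push_sub_le k z₁ c₀ h r q x y).1.trans ?_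
  gcongr
  push_cast
  linarith

lemma push_antilipschitz (k : Fin (n + 1)) (z₁ : Fin n → ℝ) (c₀ h r : ℝ) {q : ℝ} {τ : ℝ≥0}
    (hq : |q| ≤ τ) (hτ : τ ≤ 1 / 2) : AntilipschitzWith (1 + 2 * τ) (push k z₁ c₀ h r q) := by
  refine AntilipschitzWith.of_le_mul_dist fun x y => ?_
  have h2 := (dist_push_sub_le k z₁ c₀ h r q x y).2
  have hτ' : (τ : ℝ) ≤ 1 / 2 := by exact_mod_cast hτ
  have hd : 0 ≤ dist x y := dist_nonneg
  have h3 : (1 - (τ : ℝ)) * dist x y ≤ dist (push k z₁ c₀ h r q x) (push k z₁ c₀ h r q y) :=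
    le_trans (by gcongr) h2
  push_cast
  have h4 : dist x y ≤ (1 + 2 * (τ : ℝ)) * ((1 - (τ : ℝ)) * dist x y) := by
    have : 0 ≤ (τ : ℝ) * (1 - 2 * τ) * dist x y :=
      mul_nonneg (mul_nonneg τ.2 (by linarith)) hd
    nlinarith
  exact h4.trans (by gcongr)

/-- The cylinder in which the displacement takes place. -/
def cyl (k : Fin (n + 1)) (z₁ : Fin n → ℝ) (c₀ h r : ℝ) : Set (Pt (n + 1)) :=
  {x | 0 < bump k z₁ c₀ h r x}

lemma mem_cyl {k : Fin (n + 1)} {z₁ : Fin n → ℝ} {c₀ h r : ℝ} {x : Pt (n + 1)} :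
    x ∈ cyl k z₁ c₀ h r ↔ dist (shadow k x) z₁ < r ∧ |x k - c₀| < 2 * h := by
  simp [cyl, bump]

lemma isOpen_cyl (k : Fin (n + 1)) (z₁ : Fin n → ℝ) (c₀ h r : ℝ) : IsOpen (cyl k z₁ c₀ h r) :=
  isOpen_lt continuous_const (continuous_bump k z₁ c₀ h r)

lemma push_of_notMem {k : Fin (n + 1)} {z₁ : Fin n → ℝ} {c₀ h r q : ℝ} {x : Pt (n + 1)}
    (hx : x ∉ cyl k z₁ c₀ h r) : push k z₁ c₀ h r q x = x := by
  have : bump k z₁ c₀ h r x = 0 := le_antisymm (not_lt.1 hx) (bump_nonneg _ _ _ _ _ _)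
  simp [push, this]

lemma push_mem {k : Fin (n + 1)} {z₁ : Fin n → ℝ} {c₀ h r q : ℝ} (hq : |q| < 1)
    {x : Pt (n + 1)} (hx : x ∈ cyl k z₁ c₀ h r) :
    push k z₁ c₀ h r q x ∈ cyl k z₁ c₀ h r := by
  have h1 := abs_bump_sub_le k z₁ c₀ h r (push k z₁ c₀ h r q x) x
  rw [shadow_push, push_same, dist_self, sub_sub_cancel_left, abs_neg,
    max_eq_right (abs_nonneg _), abs_mul, abs_of_nonneg (bump_nonneg _ _ _ _ _ x)] at h1
  have h2 := (abs_le.1 h1).1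
  change 0 < bump k z₁ c₀ h r x at hx
  change 0 < bump k z₁ c₀ h r (push k z₁ c₀ h r q x)
  nlinarith

lemma zeroDens_preimage_of_bilipschitz {Ψ : Pt N → Pt N} {K K' : ℝ≥0} (hK : 0 < K)
    (hl : LipschitzWith K Ψ) (ha : AntilipschitzWith K' Ψ) {E : Set (Pt N)} {x : Pt N}
    (hx : Ψ x ∈ zeroDens E) : x ∈ zeroDens (Ψ ⁻¹' E) := by
  rw [mem_zeroDens_iff] at hx ⊢
  intro ε hε
  have hC : ((K' : ℝ≥0∞) ^ N * (K : ℝ≥0∞) ^ N) ≠ ⊤ := by finiteness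
  obtain ⟨δ, hδ, h⟩ := hx (ε / ((K' : ℝ≥0∞) ^ N * (K : ℝ≥0∞) ^ N)) (ENNReal.div_pos hε.ne' hC)
  refine ⟨δ / K, by positivity, fun r hr => ?_⟩
  have hr0 : 0 < r := hr.1
  have hr1 : r < δ / K := hr.2
  have hKr : (K : ℝ) * r ∈ Ioo 0 δ := by
    refine ⟨by positivity, ?_⟩
    rw [lt_div_iff₀ (by positivity)] at hr1
    linarith
  have h1 := h (K * r) hKr
  have hsub : Ψ ⁻¹' E ∩ ball x r ⊆ Ψ ⁻¹' (E ∩ ball (Ψ x) (K * r)) := by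
    rintro y ⟨hy, hyr⟩
    refine ⟨hy, mem_ball.2 ((hl.dist_le_mul y x).trans_lt ?_)⟩
    have : dist y x < r := hyr
    gcongr
  refine (measure_mono hsub).trans ((volume_preimage_le ha _).trans ?_)
  calc _ ≤ (K' : ℝ≥0∞) ^ N * (ε / ((K' : ℝ≥0∞) ^ N * (K : ℝ≥0∞) ^ N) *
        volume (ball (Ψ x) (K * r))) := by gcongr
    _ = (K' : ℝ≥0∞) ^ N * (ε / ((K' : ℝ≥0∞) ^ N * (K : ℝ≥0∞) ^ N) *
        ((K : ℝ≥0∞) ^ N * volume (ball x r))) := by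
        rw [Measure.addHaar_ball_mul_of_pos _ _ (by positivity) r, Measure.addHaar_ball_center,
          Measure.addHaar_ball_center _ x r]
        congr 3
        rw [finrank_euclideanSpace_fin, ENNReal.ofReal_pow (by positivity), ENNReal.ofReal_coe_nnreal]
    _ = (ε / ((K' : ℝ≥0∞) ^ N * (K : ℝ≥0∞) ^ N) * ((K' : ℝ≥0∞) ^ N * (K : ℝ≥0∞) ^ N)) *
        volume (ball x r) := by ring
    _ ≤ ε * volume (ball x r) := by gcongr; rw [mul_comm]; exact ENNReal.mul_div_le

/-- The labelling in which the cell `i` is enlarged, inside the cell `j`, by its preimage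
under `Ψ`. -/
def pushLab (c : Pt N → L) (Ψ : Pt N → Pt N) (i j : L) (x : Pt N) : L :=
  if c x = j ∧ c (Ψ x) = i then i else c x

lemma pushLab_preimage_left {c : Pt N → L} {Ψ : Pt N → Pt N} {i j : L} :
    pushLab c Ψ i j ⁻¹' {i} = c ⁻¹' {i} ∪ (c ⁻¹' {j} ∩ Ψ ⁻¹' (c ⁻¹' {i})) := by
  ext x
  by_cases hx : c x = j ∧ c (Ψ x) = i
  · simp [pushLab, hx]
  · simp only [mem_preimage, pushLab, if_neg hx, mem_union, mem_inter_iff, mem_singleton_iff]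
    tauto

lemma pushLab_preimage_right {c : Pt N → L} {Ψ : Pt N → Pt N} {i j : L} (hij : i ≠ j) :
    pushLab c Ψ i j ⁻¹' {j} = c ⁻¹' {j} \ Ψ ⁻¹' (c ⁻¹' {i}) := by
  ext x
  by_cases hx : c x = j ∧ c (Ψ x) = i
  · simp [pushLab, hx, hij]
  · simp only [mem_preimage, pushLab, if_neg hx, Set.mem_sdiff, mem_singleton_iff]
    tauto

lemma pushLab_preimage_of_ne {c : Pt N → L} {Ψ : Pt N → Pt N} {i j l : L} (hi : l ≠ i)
    (hj : l ≠ j) : pushLab c Ψ i j ⁻¹' {l} = c ⁻¹' {l} := by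
  ext x
  by_cases hx : c x = j ∧ c (Ψ x) = i
  · simp [pushLab, hx, hi.symm, hj.symm]
  · simp [pushLab, if_neg hx]

lemma MeasLab.pushLab {c : Pt N → L} (hc : MeasLab c) {Ψ : Pt N → Pt N} (hΨ : Measurable Ψ)
    {i j : L} (hij : i ≠ j) : MeasLab (pushLab c Ψ i j) := by
  intro l
  by_cases hi : l = i
  · rw [hi, pushLab_preimage_left]; exact (hc i).union ((hc j).inter ((hc i).preimage hΨ))
  · by_cases hj : l = j
    · rw [hj, pushLab_preimage_right hij]; exact (hc j).diff ((hc i).preimage hΨ)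
    · rw [pushLab_preimage_of_ne hi hj]; exact hc l

section
variable {c : Pt N → L} {Ψ : Pt N → Pt N} {i j : L} {K₁ K : ℝ≥0}

lemma cellBdry_pushLab_of_fixed (hc : MeasLab c) (hK₁ : 0 < K₁) (hl : LipschitzWith K₁ Ψ)
    (ha : AntilipschitzWith K Ψ) (hij : i ≠ j) {x : Pt N} (hx : Ψ x = x) {l : L}
    (h : x ∈ cellBdry (pushLab c Ψ i j) l) : x ∈ cellBdry c l := by
  have hm := hc.pushLab hl.continuous.measurable hij
  rw [mem_cellBdry hm] at h
  rw [mem_cellBdry hc]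
  have hpre : ∀ E : Set (Pt N), x ∈ zeroDens E → x ∈ zeroDens (Ψ ⁻¹' E) := fun E hE =>
    zeroDens_preimage_of_bilipschitz hK₁ hl ha (hx.symm ▸ hE)
  by_cases hi : l = i
  · subst hi
    unfold purePts at h ⊢
    rw [pushLab_preimage_left] at h
    refine ⟨fun h0 => h.1 (zeroDens_union h0 (zeroDens_anti inter_subset_right (hpre _ h0))),
      fun h0 => h.2 (zeroDens_anti (compl_subset_compl.2 subset_union_left) h0)⟩
  · by_cases hj : l = j
    · subst hj
      unfold purePts at h ⊢
      rw [pushLab_preimage_right hij] at h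
      refine ⟨fun h0 => h.1 (zeroDens_anti sdiff_subset h0), fun h0 => h.2 ?_⟩
      refine zeroDens_anti ?_ (zeroDens_union h0 (hpre _ h0))
      intro y hy
      simp only [mem_compl_iff, Set.mem_sdiff, mem_preimage, mem_singleton_iff, not_and,
        not_not] at hy
      by_cases hyl : c y = l
      · right
        have := hy hyl
        simp [this, hij]
      · exact Or.inl hyl
    · unfold purePts at h ⊢
      rwa [pushLab_preimage_of_ne hi hj] at h

lemma cellBdry_pushLab_subset (hc : MeasLab c) (hK₁ : 0 < K₁) (hl : LipschitzWith K₁ Ψ)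
    (ha : AntilipschitzWith K Ψ) (hij : i ≠ j) (l : L) :
    cellBdry (pushLab c Ψ i j) l ⊆ (⋃ l, cellBdry c l) ∪ Ψ ⁻¹' (⋃ l, cellBdry c l) := by
  have hm := hc.pushLab hl.continuous.measurable hij
  intro x hx
  by_contra hno
  simp only [mem_union, mem_iUnion, mem_preimage, not_or, not_exists] at hno
  obtain ⟨p, hp⟩ := exists_pure hc hno.1
  obtain ⟨q, hq⟩ := exists_pure hc hno.2
  have hq' : x ∈ zeroDens (Ψ ⁻¹' (c ⁻¹' {q})ᶜ) := zeroDens_preimage_of_bilipschitz hK₁ hl ha hq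
  refine notMem_cellBdry_of_pure hm (l := if p = j ∧ q = i then i else p) l ?_ hx
  refine zeroDens_anti ?_ (zeroDens_union hp hq')
  intro y hy
  by_contra hy2
  simp only [mem_union, mem_compl_iff, mem_preimage, mem_singleton_iff, not_or, not_not] at hy2
  apply hy
  simp [pushLab, hy2.1, hy2.2]

/-- The points where `i` and `j` are not the only labels involved or the displacement is not
monotone. -/
def pushDefect (c : Pt N → L) (Ψ : Pt N → Pt N) (i j : L) : Set (Pt N) :=
  {y | (c y ≠ i ∧ c y ≠ j) ∨ (c y = i ∧ c (Ψ y) ≠ i)}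

lemma cellBdry_pushLab_good (hc : MeasLab c) (hK₁ : 0 < K₁) (hl : LipschitzWith K₁ Ψ)
    (ha : AntilipschitzWith K Ψ) (hij : i ≠ j) {x : Pt N}
    (hx : x ∈ zeroDens (pushDefect c Ψ i j)) {l : L}
    (h : x ∈ cellBdry (pushLab c Ψ i j) l) : Ψ x ∈ cellBdry c i := by
  have hm := hc.pushLab hl.continuous.measurable hij
  by_contra hno
  rw [mem_cellBdry hc, not_and_or, not_not, not_not] at hno
  rcases hno with h0 | h0
  · have h1 := zeroDens_preimage_of_bilipschitz hK₁ hl ha h0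
    refine notMem_cellBdry_of_pure hm (l := j) l (zeroDens_anti ?_ (zeroDens_union hx h1)) h
    intro y hy
    by_contra hy2
    apply hy
    simp only [pushDefect, mem_union, mem_ofPred_eq, mem_preimage, mem_singleton_iff] at hy2
    have : ¬ (c y = j ∧ c (Ψ y) = i) := by tauto
    change pushLab c Ψ i j y = j
    rw [pushLab, if_neg this]
    tauto
  · have h1 := zeroDens_preimage_of_bilipschitz hK₁ hl ha h0
    refine notMem_cellBdry_of_pure hm (l := i) l (zeroDens_anti ?_ (zeroDens_union hx h1)) h
    intro y hy
    by_contra hy2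
    apply hy
    simp only [pushDefect, mem_union, mem_ofPred_eq, mem_preimage, mem_singleton_iff,
      mem_compl_iff] at hy2
    change pushLab c Ψ i j y = i
    unfold pushLab
    split_ifs <;> tauto

lemma notMem_cellBdry_of_pushDefect (hc : MeasLab c) {x : Pt N}
    (hx : x ∈ zeroDens (pushDefect c Ψ i j)) {l : L} (hi : l ≠ i) (hj : l ≠ j) :
    x ∉ cellBdry c l ∧ x ∉ cellBdry (pushLab c Ψ i j) l := by
  have h0 : x ∈ zeroDens (c ⁻¹' {l}) := by
    refine zeroDens_anti (fun y (hy : c y = l) => ?_) hx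
    left; rw [hy]; exact ⟨hi, hj⟩
  refine ⟨fun h => ((mem_cellBdry hc).1 h).1 h0, fun h => ?_⟩
  rw [cellBdry, pushLab_preimage_of_ne hi hj] at h
  exact ((mem_cellBdry hc).1 h).1 h0

end

lemma sum_eq_pair {i j : L} (hij : i ≠ j) (f : L → ℝ≥0∞) (h : ∀ l, l ≠ i → l ≠ j → f l = 0) :
    ∑ l, f l = f i + f j :=
  Fintype.sum_eq_add i j hij fun l hl => h l hl.1 hl.2

/-- The perimeter of the pushed labelling. -/
lemma totalPer_pushLab_le {ν γ : Measure (Pt (n + 1))} {M : ℝ≥0∞} (hw : Weights ν γ M)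
    {c : Pt (n + 1) → L} {Ψ : Pt (n + 1) → Pt (n + 1)} {i j : L} {K₁ K : ℝ≥0}
    (hc : MeasLab c) (hK₁ : 0 < K₁) (hl : LipschitzWith K₁ Ψ)
    (ha : AntilipschitzWith K Ψ) (hij : i ≠ j) {C G : Set (Pt (n + 1))}
    (hC : MeasurableSet C) (hG : MeasurableSet G) (hfix : ∀ x ∉ C, Ψ x = x)
    (hΨC : ∀ x ∈ C, Ψ x ∈ C) (hΨG : ∀ x, Ψ x ∈ G ↔ x ∈ G)
    (hD : ∀ x ∈ C ∩ G, x ∈ zeroDens (pushDefect c Ψ i j)) {b δ : ℝ≥0∞}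
    (hfar : ∀ A, MeasurableSet A → A ⊆ C →
      b * μH[(n : ℝ)] A ≤ γ A ∧ γ A ≤ (b + δ) * μH[(n : ℝ)] A) :
    totalPer γ (pushLab c Ψ i j) + 2 * b * μH[(n : ℝ)] (cellBdry c i ∩ (C ∩ G)) ≤
      totalPer γ c + 2 * (b + δ) * (K : ℝ≥0∞) ^ n * μH[(n : ℝ)] (cellBdry c i ∩ (C ∩ G)) +
      Fintype.card L * (M * (1 + (K : ℝ≥0∞) ^ n)) *
        μH[(n : ℝ)] ((⋃ l, cellBdry c l) ∩ (C \ G)) := by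
  set c' := pushLab c Ψ i j with hc'
  have hΨm := hl.continuous.measurable
  have hm : MeasLab c' := hc.pushLab hΨm hij
  have hHpre : ∀ A, μH[(n : ℝ)] (Ψ ⁻¹' A) ≤ (K : ℝ≥0∞) ^ n * μH[(n : ℝ)] A := fun A => by
    have := ha.hausdorffMeasure_preimage_le (d := n) (by positivity) A
    rwa [ENNReal.rpow_natCast] at this
  have hout : ∀ l, γ (cellBdry c' l ∩ Cᶜ) ≤ γ (cellBdry c l ∩ Cᶜ) := fun l =>
    measure_mono fun x hx => ⟨cellBdry_pushLab_of_fixed hc hK₁ hl ha hij (hfix x hx.2) hx.1, hx.2⟩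
  have hbad : ∀ l, γ (cellBdry c' l ∩ (C \ G)) ≤
      M * (1 + (K : ℝ≥0∞) ^ n) * μH[(n : ℝ)] ((⋃ l, cellBdry c l) ∩ (C \ G)) := fun l => by
    refine (hw.per_le _).trans ?_
    rw [mul_assoc]
    gcongr
    have hsub : cellBdry c' l ∩ (C \ G) ⊆ ((⋃ l, cellBdry c l) ∩ (C \ G)) ∪
        Ψ ⁻¹' ((⋃ l, cellBdry c l) ∩ (C \ G)) := by
      rintro x ⟨hx, hxC, hxG⟩
      rcases cellBdry_pushLab_subset hc hK₁ hl ha hij l hx with h | h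
      · exact Or.inl ⟨h, hxC, hxG⟩
      · exact Or.inr ⟨h, hΨC x hxC, fun h' => hxG ((hΨG x).1 h')⟩
    refine (measure_mono hsub).trans ((measure_union_le _ _).trans ?_)
    rw [add_mul, one_mul]
    gcongr
    exact hHpre _
  have hgood : ∀ l, γ (cellBdry c' l ∩ (C ∩ G)) ≤
      (b + δ) * (K : ℝ≥0∞) ^ n * μH[(n : ℝ)] (cellBdry c i ∩ (C ∩ G)) := fun l => by
    refine (hfar _ ((hm.measurableSet_cellBdry l).inter (hC.inter hG))
      (inter_subset_right.trans inter_subset_left)).2.trans ?_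
    rw [mul_assoc]
    gcongr
    refine (measure_mono ?_).trans (hHpre _)
    intro x hx
    exact ⟨cellBdry_pushLab_good hc hK₁ hl ha hij (hD x hx.2) hx.1, hΨC x hx.2.1,
      (hΨG x).2 hx.2.2⟩
  have hempty : ∀ l, l ≠ i → l ≠ j → cellBdry c l ∩ (C ∩ G) = ∅ ∧ cellBdry c' l ∩ (C ∩ G) = ∅ :=
    fun l h1 h2 => ⟨eq_empty_of_forall_notMem fun x hx =>
      (notMem_cellBdry_of_pushDefect hc (hD x hx.2) h1 h2).1 hx.1,
      eq_empty_of_forall_notMem fun x hx =>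
      (notMem_cellBdry_of_pushDefect hc (hD x hx.2) h1 h2).2 hx.1⟩
  have hBij : cellBdry c i ∩ (C ∩ G) ⊆ cellBdry c j ∩ (C ∩ G) := by
    intro x hx
    obtain ⟨l, hli, hxl⟩ := exists_ne_cellBdry hc hx.1
    by_cases hlj : l = j
    · exact ⟨hlj ▸ hxl, hx.2⟩
    · exact absurd (show x ∈ cellBdry c l ∩ (C ∩ G) from ⟨hxl, hx.2⟩)
        (by rw [(hempty l hli hlj).1]; exact notMem_empty x)
  have hsplit : ∀ A, γ A = γ (A ∩ Cᶜ) + γ (A ∩ (C ∩ G)) + γ (A ∩ (C \ G)) := fun A => by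
    rw [← measure_inter_add_sdiff A hC, ← measure_inter_add_sdiff (A ∩ C) hG, inter_assoc,
      ← inter_sdiff_assoc, sdiff_eq A C]
    ring
  have hi : b * μH[(n : ℝ)] (cellBdry c i ∩ (C ∩ G)) ≤ γ (cellBdry c i ∩ (C ∩ G)) :=
    (hfar _ ((hc.measurableSet_cellBdry i).inter (hC.inter hG))
      (inter_subset_right.trans inter_subset_left)).1
  set H := μH[(n : ℝ)] (cellBdry c i ∩ (C ∩ G)) with hH
  set H' := μH[(n : ℝ)] ((⋃ l, cellBdry c l) ∩ (C \ G)) with hH'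
  have hlow : ∑ l, γ (cellBdry c l ∩ Cᶜ) + 2 * b * H ≤ totalPer γ c := by
    calc ∑ l, γ (cellBdry c l ∩ Cᶜ) + 2 * b * H
        ≤ ∑ l, γ (cellBdry c l ∩ Cᶜ) + ∑ l, γ (cellBdry c l ∩ (C ∩ G)) := by
          gcongr
          rw [sum_eq_pair hij _ fun l h1 h2 => by rw [(hempty l h1 h2).1, measure_empty]]
          rw [two_mul, add_mul]
          gcongr
          exact hi.trans (measure_mono hBij)
      _ ≤ totalPer γ c := by
          rw [← Finset.sum_add_distrib]
          refine Finset.sum_le_sum fun l _ => ?_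
          rw [hsplit (cellBdry c l)]
          exact le_self_add
  calc totalPer γ c' + 2 * b * H
      = ∑ l, γ (cellBdry c' l ∩ Cᶜ) + ∑ l, γ (cellBdry c' l ∩ (C ∩ G)) +
        ∑ l, γ (cellBdry c' l ∩ (C \ G)) + 2 * b * H := by
        rw [← Finset.sum_add_distrib, ← Finset.sum_add_distrib, totalPer]
        congr 1
        exact Finset.sum_congr rfl fun l _ => hsplit _
    _ ≤ ∑ l, γ (cellBdry c l ∩ Cᶜ) + ((b + δ) * (K : ℝ≥0∞) ^ n * H + (b + δ) * (K : ℝ≥0∞) ^ n * H) +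
        Fintype.card L * (M * (1 + (K : ℝ≥0∞) ^ n) * H') + 2 * b * H := by
        refine add_le_add (add_le_add (add_le_add (Finset.sum_le_sum fun l _ => hout l) ?_) ?_)
          le_rfl
        · rw [sum_eq_pair hij _ fun l h1 h2 => by rw [(hempty l h1 h2).2, measure_empty]]
          exact add_le_add (hgood i) (hgood j)
        · refine (Finset.sum_le_sum fun l _ => hbad l).trans ?_
          simp
    _ = (∑ l, γ (cellBdry c l ∩ Cᶜ) + 2 * b * H) + 2 * (b + δ) * (K : ℝ≥0∞) ^ n * H +
        Fintype.card L * (M * (1 + (K : ℝ≥0∞) ^ n)) * H' := by ring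
    _ ≤ _ := by gcongr

lemma ae_preimage_of_antilipschitz {K : ℝ≥0} {Ψ : Pt N → Pt N} (hΨ : AntilipschitzWith K Ψ)
    {p : Pt N → Prop} (h : ∀ᵐ x, p x) : ∀ᵐ x, p (Ψ x) := by
  rw [ae_iff] at h ⊢
  refine le_antisymm ((volume_preimage_le hΨ {x | ¬ p x}).trans ?_) bot_le
  rw [h, mul_zero]

lemma volume_lineCyl (k : Fin (n + 1)) (I : Set ℝ) (A : Set (Fin n → ℝ)) :
    volume {y | y k ∈ I ∧ shadow k y ∈ A} = volume I * volume A := by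
  rw [← (measurePreserving_lineEquiv k).measure_preimage_equiv, ← Measure.prod_prod]
  congr 1
  ext p
  simp [lineEquiv_apply]

/-- Over a density point of `T` the cylinder over the complement of `T` has density zero. -/
lemma zeroDens_shadow_preimage (k : Fin (n + 1)) {A : Set (Fin n → ℝ)} {x : Pt (n + 1)}
    (h : Tendsto (fun r => volume (A ∩ closedBall (shadow k x) r) /
      volume (closedBall (shadow k x) r)) (𝓝[>] 0) (𝓝 0)) :
    x ∈ zeroDens (shadow k ⁻¹' A) := by
  rw [mem_zeroDens_iff]
  intro ε hε
  set V := volume (ball (0 : Pt (n + 1)) 1) with hV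
  have hV0 : V ≠ 0 := volume_ball_ne_zero _ one_pos
  have hVt : V ≠ ⊤ := volume_ball_ne_top _ _
  have hε' : 0 < ε * V / 2 ^ (n + 1) :=
    ENNReal.div_pos (mul_ne_zero hε.ne' hV0) (by finiteness)
  have h1 := (ENNReal.tendsto_nhds_zero.1 h) _ hε'
  rw [Filter.eventually_iff, mem_nhdsGT_iff_exists_Ioo_subset] at h1
  obtain ⟨δ, hδ, hsub⟩ := h1
  refine ⟨δ, hδ, fun r hr => ?_⟩
  have hr0 : 0 < r := hr.1
  have h2 : volume (A ∩ closedBall (shadow k x) r) / volume (closedBall (shadow k x) r) ≤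
    ε * V / 2 ^ (n + 1) := hsub hr
  have hvol : volume (closedBall (shadow k x) r) = ENNReal.ofReal (2 * r) ^ n := by
    rw [Real.volume_pi_closedBall _ hr0.le, Fintype.card_fin, ENNReal.ofReal_pow (by positivity)]
  have hpos : ENNReal.ofReal (2 * r) ≠ 0 := by simpa using hr0
  rw [hvol, ENNReal.div_le_iff (pow_ne_zero _ hpos) (by finiteness)] at h2
  have hball : volume (ball x r) = ENNReal.ofReal r ^ (n + 1) * V := by
    rw [Measure.addHaar_ball _ _ hr0.le, finrank_euclideanSpace_fin,
      ENNReal.ofReal_pow hr0.le]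
  have hincl : shadow k ⁻¹' A ∩ ball x r ⊆
      {y | y k ∈ Ioo (x k - r) (x k + r) ∧ shadow k y ∈ A ∩ closedBall (shadow k x) r} := by
    rintro y ⟨hyA, hyr⟩
    have hd : dist y x < r := hyr
    have h3 := (abs_coord_sub_le k y x).trans_lt hd
    have h4 := (shadow_lipschitz k).dist_le_mul y x
    rw [abs_lt] at h3
    refine ⟨⟨by linarith, by linarith⟩, hyA, mem_closedBall.2 ?_⟩
    simpa using h4.trans (by simpa using hd.le)
  refine (measure_mono hincl).trans ?_
  rw [volume_lineCyl, Real.volume_Ioo, show x k + r - (x k - r) = 2 * r by ring, hball]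
  calc ENNReal.ofReal (2 * r) * volume (A ∩ closedBall (shadow k x) r)
      ≤ ENNReal.ofReal (2 * r) * (ε * V / 2 ^ (n + 1) * ENNReal.ofReal (2 * r) ^ n) := by gcongr
    _ = ε * V / 2 ^ (n + 1) * ENNReal.ofReal (2 * r) ^ (n + 1) := by ring
    _ = ε * V / 2 ^ (n + 1) * (2 ^ (n + 1) * ENNReal.ofReal r ^ (n + 1)) := by
        rw [ENNReal.ofReal_mul (by norm_num), mul_pow]; norm_num
    _ = (ε * V / 2 ^ (n + 1) * 2 ^ (n + 1)) * ENNReal.ofReal r ^ (n + 1) := by ring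
    _ = ε * V * ENNReal.ofReal r ^ (n + 1) := by
        rw [ENNReal.div_mul_cancel (by positivity) (by finiteness)]
    _ = ε * (ENNReal.ofReal r ^ (n + 1) * V) := by ring

lemma lowerSemicontinuous_measure_push (k : Fin (n + 1)) (z₁ : Fin n → ℝ) (c₀ h r σ : ℝ)
    (hσ : σ = 1 ∨ σ = -1) {m : Measure (Pt (n + 1))} {M : ℝ≥0∞} (hM : M ≠ ⊤)
    (hm : ∀ A, m A ≤ M * volume A) {F : Set (Pt (n + 1))} (hF : MeasurableSet F)
    (hFt : volume F ≠ ⊤) {τ₀ : ℝ} {t : ℝ≥0∞}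
    (ht : t < m (push k z₁ c₀ h r (σ * τ₀) ⁻¹' F)) :
    ∀ᶠ τ in 𝓝[Icc 0 (1 / 2)] τ₀, t < m (push k z₁ c₀ h r (σ * τ) ⁻¹' F) := by
  obtain ⟨e, he, hte⟩ := ENNReal.lt_iff_exists_add_pos_lt.1 ht
  have hM0 : M * 2 ^ (n + 1) ≠ ⊤ := by finiteness
  have he' : (e : ℝ≥0∞) / (M * 2 ^ (n + 1)) ≠ 0 :=
    (ENNReal.div_pos (by simpa using he.ne') hM0).ne'
  obtain ⟨U, hFU, hU, -, hUF⟩ := hF.exists_isOpen_sdiff_lt hFt he'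
  have hanti : ∀ τ ∈ Icc (0 : ℝ) (1 / 2), m (push k z₁ c₀ h r (σ * τ) ⁻¹' (U \ F)) ≤ e := by
    intro τ hτ
    have hq : |σ * τ| ≤ ((1 / 2 : ℝ≥0) : ℝ) := by
      rw [abs_mul, abs_of_nonneg hτ.1]
      have := hτ.2
      rcases hσ with rfl | rfl <;> norm_num <;> linarith
    have ha := push_antilipschitz k z₁ c₀ h r hq le_rfl
    have h2 : ((1 + 2 * (1 / 2) : ℝ≥0) : ℝ≥0∞) = 2 := by
      rw [show (1 + 2 * (1 / 2) : ℝ≥0) = 2 by norm_num]; rfl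
    calc _ ≤ M * volume (push k z₁ c₀ h r (σ * τ) ⁻¹' (U \ F)) := hm _
      _ ≤ M * (2 ^ (n + 1) * volume (U \ F)) := by
          gcongr
          have := volume_preimage_le ha (U \ F)
          rwa [h2] at this
      _ ≤ M * (2 ^ (n + 1) * (e / (M * 2 ^ (n + 1)))) := by gcongr
      _ = M * 2 ^ (n + 1) * (e / (M * 2 ^ (n + 1))) := by ring
      _ ≤ e := ENNReal.mul_div_le
  set A : ℕ → Set (Pt (n + 1)) := fun q =>
    {x | ∀ τ, |τ - τ₀| < 1 / ((q : ℝ) + 1) → push k z₁ c₀ h r (σ * τ) x ∈ U} with hA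
  have hAmono : Monotone A := by
    intro q q' hqq x hx τ hτ
    refine hx τ (hτ.trans_le ?_)
    have : (q : ℝ) ≤ q' := by exact_mod_cast hqq
    gcongr
  have hAU : push k z₁ c₀ h r (σ * τ₀) ⁻¹' U ⊆ ⋃ q, A q := by
    intro x hx
    have hcont : Continuous fun τ => push k z₁ c₀ h r (σ * τ) x :=
      (continuous_push_param k z₁ c₀ h r x).comp (continuous_const.mul continuous_id)
    obtain ⟨δ, hδ, hball⟩ := Metric.isOpen_iff.1 (hU.preimage hcont) τ₀ hx
    obtain ⟨q, hq⟩ := exists_nat_one_div_lt hδ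
    refine mem_iUnion.2 ⟨q, fun τ hτ => hball ?_⟩
    rw [mem_ball, Real.dist_eq]
    exact hτ.trans hq
  have hlt : t + e < m (⋃ q, A q) :=
    hte.trans_le (measure_mono ((preimage_mono hFU).trans hAU))
  rw [hAmono.measure_iUnion, lt_iSup_iff] at hlt
  obtain ⟨q, hq⟩ := hlt
  have hq0 : (0 : ℝ) < 1 / ((q : ℝ) + 1) := by positivity
  filter_upwards [self_mem_nhdsWithin, mem_nhdsWithin_of_mem_nhds (ball_mem_nhds τ₀ hq0)]
    with τ hτ hτb
  rw [mem_ball, Real.dist_eq] at hτb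
  have h1 : t + e < m (push k z₁ c₀ h r (σ * τ) ⁻¹' F) + e := by
    refine hq.trans_le ((measure_mono fun x hx => ?_).trans
      ((measure_union_le _ _).trans (add_le_add le_rfl (hanti τ hτ))))
    rw [← preimage_union, union_sdiff_cancel hFU]
    exact hx τ hτb
  exact lt_of_add_lt_add_right h1

lemma continuousOn_measure_push (k : Fin (n + 1)) (z₁ : Fin n → ℝ) (c₀ h r σ : ℝ)
    (hσ : σ = 1 ∨ σ = -1) {m : Measure (Pt (n + 1))} [IsFiniteMeasure m] {M : ℝ≥0∞} (hM : M ≠ ⊤)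
    (hm : ∀ A, m A ≤ M * volume A) {C F : Set (Pt (n + 1))} (hC : MeasurableSet C)
    (hCt : volume C ≠ ⊤) (hmC : m Cᶜ = 0) (hF : MeasurableSet F) (hFC : F ⊆ C)
    (hpC : ∀ q : ℝ, |q| < 1 → ∀ x ∈ C, push k z₁ c₀ h r q x ∈ C) :
    ContinuousOn (fun τ => m (push k z₁ c₀ h r (σ * τ) ⁻¹' F)) (Icc 0 (1 / 2)) := by
  intro τ₀ hτ₀
  have hFt : volume F ≠ ⊤ := measure_ne_top_of_subset hFC hCt
  have hCFt : volume (C \ F) ≠ ⊤ := measure_ne_top_of_subset sdiff_subset hCt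
  have hq : ∀ τ ∈ Icc (0 : ℝ) (1 / 2), |σ * τ| ≤ 1 / 2 := fun τ hτ => by
    rw [abs_mul, abs_of_nonneg hτ.1]
    have := hτ.2
    rcases hσ with rfl | rfl <;> norm_num <;> linarith
  have hsum : ∀ τ ∈ Icc (0 : ℝ) (1 / 2), m (push k z₁ c₀ h r (σ * τ) ⁻¹' F) +
      m (push k z₁ c₀ h r (σ * τ) ⁻¹' (C \ F)) = m univ := fun τ hτ => by
    have hcont := (push_lipschitz k z₁ c₀ h r (hq τ hτ)).continuous.measurable
    rw [← measure_union ((disjoint_sdiff_right).preimage _) ((hC.diff hF).preimage hcont),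
      ← preimage_union, union_sdiff_cancel hFC]
    refine le_antisymm (measure_mono (subset_univ _)) ?_
    rw [← measure_add_measure_compl hC, hmC, add_zero]
    exact measure_mono fun x hx => hpC _ ((hq τ hτ).trans_lt (by norm_num)) x hx
  refine tendsto_order.2 ⟨fun t ht =>
    lowerSemicontinuous_measure_push k z₁ c₀ h r σ hσ hM hm hF hFt ht, fun t ht => ?_⟩
  by_cases htt : m univ < t
  · exact Eventually.of_forall fun τ => (measure_mono (subset_univ _)).trans_lt htt
  push Not at htt
  have h1 : m univ - t < m (push k z₁ c₀ h r (σ * τ₀) ⁻¹' (C \ F)) := by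
    refine ENNReal.sub_lt_of_lt_add htt ?_
    rw [← hsum τ₀ hτ₀, add_comm]
    exact ENNReal.add_lt_add_left (measure_ne_top _ _) ht
  filter_upwards [self_mem_nhdsWithin,
    lowerSemicontinuous_measure_push k z₁ c₀ h r σ hσ hM hm (hC.diff hF) hCFt h1] with τ hτ h2
  have h3 : m univ < m (push k z₁ c₀ h r (σ * τ) ⁻¹' (C \ F)) + t :=
    (ENNReal.sub_lt_iff_lt_right (ne_top_of_le_ne_top (measure_ne_top m univ) htt) htt).1 h2
  rw [← hsum τ hτ, add_comm] at h3
  exact lt_of_add_lt_add_left h3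

/-- Over the base `T` the labelling is `i` on one side of the graph of `p` and `j` on the other
side, up to height `3 * h` around `c₀`. -/
structure Column (c : Pt (n + 1) → L) (k : Fin (n + 1)) (σ c₀ h : ℝ) (i j : L)
    (p : (Fin n → ℝ) → ℝ) (T : Set (Fin n → ℝ)) : Prop where
  ne : i ≠ j
  sign : σ = 1 ∨ σ = -1
  pos : 0 < h
  measT : MeasurableSet T
  measp : Measurable p
  close : ∀ z ∈ T, |p z - c₀| ≤ h
  lab : ∀ᵐ x, shadow k x ∈ T → |x k - c₀| < 3 * h →
    (σ * (x k - p (shadow k x)) < 0 ∧ c x = i) ∨ (0 < σ * (x k - p (shadow k x)) ∧ c x = j)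

lemma abs_sign_mul {σ : ℝ} (hσ : σ = 1 ∨ σ = -1) (x : ℝ) : |σ * x| = |x| := by
  rcases hσ with rfl | rfl <;> simp

section
variable {c : Pt (n + 1) → L} {k : Fin (n + 1)} {σ c₀ h : ℝ} {i j : L}
  {p : (Fin n → ℝ) → ℝ} {T : Set (Fin n → ℝ)}

lemma sign_mul_push {σ : ℝ} (hσ : σ = 1 ∨ σ = -1) (k : Fin (n + 1)) (z₁ : Fin n → ℝ)
    (c₀ h r τ : ℝ) (p : (Fin n → ℝ) → ℝ) (x : Pt (n + 1)) :
    σ * (push k z₁ c₀ h r (σ * τ) x k - p (shadow k (push k z₁ c₀ h r (σ * τ) x))) =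
      σ * (x k - p (shadow k x)) - τ * bump k z₁ c₀ h r x := by
  rw [push_same, shadow_push]
  rcases hσ with rfl | rfl <;> ring

lemma Column.ae_push (hcol : Column c k σ c₀ h i j p T) (z₁ : Fin n → ℝ) (r : ℝ) {τ : ℝ}
    (h0 : 0 ≤ τ) (h1 : τ ≤ 1 / 2) : ∀ᵐ x, x ∈ cyl k z₁ c₀ h r → shadow k x ∈ T →
      x ∉ pushDefect c (push k z₁ c₀ h r (σ * τ)) i j := by
  have hq : |σ * τ| ≤ ((1 / 2 : ℝ≥0) : ℝ) := by
    rw [abs_sign_mul hcol.sign, abs_of_nonneg h0]; simpa using h1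
  have ha := push_antilipschitz k z₁ c₀ h r hq le_rfl
  have hpos := hcol.pos
  filter_upwards [hcol.lab, ae_preimage_of_antilipschitz ha hcol.lab] with x hx hx2 hxc hxT
  have hq1 : |σ * τ| < 1 := hq.trans_lt (by norm_num)
  have hc1 := (mem_cyl.1 hxc).2
  have hc2 := (mem_cyl.1 (push_mem hq1 hxc)).2
  have l1 := hx hxT (by linarith)
  have l2 := hx2 (by rwa [shadow_push]) (by linarith)
  rw [sign_mul_push hcol.sign] at l2
  have hu : 0 ≤ τ * bump k z₁ c₀ h r x := mul_nonneg h0 (bump_nonneg _ _ _ _ _ _)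
  rintro (⟨hi, hj⟩ | ⟨hi, hi2⟩)
  · rcases l1 with l1 | l1
    · exact hi l1.2
    · exact hj l1.2
  · rcases l1 with l1 | l1
    · rcases l2 with l2 | l2
      · exact hi2 l2.2
      · linarith [l1.1, l2.1]
    · exact hcol.ne (hi.symm.trans l1.2)

lemma Column.zeroDens_pushDefect (hcol : Column c k σ c₀ h i j p T) {z₁ : Fin n → ℝ} {r : ℝ}
    {τ : ℝ} (h0 : 0 ≤ τ) (h1 : τ ≤ 1 / 2) {x : Pt (n + 1)} (hx : x ∈ cyl k z₁ c₀ h r)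
    (hT : Tendsto (fun r => volume (Tᶜ ∩ closedBall (shadow k x) r) /
      volume (closedBall (shadow k x) r)) (𝓝[>] 0) (𝓝 0)) :
    x ∈ zeroDens (pushDefect c (push k z₁ c₀ h r (σ * τ)) i j) := by
  refine zeroDens_local (isOpen_cyl k z₁ c₀ h r) hx (F := shadow k ⁻¹' Tᶜ) ?_
    (zeroDens_shadow_preimage k hT)
  filter_upwards [hcol.ae_push z₁ r h0 h1] with y hy hyd hyc hyT
  exact hy hyc hyT hyd

lemma Column.gain (hcol : Column c k σ c₀ h i j p T) (z₁ : Fin n → ℝ) {r τ : ℝ} (hr : 0 < r)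
    (hrh : r ≤ h) (h0 : 0 ≤ τ) (h1 : τ ≤ 1 / 2) :
    ENNReal.ofReal (τ * r / 4) * volume (T ∩ closedBall z₁ (r / 2)) ≤
      volume (c ⁻¹' {j} ∩ push k z₁ c₀ h r (σ * τ) ⁻¹' (c ⁻¹' {i})) := by
  set A : Set (Pt (n + 1)) := {x | shadow k x ∈ T ∩ closedBall z₁ (r / 2) ∧
    0 < σ * (x k - p (shadow k x)) ∧ σ * (x k - p (shadow k x)) < τ * r / 4} with hA
  have hcoord : Measurable fun x : Pt (n + 1) => σ * (x k - p (shadow k x)) := by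
    have h1 : Measurable fun x : Pt (n + 1) => x k := by fun_prop
    exact (h1.sub (hcol.measp.comp (measurable_shadow k))).const_mul σ
  have hAm : MeasurableSet A :=
    ((hcol.measT.inter measurableSet_closedBall).preimage (measurable_shadow k)).inter
      ((measurableSet_lt measurable_const hcoord).inter (measurableSet_lt hcoord measurable_const))
  have hTm := hcol.measT.inter (measurableSet_closedBall (x := z₁) (ε := r / 2))
  have hvol : ENNReal.ofReal (τ * r / 4) * volume (T ∩ closedBall z₁ (r / 2)) = volume A := by
    rw [volume_eq_line k hAm, ← setLIntegral_const, ← lintegral_indicator hTm]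
    refine lintegral_congr fun z => ?_
    by_cases hz : z ∈ T ∩ closedBall z₁ (r / 2)
    · rw [indicator_of_mem hz]
      rcases hcol.sign with rfl | rfl
      · have : {s | lineAt k s z ∈ A} = Ioo (p z) (p z + τ * r / 4) := by
          ext s
          simp only [hA, mem_ofPred_eq, shadow_lineAt, hz, lineAt_same, true_and, mem_Ioo]
          constructor <;> rintro ⟨h1, h2⟩ <;> constructor <;> linarith
        rw [this, Real.volume_Ioo, add_sub_cancel_left]
      · have : {s | lineAt k s z ∈ A} = Ioo (p z - τ * r / 4) (p z) := by
          ext s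
          simp only [hA, mem_ofPred_eq, shadow_lineAt, hz, lineAt_same, true_and, mem_Ioo]
          constructor <;> rintro ⟨h1, h2⟩ <;> constructor <;> linarith
        rw [this, Real.volume_Ioo, sub_sub_cancel]
    · rw [indicator_of_notMem hz]
      have : {s | lineAt k s z ∈ A} = ∅ := by
        ext s
        simp only [hA, mem_ofPred_eq, shadow_lineAt, hz, false_and, mem_empty_iff_false]
      rw [this, measure_empty]
  rw [hvol]
  have hq : |σ * τ| ≤ ((1 / 2 : ℝ≥0) : ℝ) := by
    rw [abs_sign_mul hcol.sign, abs_of_nonneg h0]; simpa using h1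
  have hq1 : |σ * τ| < 1 := hq.trans_lt (by norm_num)
  have ha := push_antilipschitz k z₁ c₀ h r hq le_rfl
  refine measure_mono_ae ?_
  filter_upwards [hcol.lab, ae_preimage_of_antilipschitz ha hcol.lab] with x hx hx2 hxA
  obtain ⟨⟨hT, hz⟩, hs0, hs1⟩ := hxA
  have hp := hcol.close _ hT
  have hd : dist (shadow k x) z₁ ≤ r / 2 := hz
  have hτr : τ * r / 4 ≤ r / 8 := by nlinarith
  have hxp : |x k - p (shadow k x)| < r / 8 := by
    rw [← abs_sign_mul hcol.sign, abs_of_pos hs0]; linarith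
  have hxc : |x k - c₀| < h + r / 8 := by
    have := abs_sub_le (x k) (p (shadow k x)) c₀
    linarith
  have hb : r / 4 ≤ bump k z₁ c₀ h r x := by
    unfold bump
    refine le_max_of_le_right (le_min ?_ ?_) <;> linarith
  have hcy : x ∈ cyl k z₁ c₀ h r := mem_cyl.2 ⟨by linarith, by linarith⟩
  have hc2 := (mem_cyl.1 (push_mem hq1 hcy)).2
  have l1 := hx hT (by linarith)
  have l2 := hx2 (by rwa [shadow_push]) (by linarith)
  rw [sign_mul_push hcol.sign] at l2
  have hm : τ * (r / 4) ≤ τ * bump k z₁ c₀ h r x := by gcongr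
  refine ⟨?_, ?_⟩
  · rcases l1 with l1 | l1
    · linarith [l1.1]
    · exact l1.2
  · rcases l2 with l2 | l2
    · exact l2.2
    · linarith [l2.1]

lemma volume_cyl_ne_top (k : Fin (n + 1)) (z₁ : Fin n → ℝ) (c₀ h r : ℝ) :
    volume (cyl k z₁ c₀ h r) ≠ ⊤ := by
  have : cyl k z₁ c₀ h r ⊆
      {y | y k ∈ Icc (c₀ - 2 * h) (c₀ + 2 * h) ∧ shadow k y ∈ closedBall z₁ r} := by
    intro x hx
    obtain ⟨h1, h2⟩ := mem_cyl.1 hx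
    rw [abs_lt] at h2
    exact ⟨⟨by linarith, by linarith⟩, h1.le⟩
  refine ne_top_of_le_ne_top ?_ (measure_mono this)
  rw [volume_lineCyl]
  exact ENNReal.mul_ne_top (by simp) measure_closedBall_lt_top.ne

/-- Pushing the interface over the column transfers an exactly prescribed amount of volume. -/
lemma Column.exists_push (hcol : Column c k σ c₀ h i j p T) {ν γ : Measure (Pt (n + 1))}
    {M : ℝ≥0∞} (hw : Weights ν γ M) {z₁ : Fin n → ℝ} {r : ℝ} {τ : ℝ≥0} (hr : 0 < r) (hrh : r ≤ h)
    (h1 : τ ≤ 1 / 2) {G : Set (Fin n → ℝ)} (hG : MeasurableSet G)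
    (hGT : ∀ z ∈ G, Tendsto (fun r => volume (Tᶜ ∩ closedBall z r) /
      volume (closedBall z r)) (𝓝[>] 0) (𝓝 0)) {b δ : ℝ≥0∞}
    (hfar : ∀ A, MeasurableSet A → A ⊆ cyl k z₁ c₀ h r →
      b * μH[(n : ℝ)] A ≤ γ A ∧ γ A ≤ (b + δ) * μH[(n : ℝ)] A)
    {ε : ℝ≥0∞} (hε : M * ε ≤ ENNReal.ofReal (τ * r / 4) * volume (T ∩ closedBall z₁ (r / 2)))
    {c' : Pt (n + 1) → L} (hc : MeasLab c) (hc' : MeasLab c')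
    (heq : ∀ x ∈ cyl k z₁ c₀ h r, c' x = c x) :
    ∃ c'' : Pt (n + 1) → L, MeasLab c'' ∧ (∀ x ∉ cyl k z₁ c₀ h r, c'' x = c' x) ∧
      ν (c'' ⁻¹' {j}) + ε = ν (c' ⁻¹' {j}) ∧ ν (c'' ⁻¹' {i}) = ν (c' ⁻¹' {i}) + ε ∧
      (∀ l, l ≠ j → l ≠ i → ν (c'' ⁻¹' {l}) = ν (c' ⁻¹' {l})) ∧
      totalPer γ c'' + 2 * b * μH[(n : ℝ)] (cellBdry c i ∩ (cyl k z₁ c₀ h r ∩ shadow k ⁻¹' G)) ≤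
        totalPer γ c' + 2 * (b + δ) * (1 + 2 * τ) ^ n *
          μH[(n : ℝ)] (cellBdry c i ∩ (cyl k z₁ c₀ h r ∩ shadow k ⁻¹' G)) +
        Fintype.card L * (M * (1 + (1 + 2 * τ) ^ n)) *
          μH[(n : ℝ)] ((⋃ l, cellBdry c l) ∩ (cyl k z₁ c₀ h r \ shadow k ⁻¹' G)) := by
  set C := cyl k z₁ c₀ h r with hCdef
  have hCo : IsOpen C := isOpen_cyl k z₁ c₀ h r
  have hCm := hCo.measurableSet
  have h1' : (τ : ℝ) ≤ 1 / 2 := by exact_mod_cast h1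
  have hq : ∀ τ' ∈ Icc (0 : ℝ) τ, |σ * τ'| ≤ τ := fun τ' hτ => by
    rw [abs_sign_mul hcol.sign, abs_of_nonneg hτ.1]; exact hτ.2
  have hq1 : ∀ τ' ∈ Icc (0 : ℝ) τ, |σ * τ'| < 1 := fun τ' hτ =>
    (hq τ' hτ).trans_lt (by linarith)
  set m := ν.restrict (c ⁻¹' {j} ∩ C) with hm
  have hjm := (hc j).inter hCm
  have hmvol : ∀ A, m A ≤ M * volume A := fun A =>
    (Measure.restrict_apply_le _ _).trans (hw.vol_le A)
  have : IsFiniteMeasure m := ⟨by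
    rw [hm, Measure.restrict_apply_univ]
    refine (hw.vol_le _).trans_lt (ENNReal.mul_lt_top hw.ne_top.lt_top ?_)
    exact (measure_mono inter_subset_right).trans_lt (volume_cyl_ne_top k z₁ c₀ h r).lt_top⟩
  have hcont : ContinuousOn (fun τ' => m (push k z₁ c₀ h r (σ * τ') ⁻¹' (c ⁻¹' {i} ∩ C)))
      (Icc 0 τ) := by
    refine (continuousOn_measure_push k z₁ c₀ h r σ hcol.sign hw.ne_top hmvol hCm
      (volume_cyl_ne_top k z₁ c₀ h r) ?_ ((hc i).inter hCm) inter_subset_right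
      fun q hq x hx => push_mem hq hx).mono (Icc_subset_Icc_right h1')
    rw [hm, Measure.restrict_apply hCm.compl]
    rw [show Cᶜ ∩ (c ⁻¹' {j} ∩ C) = ∅ by ext; simp; tauto, measure_empty]
  have hval : ∀ τ' ∈ Icc (0 : ℝ) τ, m (push k z₁ c₀ h r (σ * τ') ⁻¹' (c ⁻¹' {i} ∩ C)) =
      ν (c' ⁻¹' {j} ∩ push k z₁ c₀ h r (σ * τ') ⁻¹' (c' ⁻¹' {i})) ∧
      ν (c' ⁻¹' {j} ∩ push k z₁ c₀ h r (σ * τ') ⁻¹' (c' ⁻¹' {i})) =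
      ν (c ⁻¹' {j} ∩ push k z₁ c₀ h r (σ * τ') ⁻¹' (c ⁻¹' {i})) := fun τ' hτ => by
    rw [hm, Measure.restrict_apply' hjm]
    constructor
    · congr 1
      ext x
      by_cases hx : x ∈ C
      · have hx' := push_mem (hq1 τ' hτ) hx
        simp only [mem_inter_iff, mem_preimage, mem_singleton_iff, heq x hx, heq _ hx', hx,
          and_true]
        constructor
        · exact fun h => ⟨h.2, h.1.1⟩
        · exact fun h => ⟨⟨h.2, hx'⟩, h.1⟩
      · simp only [mem_inter_iff, mem_preimage, mem_singleton_iff, hx, and_false, false_iff,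
          push_of_notMem hx]
        rintro ⟨e1, e2⟩
        exact hcol.ne (e2.symm.trans e1)
    · congr 1
      ext x
      by_cases hx : x ∈ C
      · have hx' := push_mem (hq1 τ' hτ) hx
        simp only [mem_inter_iff, mem_preimage, mem_singleton_iff, heq x hx, heq _ hx']
      · simp only [mem_inter_iff, mem_preimage, mem_singleton_iff, push_of_notMem hx]
        constructor <;> rintro ⟨e1, e2⟩ <;> exact absurd (e2.symm.trans e1) hcol.ne
  have hzero : m (push k z₁ c₀ h r (σ * 0) ⁻¹' (c ⁻¹' {i} ∩ C)) = 0 := by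
    rw [(hval 0 ⟨le_rfl, τ.2⟩).1]
    rw [show c' ⁻¹' {j} ∩ push k z₁ c₀ h r (σ * 0) ⁻¹' (c' ⁻¹' {i}) = ∅ from ?_, measure_empty]
    ext x
    simp only [push, mul_zero, zero_mul, zero_smul, sub_zero, mem_inter_iff, mem_preimage,
      mem_singleton_iff, mem_empty_iff_false, iff_false]
    rintro ⟨e1, e2⟩
    exact hcol.ne (e2.symm.trans e1)
  have hM0 : M ≠ 0 := (one_pos.trans_le hw.one_le).ne'
  have hbig : ε ≤ m (push k z₁ c₀ h r (σ * τ) ⁻¹' (c ⁻¹' {i} ∩ C)) := by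
    rw [(hval τ ⟨τ.2, le_rfl⟩).1, (hval τ ⟨τ.2, le_rfl⟩).2]
    have := hε.trans ((hcol.gain z₁ hr hrh τ.2 h1').trans (hw.le_vol _))
    exact (ENNReal.mul_le_mul_iff_right hM0 hw.ne_top).1 this
  obtain ⟨τ', hτ', hτε⟩ := intermediate_value_Icc τ.2 hcont
    (show ε ∈ Icc _ _ from ⟨by simp only [hzero]; exact bot_le, hbig⟩)
  simp only at hτε
  rw [(hval τ' hτ').1] at hτε
  have hlip := push_lipschitz k z₁ c₀ h r ((hq τ' hτ').trans h1')
  have hanti := push_antilipschitz k z₁ c₀ h r (hq τ' hτ') h1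
  set Ψ := push k z₁ c₀ h r (σ * τ') with hΨ
  have hΨm := hlip.continuous.measurable
  have hcell : ∀ l, cellBdry c' l ∩ C = cellBdry c l ∩ C := fun l =>
    essBdry_local (hc' l) (hc l) hCo (Eventually.of_forall fun y hy => by simp [heq y hy])
  have hmain := totalPer_pushLab_le hw hc' two_pos hlip hanti hcol.ne hCm
    (hG.preimage (measurable_shadow k)) (fun x hx => push_of_notMem hx)
    (fun x hx => push_mem (hq1 τ' hτ') hx)
    (fun x => by simp only [mem_preimage, hΨ, shadow_push]) ?_ hfar
  · refine ⟨pushLab c' Ψ i j, hc'.pushLab hΨm hcol.ne, fun x hx => ?_, ?_, ?_, ?_, ?_⟩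
    · unfold pushLab
      rw [if_neg]
      rw [hΨ, push_of_notMem hx]
      exact fun e => hcol.ne (e.2.symm.trans e.1)
    · rw [pushLab_preimage_right hcol.ne, add_comm, ← hτε]
      exact measure_inter_add_sdiff _ ((hc' i).preimage hΨm)
    · rw [pushLab_preimage_left, measure_union _ ((hc' j).inter ((hc' i).preimage hΨm)), hτε]
      refine disjoint_left.2 fun x (hx : c' x = i) hx2 => hcol.ne (hx.symm.trans hx2.1)
    · intro l hlj hli
      rw [pushLab_preimage_of_ne hli hlj]
    · have e1 : cellBdry c' i ∩ (C ∩ shadow k ⁻¹' G) = cellBdry c i ∩ (C ∩ shadow k ⁻¹' G) := by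
        rw [← inter_assoc, hcell, inter_assoc]
      have e2 : (⋃ l, cellBdry c' l) ∩ (C \ shadow k ⁻¹' G) =
          (⋃ l, cellBdry c l) ∩ (C \ shadow k ⁻¹' G) := by
        rw [sdiff_eq, ← inter_assoc, ← inter_assoc, iUnion_inter, iUnion_inter]
        simp only [hcell]
        rw [iUnion_inter, iUnion_inter]
      rw [e1, e2] at hmain
      exact_mod_cast hmain
  · rintro x ⟨hxC, hxG⟩
    have h2 := hcol.zeroDens_pushDefect hτ'.1 (hτ'.2.trans h1') hxC (hGT _ hxG)
    refine zeroDens_local hCo hxC (Eventually.of_forall fun y hy hyC => ?_) h2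
    have hy' : Ψ y ∈ C := push_mem (hq1 τ' hτ') hyC
    simpa only [pushDefect, mem_ofPred_eq, heq y hyC, heq (Ψ y) hy'] using hy
end

lemma ae_tendsto_compl_density {T : Set (Fin n → ℝ)} (hT : MeasurableSet T) :
    ∀ᵐ z, z ∈ T → Tendsto (fun r => volume (Tᶜ ∩ closedBall z r) / volume (closedBall z r))
      (𝓝[>] 0) (𝓝 0) := by
  filter_upwards [Besicovitch.ae_tendsto_measure_inter_div_of_measurableSet volume hT.compl]
    with z hz hzT
  simpa [hzT] using hz

/-- A common point of density of `T` at which one measure has bounded upper density and the part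
of another measure away from a full-measure subset of `T` has density zero. -/
lemma exists_density_point {T : Set (Fin n → ℝ)} (hT : MeasurableSet T) (hT0 : volume T ≠ 0)
    (ρ₁ ρ₂ : Measure (Fin n → ℝ)) [IsFiniteMeasure ρ₁] [IsFiniteMeasure ρ₂] {D : ℝ≥0∞}
    (hD : ∀ z ∈ T, ρ₁.rnDeriv volume z ≤ D) (hDt : D ≠ ⊤) :
    ∃ G ⊆ T, MeasurableSet G ∧ (∀ z ∈ G, Tendsto (fun r => volume (Tᶜ ∩ closedBall z r) /
      volume (closedBall z r)) (𝓝[>] 0) (𝓝 0)) ∧ ∃ z₁ ∈ T, ∀ τ : ℝ≥0∞, τ ≠ 0 → ∃ r₀ > (0 : ℝ),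
        ∀ r ∈ Ioc 0 r₀, volume (closedBall z₁ (r / 2)) ≤ 2 * volume (T ∩ closedBall z₁ (r / 2)) ∧
          ρ₁ (closedBall z₁ r) ≤ (D + 1) * volume (closedBall z₁ r) ∧
          ρ₂ (closedBall z₁ r \ G) ≤ τ * volume (closedBall z₁ r) := by
  set bad := {z | ¬ (z ∈ T → Tendsto (fun r => volume (Tᶜ ∩ closedBall z r) /
    volume (closedBall z r)) (𝓝[>] 0) (𝓝 0))} with hbad
  have hbad0 : volume bad = 0 := ae_tendsto_compl_density hT
  set G := T \ toMeasurable volume bad with hGdef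
  have hG : MeasurableSet G := hT.diff (measurableSet_toMeasurable _ _)
  have hGT : ∀ z ∈ G, Tendsto (fun r => volume (Tᶜ ∩ closedBall z r) /
      volume (closedBall z r)) (𝓝[>] 0) (𝓝 0) := fun z hz => by
    by_contra hcon
    exact hz.2 (subset_toMeasurable _ _ fun h => hcon (h hz.1))
  refine ⟨G, sdiff_subset, hG, hGT, ?_⟩
  have hG0 : volume G ≠ 0 := by
    rw [hGdef, measure_sdiff_null (by rwa [measure_toMeasurable])]
    exact hT0
  set ρ := ρ₂.restrict Gᶜ with hρ
  have hρG : ∀ᵐ z, z ∈ G → ρ.rnDeriv volume z = 0 := by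
    have h1 : ∫⁻ z in G, ρ.rnDeriv volume z = 0 := by
      refine le_antisymm ((Measure.setLIntegral_rnDeriv_le G).trans ?_) bot_le
      rw [hρ, Measure.restrict_apply hG, inter_compl_self, measure_empty]
    rw [lintegral_eq_zero_iff (Measure.measurable_rnDeriv _ _)] at h1
    rwa [← ae_restrict_iff' hG]
  obtain ⟨z₁, hz₁G, l1, l2, l3⟩ : ∃ z₁ ∈ G,
      Tendsto (fun r => ρ₁ (closedBall z₁ r) / volume (closedBall z₁ r)) (𝓝[>] 0)
        (𝓝 (ρ₁.rnDeriv volume z₁)) ∧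
      Tendsto (fun r => ρ (closedBall z₁ r) / volume (closedBall z₁ r)) (𝓝[>] 0)
        (𝓝 (ρ.rnDeriv volume z₁)) ∧ ρ.rnDeriv volume z₁ = 0 := by
    obtain ⟨z, hz, h1, h2, h3⟩ := ((frequently_ae_mem_iff.2 hG0).and_eventually
      ((Besicovitch.ae_tendsto_rnDeriv ρ₁ volume).and
        ((Besicovitch.ae_tendsto_rnDeriv ρ volume).and hρG))).exists
    exact ⟨z, hz, h1, h2, h3 hz⟩
  rw [l3] at l2
  refine ⟨z₁, hz₁G.1, fun τ hτ => ?_⟩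
  have hb : ∀ r > (0 : ℝ), volume (closedBall z₁ r) ≠ 0 ∧ volume (closedBall z₁ r) ≠ ⊤ :=
    fun r hr => ⟨(measure_closedBall_pos _ _ hr).ne', measure_closedBall_lt_top.ne⟩
  have ev1 := l1.eventually (gt_mem_nhds (lt_of_le_of_lt (hD z₁ hz₁G.1)
    (ENNReal.lt_add_right hDt one_ne_zero)))
  have ev2 := l2.eventually (gt_mem_nhds (pos_iff_ne_zero.2 hτ))
  have ev3 := (hGT z₁ hz₁G).eventually (gt_mem_nhds (show (0 : ℝ≥0∞) < 1 / 2 by simp))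
  obtain ⟨r₀, hr₀, h₀⟩ := mem_nhdsGT_iff_exists_Ioc_subset.1 (ev1.and (ev2.and ev3))
  refine ⟨r₀, hr₀, fun r hr => ⟨?_, ?_, ?_⟩⟩
  · have hr2 : r / 2 ∈ Ioc 0 r₀ := ⟨by linarith [hr.1], by linarith [hr.1, hr.2]⟩
    have h1 := (h₀ hr2).2.2
    obtain ⟨hb0, hbt⟩ := hb _ hr2.1
    rw [ENNReal.div_lt_iff (Or.inl hb0) (Or.inl hbt)] at h1
    have h2 := measure_inter_add_sdiff (μ := volume) (closedBall z₁ (r / 2)) hT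
    rw [inter_comm, sdiff_eq, inter_comm _ Tᶜ] at h2
    have h3 : volume (closedBall z₁ (r / 2)) ≤
        volume (T ∩ closedBall z₁ (r / 2)) + 1 / 2 * volume (closedBall z₁ (r / 2)) := by
      conv_lhs => rw [← h2]
      gcongr
    have h4 : volume (closedBall z₁ (r / 2)) = 1 / 2 * volume (closedBall z₁ (r / 2)) +
        1 / 2 * volume (closedBall z₁ (r / 2)) := by
      rw [← add_mul, ENNReal.add_halves, one_mul]
    have h5 : 1 / 2 * volume (closedBall z₁ (r / 2)) ≤ volume (T ∩ closedBall z₁ (r / 2)) := by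
      refine ENNReal.le_of_add_le_add_right ?_ (h4.symm.trans_le h3)
      exact ENNReal.mul_ne_top (by simp) hbt
    calc _ = 2 * (1 / 2 * volume (closedBall z₁ (r / 2))) := by
          rw [← mul_assoc, one_div, ENNReal.mul_inv_cancel (by simp) (by simp), one_mul]
      _ ≤ _ := by gcongr
  · have h1 := (h₀ hr).1
    obtain ⟨hb0, hbt⟩ := hb _ hr.1
    rw [ENNReal.div_lt_iff (Or.inl hb0) (Or.inl hbt)] at h1
    exact h1.le
  · have h1 := (h₀ hr).2.1
    obtain ⟨hb0, hbt⟩ := hb _ hr.1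
    rw [ENNReal.div_lt_iff (Or.inl hb0) (Or.inl hbt), hρ,
      Measure.restrict_apply measurableSet_closedBall] at h1
    exact h1.le

lemma canTransfer_of_scale {ν γ : Measure (Pt (n + 1))} {c : Pt (n + 1) → L}
    {W : Set (Pt (n + 1))} {i j : L} {K M : ℝ≥0∞} (hM1 : 1 ≤ M) {t r₀ : ℝ}
    (ht : 0 < t) (hr₀ : 0 < r₀)
    (hT : ∀ r ∈ Ioc 0 r₀, ∀ ε : ℝ≥0∞, M * ε ≤ ENNReal.ofReal ((t * r) ^ (n + 1) / 8) →
      ∀ c' : Pt (n + 1) → L, MeasLab c' → (∀ x ∈ W, c' x = c x) →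
        ∃ c'' : Pt (n + 1) → L, MeasLab c'' ∧ (∀ x ∉ W, c'' x = c' x) ∧
          ν (c'' ⁻¹' {j}) + ε = ν (c' ⁻¹' {j}) ∧ ν (c'' ⁻¹' {i}) = ν (c' ⁻¹' {i}) + ε ∧
          (∀ l, l ≠ j → l ≠ i → ν (c'' ⁻¹' {l}) = ν (c' ⁻¹' {l})) ∧
          totalPer γ c'' ≤ totalPer γ c' + K * ENNReal.ofReal (t ^ (n + 1) * r ^ n)) :
    CanTransfer ν γ c W j i (K * (8 * M) * ENNReal.ofReal t)
      (ENNReal.ofReal ((t * r₀) ^ (n + 1) / 8) / M) := by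
  intro ε hε c' hc' hcc
  have hM0 : M ≠ 0 := (one_pos.trans_le hM1).ne'
  by_cases hε0 : ε = 0
  · exact ⟨c', hc', fun _ _ => rfl, by simp [hε0], by simp [hε0], fun _ _ _ => rfl, le_self_add⟩
  have hεM : M * ε ≤ ENNReal.ofReal ((t * r₀) ^ (n + 1) / 8) :=
    (mul_le_mul_right hε M).trans ENNReal.mul_div_le
  have hMε : M * ε ≠ ⊤ := ne_top_of_le_ne_top ENNReal.ofReal_ne_top hεM
  set X : ℝ := (8 * (M * ε)).toReal with hX
  have hXe : ENNReal.ofReal X = 8 * (M * ε) := ENNReal.ofReal_toReal (by finiteness)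
  have hX0 : 0 < X := ENNReal.toReal_pos (by simp [hM0, hε0]) (by finiteness)
  set s : ℝ := X ^ ((1 : ℝ) / (n + 1)) with hs
  have hs0 : 0 < s := Real.rpow_pos_of_pos hX0 _
  have hsX : s ^ (n + 1) = X := by
    rw [hs, ← Real.rpow_natCast, ← Real.rpow_mul hX0.le]
    push_cast
    rw [one_div, inv_mul_cancel₀ (by positivity), Real.rpow_one]
  have hMs : M * ε = ENNReal.ofReal (s ^ (n + 1) / 8) := by
    rw [hsX, ENNReal.ofReal_div_of_pos (by norm_num), hXe]
    rw [ENNReal.ofReal_ofNat, mul_comm (8 : ℝ≥0∞), ENNReal.mul_div_cancel_right (by simp) (by simp)]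
  have hsr : s ≤ t * r₀ := by
    rw [hMs, ENNReal.ofReal_le_ofReal_iff (by positivity)] at hεM
    exact (pow_le_pow_iff_left₀ hs0.le (by positivity) (by omega : n + 1 ≠ 0)).1 (by linarith)
  have hr : s / t ∈ Ioc 0 r₀ := ⟨by positivity, by rw [div_le_iff₀ ht]; linarith⟩
  obtain ⟨c'', h1, h2, h3, h4, h5, h6⟩ := hT (s / t) hr ε
    (by rw [mul_div_cancel₀ s ht.ne', hMs]) c' hc' hcc
  refine ⟨c'', h1, h2, h3, h4, h5, h6.trans (add_le_add le_rfl ?_)⟩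
  have e1 : t ^ (n + 1) * (s / t) ^ n = t * s ^ n := by
    rw [div_pow, pow_succ]; field_simp
  have e2 : ENNReal.ofReal (s ^ n) = (8 * (M * ε)) ^ ((n : ℝ) / (n + 1)) := by
    rw [← hXe, ENNReal.ofReal_rpow_of_pos hX0, hs, ← Real.rpow_natCast, ← Real.rpow_mul hX0.le]
    congr 2
    ring
  have hβ0 : 0 ≤ (n : ℝ) / (n + 1) := by positivity
  have hβ1 : (n : ℝ) / (n + 1) ≤ 1 := by rw [div_le_one (by positivity)]; linarith
  have e3 : (8 * (M * ε)) ^ ((n : ℝ) / (n + 1)) ≤ 8 * M * ε ^ ((n : ℝ) / (n + 1)) := by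
    rw [← mul_assoc, ENNReal.mul_rpow_of_nonneg _ _ hβ0]
    gcongr
    refine (ENNReal.rpow_le_rpow_of_exponent_le ?_ hβ1).trans_eq (ENNReal.rpow_one _)
    exact one_le_mul (by norm_num) hM1
  rw [e1, ENNReal.ofReal_mul ht.le, e2]
  calc K * (ENNReal.ofReal t * (8 * (M * ε)) ^ ((n : ℝ) / (n + 1)))
      ≤ K * (ENNReal.ofReal t * (8 * M * ε ^ ((n : ℝ) / (n + 1)))) := by gcongr
    _ = _ := by ring

lemma one_add_two_mul_pow_le {τ : ℝ≥0∞} (hτ : τ ≤ 1 / 2) (n : ℕ) :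
    (1 + 2 * τ) ^ n ≤ 1 + 2 * 3 ^ n * τ := by
  have h2 : 2 * τ ≤ 1 := by
    calc 2 * τ ≤ 2 * (1 / 2) := by gcongr
      _ = 1 := by rw [one_div, ENNReal.mul_inv_cancel (by simp) (by simp)]
  induction n with
  | zero => simp
  | succ n ih =>
    calc (1 + 2 * τ) ^ (n + 1) = (1 + 2 * τ) ^ n * (1 + 2 * τ) := pow_succ _ _
      _ ≤ (1 + 2 * 3 ^ n * τ) * (1 + 2 * τ) := by gcongr
      _ = 1 + 2 * τ + (2 * 3 ^ n * τ + 2 * 3 ^ n * τ * (2 * τ)) := by ring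
      _ ≤ 1 + 2 * 3 ^ n * τ + (2 * 3 ^ n * τ + 2 * 3 ^ n * τ * 1) := by
        gcongr
        exact le_mul_of_one_le_right bot_le (one_le_pow₀ (by norm_num))
      _ = _ := by ring

lemma cyl_mono (k : Fin (n + 1)) (z₁ : Fin n → ℝ) (c₀ h : ℝ) {r r' : ℝ} (hr : r ≤ r') :
    cyl k z₁ c₀ h r ⊆ cyl k z₁ c₀ h r' := fun _ hx =>
  mem_cyl.2 ⟨(mem_cyl.1 hx).1.trans_le hr, (mem_cyl.1 hx).2⟩

/-- A column of bounded density far away yields cheap transfers. The cost coefficient is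
`K * (8 * M) * t` with `K` depending only on `n`, `M`, `D` and the number of labels. -/
lemma Column.exists_canTransfer {c : Pt (n + 1) → L} {k : Fin (n + 1)} {σ c₀ h : ℝ} {i j : L}
    {p : (Fin n → ℝ) → ℝ} {T : Set (Fin n → ℝ)} (hcol : Column c k σ c₀ h i j p T)
    {ν γ : Measure (Pt (n + 1))} {M : ℝ≥0∞} (hw : Weights ν γ M) (hc : MeasLab c)
    (hper : ∀ l, μH[(n : ℝ)] (cellBdry c l) ≠ ⊤)
    (hT0 : volume T ≠ 0) {X : Set (Pt (n + 1))} {t : ℝ} (ht : 0 < t) (ht1 : t ^ (n + 1) ≤ 1 / 2)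
    (hX : ∀ z ∈ T, cyl k z c₀ h 1 ⊆ X) {b : ℝ≥0∞} (hbM : b ≤ M)
    (hfar : ∀ A, MeasurableSet A → A ⊆ X → b * μH[(n : ℝ)] A ≤ γ A ∧
      γ A ≤ (b + ENNReal.ofReal (t ^ (n + 1))) * μH[(n : ℝ)] A) {D : ℝ≥0∞} (hDt : D ≠ ⊤)
    {B : Set (Pt (n + 1))} (hBt : μH[(n : ℝ)] B ≠ ⊤)
    (hB : ∀ x ∈ cellBdry c i, shadow k x ∈ T → Tendsto (fun r =>
      volume (Tᶜ ∩ closedBall (shadow k x) r) / volume (closedBall (shadow k x) r)) (𝓝[>] 0)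
        (𝓝 0) → |x k - c₀| < 2 * h → x ∈ B)
    (hD : ∀ z ∈ T, ((μH[(n : ℝ)].restrict B).map (shadow k)).rnDeriv volume z ≤ D) :
    ∃ z₁ ∈ T, ∃ v₀, v₀ ≠ 0 ∧ v₀ ≠ ⊤ ∧ CanTransfer ν γ c (cyl k z₁ c₀ h 1) j i
      ((12 * 3 ^ n * M * (D + 1) + Fintype.card L * (M * (1 + 2 ^ n))) * 2 ^ n * (8 * M) *
        ENNReal.ofReal t) v₀ := by
  have hM0 : M ≠ 0 := (one_pos.trans_le hw.one_le).ne'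
  have hpos := hcol.pos
  have hperU : μH[(n : ℝ)] (⋃ l, cellBdry c l) ≠ ⊤ := by
    refine ne_top_of_le_ne_top ?_ (measure_iUnion_le _)
    rw [tsum_fintype]
    exact ENNReal.sum_ne_top.2 fun l _ => hper l
  set ρ₁ := (μH[(n : ℝ)].restrict B).map (shadow k) with hρ₁
  set ρ₂ := (μH[(n : ℝ)].restrict (⋃ l, cellBdry c l)).map (shadow k) with hρ₂
  have hsh : Measurable (shadow k : Pt (n + 1) → Fin n → ℝ) := measurable_shadow k
  have : IsFiniteMeasure ρ₁ := ⟨by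
    rw [hρ₁, Measure.map_apply hsh MeasurableSet.univ, preimage_univ,
      Measure.restrict_apply_univ]
    exact hBt.lt_top⟩
  have : IsFiniteMeasure ρ₂ := ⟨by
    rw [hρ₂, Measure.map_apply hsh MeasurableSet.univ, preimage_univ,
      Measure.restrict_apply_univ]
    exact hperU.lt_top⟩
  obtain ⟨G, hGs, hG, hGT, z₁, hz₁, hz⟩ := exists_density_point hcol.measT hT0 ρ₁ ρ₂ hD hDt
  set τ : ℝ≥0 := Real.toNNReal (t ^ (n + 1)) with hτ
  have hτr : (τ : ℝ) = t ^ (n + 1) := Real.coe_toNNReal _ (by positivity)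
  have hτe : (τ : ℝ≥0∞) = ENNReal.ofReal (t ^ (n + 1)) := rfl
  have hτ1 : τ ≤ 1 / 2 := by rw [← NNReal.coe_le_coe, hτr]; simpa using ht1
  have hτ1e : (τ : ℝ≥0∞) ≤ 1 / 2 := by
    have : ((τ : ℝ≥0) : ℝ≥0∞) ≤ ((1 / 2 : ℝ≥0) : ℝ≥0∞) := by exact_mod_cast hτ1
    simpa using this
  obtain ⟨r₀, hr₀, hr₀'⟩ := hz τ (by simp only [ne_eq, ENNReal.coe_eq_zero]; positivity)
  refine ⟨z₁, hz₁, _, ?_, ?_, canTransfer_of_scale hw.one_le ht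
    (r₀ := min r₀ (min h 1)) (lt_min hr₀ (lt_min hpos one_pos)) ?_⟩
  · refine (ENNReal.div_pos ?_ hw.ne_top).ne'
    have : 0 < min r₀ (min h 1) := lt_min hr₀ (lt_min hpos one_pos)
    exact (ENNReal.ofReal_pos.2 (by positivity)).ne'
  · exact ENNReal.div_ne_top ENNReal.ofReal_ne_top hM0
  intro r hr ε hε c' hc' hcc
  have hr1 : r ≤ 1 := hr.2.trans ((min_le_right _ _).trans (min_le_right _ _))
  have hrh : r ≤ h := hr.2.trans ((min_le_right _ _).trans (min_le_left _ _))
  obtain ⟨d1, d2, d3⟩ := hr₀' r ⟨hr.1, hr.2.trans (min_le_left _ _)⟩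
  have hsub : cyl k z₁ c₀ h r ⊆ cyl k z₁ c₀ h 1 := cyl_mono k z₁ c₀ h hr1
  have hvol : ∀ s : ℝ, 0 ≤ s → volume (closedBall z₁ s) = ENNReal.ofReal ((2 * s) ^ n) :=
    fun s hs => by rw [Real.volume_pi_closedBall _ hs, Fintype.card_fin]
  have hε' : M * ε ≤ ENNReal.ofReal (τ * r / 4) * volume (T ∩ closedBall z₁ (r / 2)) := by
    refine hε.trans ?_
    rw [hvol _ (by linarith [hr.1])] at d1
    have hr' := hr.1
    have : ENNReal.ofReal ((t * r) ^ (n + 1) / 8) * 2 ≤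
        ENNReal.ofReal (τ * r / 4) * volume (T ∩ closedBall z₁ (r / 2)) * 2 := by
      calc ENNReal.ofReal ((t * r) ^ (n + 1) / 8) * 2
          = ENNReal.ofReal (τ * r / 4) * ENNReal.ofReal ((2 * (r / 2)) ^ n) := by
            rw [← ENNReal.ofReal_mul (by positivity), ← ENNReal.ofReal_ofNat 2,
              ← ENNReal.ofReal_mul (by positivity), hτr]
            congr 1
            rw [mul_div_cancel₀ r two_ne_zero, mul_pow, pow_succ r]
            ring
        _ ≤ ENNReal.ofReal (τ * r / 4) * (2 * volume (T ∩ closedBall z₁ (r / 2))) := by gcongr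
        _ = _ := by ring
    exact (ENNReal.mul_le_mul_iff_left (by simp) (by simp)).1 this
  obtain ⟨c'', h1, h2, h3, h4, h5, h6⟩ := hcol.exists_push hw hr.1 hrh hτ1 hG hGT
    (fun A hA hAX => hfar A hA (hAX.trans (hsub.trans (hX z₁ hz₁)))) (ε := ε) hε' hc hc'
    fun x hx => hcc x (hsub hx)
  refine ⟨c'', h1, fun x hx => h2 x fun h => hx (hsub h), h3, h4, h5, ?_⟩
  set V := ENNReal.ofReal ((2 * r) ^ n) with hV
  rw [hvol _ hr.1.le] at d2 d3
  have hcylsh : ∀ x ∈ cyl k z₁ c₀ h r, shadow k x ∈ closedBall z₁ r := fun x hx =>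
    (mem_cyl.1 hx).1.le
  have b1 : μH[(n : ℝ)] (cellBdry c i ∩ (cyl k z₁ c₀ h r ∩ shadow k ⁻¹' G)) ≤ (D + 1) * V := by
    refine le_trans ?_ d2
    rw [hρ₁, Measure.map_apply hsh measurableSet_closedBall,
      Measure.restrict_apply (hsh measurableSet_closedBall)]
    exact measure_mono fun x hx => ⟨hcylsh x hx.2.1,
      hB x hx.1 (hGs hx.2.2) (hGT _ hx.2.2) (mem_cyl.1 hx.2.1).2⟩
  have b2 : μH[(n : ℝ)] ((⋃ l, cellBdry c l) ∩ (cyl k z₁ c₀ h r \ shadow k ⁻¹' G)) ≤ τ * V := by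
    refine le_trans ?_ d3
    rw [hρ₂, Measure.map_apply hsh (measurableSet_closedBall.diff hG),
      Measure.restrict_apply (hsh (measurableSet_closedBall.diff hG))]
    exact measure_mono fun x hx => ⟨⟨hcylsh x hx.2.1, hx.2.2⟩, hx.1⟩
  set H₁ := μH[(n : ℝ)] (cellBdry c i ∩ (cyl k z₁ c₀ h r ∩ shadow k ⁻¹' G))
  set H₂ := μH[(n : ℝ)] ((⋃ l, cellBdry c l) ∩ (cyl k z₁ c₀ h r \ shadow k ⁻¹' G))
  have hH₁ : H₁ ≠ ⊤ := ne_top_of_le_ne_top (hper i) (measure_mono inter_subset_left)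
  have hbt : b ≠ ⊤ := ne_top_of_le_ne_top hw.ne_top hbM
  have hpow := one_add_two_mul_pow_le hτ1e n
  have hpow2 : (1 + 2 * (τ : ℝ≥0∞)) ^ n ≤ 2 ^ n := by
    gcongr
    calc 1 + 2 * (τ : ℝ≥0∞) ≤ 1 + 2 * (1 / 2) := by gcongr
      _ = 2 := by rw [one_div, ENNReal.mul_inv_cancel (by simp) (by simp)]; norm_num
  have hτ1' : (τ : ℝ≥0∞) ≤ 1 := hτ1e.trans (by simp)
  have k1 : (b + (τ : ℝ≥0∞)) * (1 + 2 * τ) ^ n ≤ b + 6 * 3 ^ n * M * τ := by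
    calc (b + (τ : ℝ≥0∞)) * (1 + 2 * τ) ^ n ≤ (b + τ) * (1 + 2 * 3 ^ n * τ) := by gcongr
      _ = b + (τ + 2 * 3 ^ n * b * τ + 2 * 3 ^ n * τ * τ) := by ring
      _ ≤ b + (2 * 3 ^ n * M * τ + 2 * 3 ^ n * M * τ + 2 * 3 ^ n * M * τ) := by
        gcongr
        · refine le_mul_of_one_le_left bot_le ?_
          exact one_le_mul (one_le_mul (by norm_num) (one_le_pow₀ (by norm_num))) hw.one_le
        · exact hτ1'.trans hw.one_le
      _ = _ := by ring
  rw [← hτe] at h6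
  have h7 : totalPer γ c'' + 2 * b * H₁ ≤ totalPer γ c' +
      (12 * 3 ^ n * M * (D + 1) + Fintype.card L * (M * (1 + 2 ^ n))) * τ * V + 2 * b * H₁ := by
    refine h6.trans ?_
    calc _ = totalPer γ c' + 2 * ((b + τ) * (1 + 2 * τ) ^ n) * H₁ +
          Fintype.card L * (M * (1 + (1 + 2 * τ) ^ n)) * H₂ := by ring
      _ ≤ totalPer γ c' + 2 * (b + 6 * 3 ^ n * M * τ) * H₁ +
          Fintype.card L * (M * (1 + 2 ^ n)) * (τ * V) := by gcongr
      _ = totalPer γ c' + 12 * 3 ^ n * M * τ * H₁ +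
          Fintype.card L * (M * (1 + 2 ^ n)) * (τ * V) + 2 * b * H₁ := by ring
      _ ≤ totalPer γ c' + 12 * 3 ^ n * M * τ * ((D + 1) * V) +
          Fintype.card L * (M * (1 + 2 ^ n)) * (τ * V) + 2 * b * H₁ := by gcongr
      _ = _ := by ring
  refine (ENNReal.le_of_add_le_add_right (by finiteness) h7).trans_eq ?_
  have hr' := hr.1
  rw [hV, hτe, ENNReal.ofReal_mul (by positivity), mul_pow, ENNReal.ofReal_mul (by positivity),
    ENNReal.ofReal_pow (by norm_num) n, ENNReal.ofReal_ofNat]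
  ring

lemma exists_gap {F : Set ℝ} (hF : F.Finite) (p : ℝ) :
    ∃ g > 0, ∀ s, |s - p| < g → s ≠ p → s ∉ F := by
  have hcl : IsClosed (F \ {p}) := (hF.subset sdiff_subset).isClosed
  obtain ⟨g, hg, hs⟩ := Metric.isOpen_iff.1 hcl.isOpen_compl p (by simp)
  refine ⟨g, hg, fun s hsg hsp hsF => hs (show s ∈ ball p g from ?_) ⟨hsF, hsp⟩⟩
  rwa [mem_ball, Real.dist_eq]

/-- A labelling of a line that is constant off a finite set has a point at which it changes from
a label with property `P` to one without it. -/
lemma exists_jump {F : Set ℝ} (hF : F.Finite) {lab : ℝ → L}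
    (hlab : ∀ s s', s ≤ s' → (∀ u ∈ Icc s s', u ∉ F) → lab s = lab s') {P : L → Prop}
    {s₁ s₂ : ℝ} (h12 : s₁ ≤ s₂) (h1 : s₁ ∉ F) (h2 : s₂ ∉ F) (hP1 : P (lab s₁)) (hP2 : ¬ P (lab s₂)) :
    ∃ p ∈ Icc s₁ s₂, ∃ g > 0, ∃ i j, P i ∧ ¬ P j ∧ (∀ s, |s - p| < g → s ≠ p → s ∉ F) ∧
      ∀ s, |s - p| < g → (s < p → lab s = i) ∧ (p < s → lab s = j) := by
  set A := {s | s ∈ Icc s₁ s₂ ∧ s ∉ F ∧ P (lab s)} with hA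
  have hA1 : s₁ ∈ A := ⟨⟨le_rfl, h12⟩, h1, hP1⟩
  have hbdd : BddAbove A := ⟨s₂, fun s hs => hs.1.2⟩
  set p := sSup A with hp
  have hp1 : s₁ ≤ p := le_csSup hbdd hA1
  have hp2 : p ≤ s₂ := csSup_le ⟨s₁, hA1⟩ fun s hs => hs.1.2
  obtain ⟨g, hg, hgap⟩ := exists_gap hF p
  obtain ⟨a, haA, hap⟩ := exists_lt_of_lt_csSup ⟨s₁, hA1⟩ (show p - g < p by linarith)
  have hap' : a ≤ p := le_csSup hbdd haA
  have habove : ∀ s ∈ Icc s₁ s₂, p < s → s ∉ F → ¬ P (lab s) := fun s hs hps hsF hPs =>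
    absurd (le_csSup hbdd ⟨hs, hsF, hPs⟩) (not_le.2 hps)
  have hpF : p ∈ F := by
    by_contra hpF
    have hfree : ∀ u, |u - p| < g → u ∉ F := fun u hu => by
      by_cases h : u = p
      · rwa [h]
      · exact hgap u hu h
    have hps2 : p < s₂ := by
      refine lt_of_le_of_ne hp2 fun h => hP2 ?_
      rw [← h, ← hlab a p hap' fun u hu => hfree u ?_]
      · exact haA.2.2
      · rw [abs_lt]; constructor <;> linarith [hu.1, hu.2]
    have hs : p < min (p + g / 2) s₂ := lt_min (by linarith) hps2
    have hsg : min (p + g / 2) s₂ ≤ p + g / 2 := min_le_left _ _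
    refine habove _ ⟨hp1.trans hs.le, min_le_right _ _⟩ hs (hfree _ ?_) ?_
    · rw [abs_lt]; constructor <;> linarith
    · rw [← hlab a _ (hap'.trans hs.le) fun u hu => hfree u ?_]
      · exact haA.2.2
      · rw [abs_lt]; constructor <;> linarith [hu.1, hu.2]
  have hne : a ≠ p := fun h => haA.2.1 (h ▸ hpF)
  have hap2 : a < p := lt_of_le_of_ne hap' hne
  have hps2 : p < s₂ := lt_of_le_of_ne hp2 fun h => h2 (h ▸ hpF)
  set s := min (p + g / 2) s₂ with hsdef
  have hs : p < s := lt_min (by linarith) hps2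
  have hsg : s ≤ p + g / 2 := min_le_left _ _
  refine ⟨p, ⟨hp1, hp2⟩, g, hg, lab a, lab s, haA.2.2, ?_, hgap, fun u hu => ⟨fun hup => ?_,
    fun hup => ?_⟩⟩
  · refine habove s ⟨hp1.trans hs.le, min_le_right _ _⟩ hs (hgap s ?_ hs.ne')
    rw [abs_lt]; constructor <;> linarith
  · rw [abs_lt] at hu
    rcases le_total u a with h | h
    · refine hlab u a h fun w hw => hgap w ?_ (by linarith [hw.2] : w < p).ne
      rw [abs_lt]; constructor <;> linarith [hw.1, hw.2]
    · refine (hlab a u h fun w hw => hgap w ?_ (by linarith [hw.2] : w < p).ne).symm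
      rw [abs_lt]; constructor <;> linarith [hw.1, hw.2]
  · rw [abs_lt] at hu
    rcases le_total u s with h | h
    · refine hlab u s h fun w hw => hgap w ?_ (by linarith [hw.1] : p < w).ne'
      rw [abs_lt]; constructor <;> linarith [hw.1, hw.2]
    · refine (hlab s u h fun w hw => hgap w ?_ (by linarith [hw.1] : p < w).ne').symm
      rw [abs_lt]; constructor <;> linarith [hw.1, hw.2]

/-- The points of a column boundary over density points of the base are boundary points of any
union of cells separating the two labels. -/
lemma Column.mem_essBdry {c : Pt (n + 1) → L} {k : Fin (n + 1)} {σ c₀ h : ℝ} {i j : L}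
    {p : (Fin n → ℝ) → ℝ} {T : Set (Fin n → ℝ)} (hcol : Column c k σ c₀ h i j p T)
    (hc : MeasLab c) {S : Set L} (hi : i ∈ S) (hj : j ∉ S) {x : Pt (n + 1)}
    (hx : x ∈ cellBdry c i) (hden : Tendsto (fun r =>
      volume (Tᶜ ∩ closedBall (shadow k x) r) / volume (closedBall (shadow k x) r)) (𝓝[>] 0)
        (𝓝 0)) (hxh : |x k - c₀| < 2 * h) : x ∈ essBdry (c ⁻¹' S) := by
  have hpos := hcol.pos
  rw [essBdry_eq (hc.preimage S), mem_compl_iff, mem_union, not_or]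
  obtain ⟨h1, h2⟩ := (mem_cellBdry hc).1 hx
  refine ⟨fun h => h1 (zeroDens_anti (preimage_mono (singleton_subset_iff.2 hi)) h), fun hd => h2 ?_⟩
  have hU : IsOpen {y : Pt (n + 1) | |y k - c₀| < 3 * h} := by
    apply isOpen_lt <;> fun_prop
  refine zeroDens_local hU (show |x k - c₀| < 3 * h by linarith) ?_
    (zeroDens_union hd (zeroDens_shadow_preimage k hden))
  filter_upwards [hcol.lab] with y hy hyi hyU
  by_cases hyT : shadow k y ∈ T
  · rcases hy hyT hyU with h | h
    · exact absurd h.2 hyi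
    · exact Or.inl fun (hyS : c y ∈ S) => hj (h.2 ▸ hyS)
  · exact Or.inr hyT

/-- For almost every line, the labels are constant off a finite set of boundary points. -/
lemma ae_line_label {c : Pt (n + 1) → L} (hc : MeasLab c)
    (hper : ∀ l, μH[(n : ℝ)] (cellBdry c l) ≠ ⊤) (e : Fin (n + 1)) :
    ∀ᵐ z, ∃ F : Set ℝ, F.Finite ∧ ∃ lab : ℝ → L,
      (∀ s s', s ≤ s' → (∀ u ∈ Icc s s', u ∉ F) → lab s = lab s') ∧
      ∀ᵐ s, lab s = c (lineAt e s z) := by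
  have h1 : ∀ l, ∀ᵐ z, {s | lineAt e s z ∈ cellBdry c l}.Finite := fun l =>
    ae_line_finite (hc.measurableSet_cellBdry l) (hper l) e
  have h2 : ∀ l, ∀ᵐ z, _ := fun l => ae_line_crossing (hc l) e
  filter_upwards [ae_all_iff.2 h1, ae_all_iff.2 h2, ae_line e (ae_mem_purePts hc)] with z h1 h2 h3
  classical
  refine ⟨⋃ l, {s | lineAt e s z ∈ cellBdry c l}, finite_iUnion h1,
    fun s => if h : ∃ l, lineAt e s z ∈ purePts c l then h.choose else c (lineAt e s z), ?_, ?_⟩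
  · intro s s' hss hfree
    have hp : ∀ u ∈ Icc s s', ∃ l, lineAt e u z ∈ purePts c l := fun u hu =>
      exists_pure hc fun l hl => hfree u hu (mem_iUnion.2 ⟨l, hl⟩)
    have a1 := hp s ⟨le_rfl, hss⟩
    have a2 := hp s' ⟨hss, le_rfl⟩
    simp only [a1, a2, dif_pos]
    by_contra hne
    obtain ⟨u, hu, hub⟩ := h2 a1.choose s s' a1.choose_spec
      (zeroDens_of_pure (Ne.symm hne) a2.choose_spec)
    rw [uIcc_of_le hss] at hu
    exact hfree u hu (mem_iUnion.2 ⟨_, hub⟩)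
  · filter_upwards [h3] with s hs
    have a1 : ∃ l, lineAt e s z ∈ purePts c l := ⟨_, hs⟩
    simp only [a1, dif_pos]
    exact purePts_unique a1.choose_spec hs


/-- Almost every line meeting `c ⁻¹' S` in a half-space in positive length has, inside the
half-space, a jump between a label of `S` and a label outside of `S`. -/
lemma ae_line_jump {c : Pt (n + 1) → L} (hc : MeasLab c)
    (hper : ∀ l, μH[(n : ℝ)] (cellBdry c l) ≠ ⊤) {S : Set L} (hS : volume (c ⁻¹' S) ≠ ⊤)
    (e k : Fin (n + 1)) {σ : ℝ} (hσ : σ = 1 ∨ σ = -1) (R : ℝ) :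
    ∀ᵐ z, z ∈ lineShadow e (c ⁻¹' S ∩ halfSp k σ R) → ∃ σ' : ℝ, (σ' = 1 ∨ σ' = -1) ∧
      ∃ i ∈ S, ∃ j ∉ S, ∃ p : ℝ, ∃ g > 0,
        (∀ s, |s - p| < g → lineAt e s z ∈ halfSp k σ R) ∧
        ∀ᵐ s, |s - p| < g → (σ' * (s - p) < 0 ∧ c (lineAt e s z) = i) ∨
          (0 < σ' * (s - p) ∧ c (lineAt e s z) = j) := by
  have hSm := hc.preimage S
  have hfin : ∀ᵐ z, volume {s | lineAt e s z ∈ c ⁻¹' S} < ⊤ := by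
    refine ae_lt_top (measurable_volume_line e hSm) ?_
    rwa [← volume_eq_line e hSm]
  filter_upwards [ae_line_label hc hper e, hfin] with z ⟨F, hF, lab, hlab, hae⟩ hz hzS
  set I := {s | lineAt e s z ∈ halfSp k σ R} with hI
  obtain ⟨hord, hinf⟩ := line_halfSp e k hσ R z
  have hIo : IsOpen I := (isOpen_halfSp k σ R).preimage (continuous_lineAt e z)
  have hFae : ∀ᵐ s, s ∉ F := compl_mem_ae_iff.2 (hF.measure_zero volume)
  have hgood : ∀ᵐ s, s ∉ F ∧ lab s = c (lineAt e s z) :=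
    hFae.and hae
  obtain ⟨s₁, hs₁I, hs₁F, hs₁S⟩ : ∃ s ∈ I, s ∉ F ∧ lab s ∈ S := by
    obtain ⟨s, hs, h1, h2⟩ := ((frequently_ae_mem_iff.2
      (show volume {s | lineAt e s z ∈ c ⁻¹' S ∩ halfSp k σ R} ≠ 0 from hzS)).and_eventually
        hgood).exists
    exact ⟨s, hs.2, h1, h2 ▸ hs.1⟩
  obtain ⟨s₂, hs₂I, hs₂F, hs₂S⟩ : ∃ s ∈ I, s ∉ F ∧ lab s ∉ S := by
    have h0 : volume (I \ {s | lineAt e s z ∈ c ⁻¹' S}) ≠ 0 := fun h0 => by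
      have h1 := measure_inter_add_sdiff (μ := volume) I
        (hSm.preimage (measurable_lineAt_left e z))
      have h2 : volume (I \ (fun s => lineAt e s z) ⁻¹' (c ⁻¹' S)) = 0 := h0
      rw [h2, add_zero, hinf ⟨s₁, hs₁I⟩] at h1
      exact absurd ((measure_mono inter_subset_right).trans_lt hz) (by rw [← h1]; exact lt_irrefl _)
    obtain ⟨s, hs, h1, h2⟩ := ((frequently_ae_mem_iff.2 h0).and_eventually hgood).exists
    exact ⟨s, hs.1, h1, h2 ▸ hs.2⟩
  have hwrap : ∀ p ∈ I, ∀ g > 0, ∀ i j, (∀ s, |s - p| < g → s ≠ p → s ∉ F) →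
      (∀ s, |s - p| < g → (s < p → lab s = i) ∧ (p < s → lab s = j)) →
      ∃ g > 0, (∀ s, |s - p| < g → lineAt e s z ∈ halfSp k σ R) ∧
        ∀ᵐ s, |s - p| < g → (s < p ∧ c (lineAt e s z) = i) ∨ (p < s ∧ c (lineAt e s z) = j) := by
    intro p hpI g hg i j _ h
    obtain ⟨g', hg', hsub⟩ := Metric.isOpen_iff.1 hIo p hpI
    refine ⟨min g g', lt_min hg hg', fun s hs => hsub ?_, ?_⟩
    · rw [mem_ball, Real.dist_eq]; exact hs.trans_le (min_le_right _ _)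
    · have hp : ∀ᵐ s : ℝ, s ≠ p := compl_mem_ae_iff.2 (measure_singleton p)
      filter_upwards [hae, hp] with s hs hsp hsg
      rcases lt_or_gt_of_ne hsp with hl | hl
      · exact Or.inl ⟨hl, hs ▸ (h s (hsg.trans_le (min_le_left _ _))).1 hl⟩
      · exact Or.inr ⟨hl, hs ▸ (h s (hsg.trans_le (min_le_left _ _))).2 hl⟩
  rcases le_total s₁ s₂ with h12 | h12
  · obtain ⟨p, hp, g, hg, i, j, hi, hj, hfree, hl⟩ := exists_jump hF hlab (P := (· ∈ S)) h12 hs₁F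
      hs₂F hs₁S hs₂S
    obtain ⟨g', hg', hin, hl'⟩ := hwrap p (hord.out hs₁I hs₂I hp) g hg i j hfree hl
    refine ⟨1, Or.inl rfl, i, hi, j, hj, p, g', hg', hin, ?_⟩
    filter_upwards [hl'] with s hs hsg
    rw [one_mul, sub_neg, sub_pos]
    exact hs hsg
  · obtain ⟨p, hp, g, hg, i, j, hi, hj, hfree, hl⟩ := exists_jump hF hlab (P := (· ∉ S)) h12 hs₂F
      hs₁F hs₂S (not_not.2 hs₁S)
    obtain ⟨g', hg', hin, hl'⟩ := hwrap p (hord.out hs₂I hs₁I hp) g hg i j hfree hl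
    refine ⟨-1, Or.inr rfl, j, not_not.1 hj, i, hi, p, g', hg', hin, ?_⟩
    filter_upwards [hl'] with s hs hsg
    rw [neg_one_mul, neg_lt_zero, neg_pos, sub_neg, sub_pos]
    exact (hs hsg).symm

/-- The height of the jump from the label `i`, recovered from the length occupied by `i`. -/
def jumpHeight (c : Pt (n + 1) → L) (e : Fin (n + 1)) (σ c₀ h : ℝ) (i : L) (z : Fin n → ℝ) : ℝ :=
  c₀ - σ * (3 * h - (volume {s | lineAt e s z ∈ c ⁻¹' {i} ∩ {x | |x e - c₀| < 3 * h}}).toReal)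

lemma measurableSet_slab (e : Fin (n + 1)) (c₀ h : ℝ) :
    MeasurableSet {x : Pt (n + 1) | |x e - c₀| < 3 * h} := by
  apply measurableSet_lt <;> fun_prop

lemma measurable_jumpHeight {c : Pt (n + 1) → L} (hc : MeasLab c) (e : Fin (n + 1)) (σ c₀ h : ℝ)
    (i : L) : Measurable (jumpHeight c e σ c₀ h i) := by
  have := measurable_volume_line e ((hc i).inter (measurableSet_slab e c₀ h))
  exact ((this.ennreal_toReal.const_sub _).const_mul _).const_sub _

lemma jumpHeight_eq {c : Pt (n + 1) → L} {e : Fin (n + 1)} {σ c₀ h p : ℝ} {i j : L}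
    {z : Fin n → ℝ} (hij : i ≠ j) (hσ : σ = 1 ∨ σ = -1) (hh : 0 < h) (hp : |p - c₀| ≤ h)
    (hae : ∀ᵐ s, |s - c₀| < 3 * h → (σ * (s - p) < 0 ∧ c (lineAt e s z) = i) ∨
      (0 < σ * (s - p) ∧ c (lineAt e s z) = j)) : jumpHeight c e σ c₀ h i z = p := by
  rw [abs_le] at hp
  have h1 : volume {s | lineAt e s z ∈ c ⁻¹' {i} ∩ {x | |x e - c₀| < 3 * h}} =
      volume {s : ℝ | σ * (s - p) < 0 ∧ |s - c₀| < 3 * h} := by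
    refine measure_congr (eventuallyEq_set.2 ?_)
    filter_upwards [hae] with s hs
    simp only [mem_ofPred_eq, mem_inter_iff, mem_preimage, mem_singleton_iff, lineAt_same]
    refine and_congr_left fun h => ?_
    rcases hs h with hs | hs
    · exact ⟨fun _ => hs.1, fun _ => hs.2⟩
    · exact ⟨fun h' => absurd (h'.symm.trans hs.2) hij, fun h' => absurd h' hs.1.not_gt⟩
  rw [jumpHeight, h1]
  rcases hσ with rfl | rfl
  · have : {s : ℝ | 1 * (s - p) < 0 ∧ |s - c₀| < 3 * h} = Ioo (c₀ - 3 * h) p := by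
      ext s
      simp only [mem_ofPred_eq, mem_Ioo, abs_lt]
      constructor
      · rintro ⟨h1, h2, h3⟩; constructor <;> linarith
      · rintro ⟨h1, h2⟩; refine ⟨?_, ?_, ?_⟩ <;> linarith
    rw [this, Real.volume_Ioo, ENNReal.toReal_ofReal (by linarith)]
    ring
  · have : {s : ℝ | -1 * (s - p) < 0 ∧ |s - c₀| < 3 * h} = Ioo p (c₀ + 3 * h) := by
      ext s
      simp only [mem_ofPred_eq, mem_Ioo, abs_lt]
      constructor
      · rintro ⟨h1, h2, h3⟩; constructor <;> linarith
      · rintro ⟨h1, h2⟩; refine ⟨?_, ?_, ?_⟩ <;> linarith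
    rw [this, Real.volume_Ioo, ENNReal.toReal_ofReal (by linarith)]
    ring

lemma exists_rat_center (p : ℝ) {g : ℝ} (hg : 0 < g) :
    ∃ c₀ h : ℚ, (0 : ℝ) < h ∧ 4 * (h : ℝ) < g ∧ |p - c₀| ≤ h := by
  obtain ⟨h, h1, h2⟩ := exists_rat_btwn (show (0 : ℝ) < g / 4 by linarith)
  obtain ⟨c₀, h3, h4⟩ := exists_rat_btwn (show p - h < p + h by linarith)
  refine ⟨c₀, h, h1, by linarith, ?_⟩
  rw [abs_le]
  constructor <;> linarith

/-- A set of positive measure of lines meeting `c ⁻¹' S` in a half-space contains the base of a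
column inside the half-space separating a label of `S` from one outside of `S`. -/
lemma exists_column {c : Pt (n + 1) → L} (hc : MeasLab c)
    (hper : ∀ l, μH[(n : ℝ)] (cellBdry c l) ≠ ⊤) {S : Set L} (hS : volume (c ⁻¹' S) ≠ ⊤)
    (e k : Fin (n + 1)) {σ : ℝ} (hσ : σ = 1 ∨ σ = -1) (R : ℝ) {A : Set (Fin n → ℝ)}
    (hAm : MeasurableSet A) (hA : A ⊆ lineShadow e (c ⁻¹' S ∩ halfSp k σ R)) (hA0 : volume A ≠ 0) :
    ∃ i ∈ S, ∃ j ∉ S, ∃ σ' c₀ h : ℝ, ∃ p T, Column c e σ' c₀ h i j p T ∧ T ⊆ A ∧ volume T ≠ 0 ∧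
      ∀ z ∈ T, ∀ s, |s - c₀| < 3 * h → lineAt e s z ∈ halfSp k σ R := by
  let sg : Bool → ℝ := fun b => if b then 1 else -1
  have hsg : ∀ b, sg b = 1 ∨ sg b = -1 := fun b => by cases b <;> simp [sg]
  let P : Bool × L × L × ℚ × ℚ → (Fin n → ℝ) → ℝ := fun q =>
    jumpHeight c e (sg q.1) q.2.2.2.1 q.2.2.2.2 q.2.1
  have hPm : ∀ q, Measurable (P q) := fun q => measurable_jumpHeight hc e _ _ _ _
  let Bad : Bool × L × L × ℚ × ℚ → Set (Pt (n + 1)) := fun q =>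
    {x | |x e - q.2.2.2.1| < 3 * (q.2.2.2.2 : ℝ)} \
      ((c ⁻¹' {q.2.1} ∩ {x | sg q.1 * (x e - P q (shadow e x)) < 0}) ∪
        (c ⁻¹' {q.2.2.1} ∩ {x | 0 < sg q.1 * (x e - P q (shadow e x))}))
  have hBm : ∀ q, MeasurableSet (Bad q) := fun q => by
    have hm : Measurable fun x : Pt (n + 1) => sg q.1 * (x e - P q (shadow e x)) :=
      ((by fun_prop : Measurable fun x : Pt (n + 1) => x e).sub
        ((hPm q).comp (measurable_shadow e))).const_mul _
    exact (measurableSet_slab e _ _).diff (((hc _).inter (measurableSet_lt hm measurable_const)).union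
      ((hc _).inter (measurableSet_lt measurable_const hm)))
  let T : Bool × L × L × ℚ × ℚ → Set (Fin n → ℝ) := fun q =>
    {z | z ∈ A ∧ |P q z - q.2.2.2.1| ≤ q.2.2.2.2 ∧
      lineAt e (q.2.2.2.1 - 3 * q.2.2.2.2) z ∈ halfSp k σ R ∧
      lineAt e (q.2.2.2.1 + 3 * q.2.2.2.2) z ∈ halfSp k σ R ∧
      volume {s | lineAt e s z ∈ Bad q} = 0}
  have hTm : ∀ q, MeasurableSet (T q) := fun q => by
    have hHm := measurableSet_halfSp k σ R
    refine hAm.inter (MeasurableSet.inter ?_ ((hHm.preimage (measurable_lineAt_right e _)).inter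
      ((hHm.preimage (measurable_lineAt_right e _)).inter
        ((measurableSet_singleton 0).preimage (measurable_volume_line e (hBm q))))))
    exact measurableSet_le (((hPm q).sub_const _).abs) measurable_const
  by_contra! hcon
  have hnull : ∀ q : Bool × L × L × ℚ × ℚ, q.2.1 ∈ S → q.2.2.1 ∉ S → 0 < (q.2.2.2.2 : ℝ) →
      volume (T q) = 0 := by
    intro q hi hj hh
    by_contra h0
    have hlab : ∀ᵐ x : Pt (n + 1), shadow e x ∈ T q → |x e - q.2.2.2.1| < 3 * (q.2.2.2.2 : ℝ) →
        (sg q.1 * (x e - P q (shadow e x)) < 0 ∧ c x = q.2.1) ∨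
          (0 < sg q.1 * (x e - P q (shadow e x)) ∧ c x = q.2.2.1) := by
      have h1 : volume (Bad q ∩ shadow e ⁻¹' T q) = 0 := by
        rw [volume_eq_line e ((hBm q).inter ((hTm q).preimage (measurable_shadow e))),
          lintegral_eq_zero_of_ae_eq_zero]
        refine Eventually.of_forall fun z => ?_
        by_cases hz : z ∈ T q
        · exact measure_mono_null (fun s hs => hs.1) hz.2.2.2.2
        · refine measure_mono_null (fun s hs => hz ?_) measure_empty
          have := hs.2
          rwa [mem_preimage, shadow_lineAt] at this
      filter_upwards [compl_mem_ae_iff.2 h1] with x hx hxT hxs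
      by_contra hno
      push Not at hno
      refine hx ⟨⟨hxs, ?_⟩, hxT⟩
      rintro (⟨h1, h2⟩ | ⟨h1, h2⟩)
      · exact hno.1 h2 h1
      · exact hno.2 h2 h1
    obtain ⟨z, hz, s, hs, hns⟩ := hcon q.2.1 hi q.2.2.1 hj (sg q.1) q.2.2.2.1 q.2.2.2.2 (P q) (T q)
      ⟨fun h => hj (h ▸ hi), hsg _, hh, hTm q, hPm q, fun z hz => hz.2.1, hlab⟩
      (fun z hz => hz.1) h0
    rw [abs_lt] at hs
    exact hns ((line_halfSp e k hσ R z).1.out hz.2.2.1 hz.2.2.2.1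
      ⟨by linarith [hs.1], by linarith [hs.2]⟩)
  refine hA0 (measure_mono_null_ae ?_ (measure_iUnion_null fun q : {q : Bool × L × L × ℚ × ℚ //
    q.2.1 ∈ S ∧ q.2.2.1 ∉ S ∧ 0 < (q.2.2.2.2 : ℝ)} => hnull q.1 q.2.1 q.2.2.1 q.2.2.2))
  filter_upwards [ae_line_jump hc hper hS e k hσ R] with z hz (hzA : z ∈ A)
  obtain ⟨σ', hσ', i, hi, j, hj, p, g, hg, hin, hae⟩ := hz (hA hzA)
  obtain ⟨c₀, h, hh, hhg, hpc⟩ := exists_rat_center p hg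
  obtain ⟨b, rfl⟩ : ∃ b, sg b = σ' := by
    rcases hσ' with rfl | rfl
    · exact ⟨true, rfl⟩
    · exact ⟨false, rfl⟩
  have hpc' := abs_le.1 hpc
  have hnear : ∀ s : ℝ, |s - (c₀ : ℝ)| ≤ 3 * (h : ℝ) → |s - p| < g := fun s hs => by
    rw [abs_le] at hs
    rw [abs_lt]
    constructor <;> linarith
  have hae' : ∀ᵐ s : ℝ, |s - (c₀ : ℝ)| < 3 * (h : ℝ) → (sg b * (s - p) < 0 ∧ c (lineAt e s z) = i) ∨
      (0 < sg b * (s - p) ∧ c (lineAt e s z) = j) := by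
    filter_upwards [hae] with s hs hsc using hs (hnear s hsc.le)
  have hPz : P (b, i, j, c₀, h) z = p :=
    jumpHeight_eq (show i ≠ j from fun hij => hj (hij ▸ hi)) (hsg b) hh hpc hae'
  refine mem_iUnion.2 ⟨⟨(b, i, j, c₀, h), hi, hj, hh⟩, hzA, ?_, hin _ (hnear _ ?_),
    hin _ (hnear _ ?_), ?_⟩
  · rw [hPz]; exact hpc
  · simp [abs_of_pos hh]
  · simp [abs_of_pos hh]
  · refine measure_mono_null_ae (t := ∅) ?_ measure_empty
    filter_upwards [hae'] with s hs (hsB : lineAt e s z ∈ Bad (b, i, j, c₀, h))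
    obtain ⟨h1, h2⟩ := hsB
    simp only [mem_ofPred_eq, lineAt_same] at h1
    refine h2 ?_
    rcases hs h1 with h3 | h3
    · refine Or.inl ⟨h3.2, ?_⟩
      simpa only [mem_ofPred_eq, lineAt_same, shadow_lineAt, hPz] using h3.1
    · refine Or.inr ⟨h3.2, ?_⟩
      simpa only [mem_ofPred_eq, lineAt_same, shadow_lineAt, hPz] using h3.1

/-- The open slab `R < σ * x k < R₁`. -/
def slabSp (k : Fin N) (σ R R₁ : ℝ) : Set (Pt N) := {x | R < σ * x k ∧ σ * x k < R₁}

lemma volume_inter_rnDeriv_le_ne_zero {ρ : Measure (Fin n → ℝ)} {A : Set (Fin n → ℝ)}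
    {Θ : ℝ≥0∞} (hΘ : Θ ≠ ⊤) (hA : MeasurableSet A) (hA0 : volume A ≠ 0) (hAt : volume A ≠ ⊤)
    (hρ : ρ univ ≤ Θ * volume A) : volume (A ∩ {z | ρ.rnDeriv volume z ≤ Θ + 1}) ≠ 0 := by
  intro h0
  have h1 : (Θ + 1) * volume A ≤ Θ * volume A := by
    calc (Θ + 1) * volume A = ∫⁻ _ in A, (Θ + 1) := by rw [setLIntegral_const]
      _ ≤ ∫⁻ z in A, ρ.rnDeriv volume z := by
        have hae : ∀ᵐ z, z ∉ A ∩ {z | ρ.rnDeriv volume z ≤ Θ + 1} := compl_mem_ae_iff.2 h0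
        refine lintegral_mono_ae ((ae_restrict_iff' hA).2 ?_)
        filter_upwards [hae] with z hz hzA
        exact le_of_not_ge fun h => hz ⟨hzA, h⟩
      _ ≤ ρ A := Measure.setLIntegral_rnDeriv_le A
      _ ≤ _ := (measure_mono (subset_univ _)).trans hρ
  rw [add_mul, one_mul] at h1
  have h2 : Θ * volume A ≠ ⊤ := ENNReal.mul_ne_top hΘ hAt
  exact hA0 (by simpa using (ENNReal.le_sub_of_add_le_left h2 h1))

lemma exists_small_scale (n : ℕ) {K η : ℝ≥0∞} (hK : K ≠ ⊤) (hη : η ≠ 0) :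
    ∃ t : ℝ, 0 < t ∧ t ^ (n + 1) ≤ 1 / 2 ∧ K * ENNReal.ofReal t ≤ η := by
  have h1 : Tendsto (fun t : ℝ => K * ENNReal.ofReal t) (𝓝[>] 0) (𝓝 0) := by
    have : Tendsto (fun t : ℝ => K * ENNReal.ofReal t) (𝓝[>] 0) (𝓝 (K * ENNReal.ofReal 0)) :=
      ENNReal.Tendsto.const_mul (ENNReal.tendsto_ofReal (tendsto_id.mono_left nhdsWithin_le_nhds)) (Or.inr hK)
    simpa using this
  obtain ⟨t, h2, h3, h4⟩ := ((h1.eventually (Iic_mem_nhds (pos_iff_ne_zero.2 hη))).and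
    ((eventually_mem_nhdsWithin).and
      (mem_nhdsWithin_of_mem_nhds (Iio_mem_nhds (show (0 : ℝ) < 1 / 2 by norm_num))))).exists
  refine ⟨t, h3, ?_, h2⟩
  have h4' : t < 1 / 2 := h4
  exact (pow_le_of_le_one (le_of_lt h3) (by linarith) (by simp)).trans h4'.le

lemma MinimalLab.cellBdry_ne_top {ν γ : Measure (Pt (n + 1))} {M : ℝ≥0∞} {z : L}
    {c : Pt (n + 1) → L} (h : MinimalLab ν γ M z c) (l : L) : μH[(n : ℝ)] (cellBdry c l) ≠ ⊤ := by
  refine ne_top_of_le_ne_top (ENNReal.mul_ne_top h.weights.ne_top ?_) (h.weights.le_per _)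
  exact ENNReal.sum_ne_top.1 h.per_ne_top l (Finset.mem_univ l)

lemma cyl_subset_slabSp {e k : Fin (n + 1)} {z : Fin n → ℝ} {c₀ h σ R : ℝ}
    (hσ : σ = 1 ∨ σ = -1) (hh : 0 < h)
    (hz : ∀ s, |s - c₀| < 3 * h → lineAt e s z ∈ halfSp k σ R) :
    ∃ R₁, cyl e z c₀ h 1 ⊆ slabSp k σ (R - 1) R₁ := by
  have key : ∀ x ∈ cyl e z c₀ h 1, |x k - lineAt e (x e) z k| < 1 := by
    intro x hx
    obtain ⟨h1, -⟩ := mem_cyl.1 hx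
    rcases Fin.eq_self_or_eq_succAbove e k with rfl | ⟨i, rfl⟩
    · simp
    · rw [lineAt_succAbove]
      exact (dist_le_pi_dist (shadow e x) z i).trans_lt h1
  have hcomp : IsCompact ((fun s => lineAt e s z) '' Icc (c₀ - 2 * h) (c₀ + 2 * h)) :=
    isCompact_Icc.image (continuous_lineAt e z)
  obtain ⟨R₂, hR₂⟩ := (hcomp.image (f := fun x : Pt (n + 1) => σ * x k)
    (by fun_prop)).bddAbove
  refine ⟨R₂ + 1, fun x hx => ?_⟩
  have h1 := abs_lt.1 (key x hx)
  have h2 := (mem_cyl.1 hx).2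
  have h3 : R < σ * lineAt e (x e) z k := hz _ (by linarith)
  have h4 : σ * lineAt e (x e) z k ≤ R₂ := by
    rw [abs_lt] at h2
    exact hR₂ (mem_image_of_mem _ (mem_image_of_mem _ ⟨by linarith, by linarith⟩))
  rcases hσ with rfl | rfl <;> constructor <;> linarith

/-- Far in a half-space in which the union of the cells of `S` has positive volume, volume can be
moved cheaply from some label outside of `S` to some label of `S`. -/
lemma MinimalLab.exists_cheap_transfer (hn : 1 ≤ n) {ν γ : Measure (Pt (n + 1))} {M : ℝ≥0∞} {z : L}
    {c : Pt (n + 1) → L} (h : MinimalLab ν γ M z c) {S : Finset L} (hz : z ∉ S)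
    {k : Fin (n + 1)} {σ : ℝ} (hσ : σ = 1 ∨ σ = -1)
    (hpos : ∀ R, volume (c ⁻¹' S ∩ halfSp k σ R) ≠ 0) {η : ℝ≥0∞} (hη : η ≠ 0) (R₀ : ℝ) :
    ∃ i ∈ S, ∃ j ∉ S, ∃ R₁, ∃ v₀, v₀ ≠ 0 ∧ v₀ ≠ ⊤ ∧
      CanTransfer ν γ c (slabSp k σ R₀ R₁) j i η v₀ := by
  have hM := h.weights.ne_top
  have hc := h.meas
  have hSm : MeasurableSet (c ⁻¹' (S : Set L)) := hc.preimage _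
  have hSt := h.volume_preimage_ne_top hz
  obtain ⟨C, hC, hR⟩ := h.exists_perimeter_le hz hσ hpos
  set Θ : ℝ≥0∞ := C * (n + 1) with hΘ
  have hΘt : Θ ≠ ⊤ := by finiteness
  set D := Θ + 1 with hD
  have hDt : D ≠ ⊤ := by finiteness
  obtain ⟨t, ht, ht1, htη⟩ := exists_small_scale n
    (K := (12 * 3 ^ n * M * (D + 1) + Fintype.card L * (M * (1 + 2 ^ n))) * 2 ^ n * (8 * M))
    (by finiteness) hη
  obtain ⟨Rf, b, hbM, hfar⟩ := h.weights.far (ENNReal.ofReal (t ^ (n + 1))) (by positivity)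
  obtain ⟨R, hRR, hRp⟩ := hR (max R₀ Rf + 1)
  obtain ⟨e, -, he⟩ := Finset.exists_max_image Finset.univ
    (fun e => volume (lineShadow e (c ⁻¹' (S : Set L) ∩ halfSp k σ R))) Finset.univ_nonempty
  have hFm := hSm.inter (measurableSet_halfSp k σ R)
  set A := lineShadow e (c ⁻¹' (S : Set L) ∩ halfSp k σ R) with hA
  set B := essBdry (c ⁻¹' (S : Set L)) ∩ halfSp k σ R with hB
  have hvol : volume (c ⁻¹' (S : Set L) ∩ halfSp k σ R) ^ ((n : ℝ) / (n + 1)) ≤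
      (n + 1) * volume A := by
    refine (volume_rpow_le_sum_lineShadow hn hFm).trans ?_
    refine (Finset.sum_le_card_nsmul _ _ _ fun e' _ => he e' (Finset.mem_univ _)).trans ?_
    simp
  have hBA : μH[(n : ℝ)] B ≤ Θ * volume A := by
    rw [hΘ, mul_assoc]
    exact hRp.trans (by gcongr)
  have hBt : μH[(n : ℝ)] B ≠ ⊤ := by
    refine ne_top_of_le_ne_top ?_ (measure_mono (inter_subset_left.trans
      (essBdry_preimage_subset hc (S : Set L))))
    refine ne_top_of_le_ne_top ?_ (measure_biUnion_finset_le S _)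
    exact ENNReal.sum_ne_top.2 fun l _ => h.cellBdry_ne_top l
  have hAt : volume A ≠ ⊤ := ne_top_of_le_ne_top hBt (volume_lineShadow_le hSm hSt e k hσ R)
  have hA0 : volume A ≠ 0 := by
    intro h0
    rw [h0, mul_zero, nonpos_iff_eq_zero, ENNReal.rpow_eq_zero_iff] at hvol
    rcases hvol with hv | hv
    · exact hpos R hv.1
    · have : (0 : ℝ) ≤ n / (n + 1) := by positivity
      linarith [hv.2]
  set ρ := (μH[(n : ℝ)].restrict B).map (shadow e) with hρ
  have hρu : ρ univ ≤ Θ * volume A := by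
    rw [hρ, Measure.map_apply (measurable_shadow e) MeasurableSet.univ, preimage_univ,
      Measure.restrict_apply_univ]
    exact hBA
  have hA' := volume_inter_rnDeriv_le_ne_zero hΘt (measurableSet_lineShadow e hFm) hA0 hAt hρu
  obtain ⟨i, hi, j, hj, σ', c₀, d, p, T, hcol, hTA, hT0, hTR⟩ := exists_column hc
    h.cellBdry_ne_top hSt e k hσ R ((measurableSet_lineShadow e hFm).inter
      (measurableSet_le (Measure.measurable_rnDeriv _ _) measurable_const)) inter_subset_left hA'
  have hcyl : ∀ z ∈ T, cyl e z c₀ d 1 ⊆ (ball 0 Rf)ᶜ := by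
    intro z hz
    obtain ⟨R₁, hR₁⟩ := cyl_subset_slabSp hσ hcol.pos (hTR z hz)
    refine fun x hx hxb => disjoint_left.1 (disjoint_ball_halfSp hσ
      (show Rf ≤ R - 1 by linarith [le_max_right R₀ Rf])) hxb (hR₁ hx).1
  obtain ⟨z₁, hz₁, v₀, hv0, hvt, htr⟩ := hcol.exists_canTransfer h.weights hc h.cellBdry_ne_top
    hT0 ht ht1 hcyl hbM hfar hDt hBt (fun x hx hxT hden hxd => ⟨hcol.mem_essBdry hc hi hj hx hden
      hxd, by
        have := hTR _ hxT (x e) (by linarith [hcol.pos])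
        rwa [lineAt_shadow] at this⟩) (fun z hz => (hTA hz).2)
  obtain ⟨R₁, hR₁⟩ := cyl_subset_slabSp hσ hcol.pos (hTR z₁ hz₁)
  exact ⟨i, hi, j, hj, R₁, v₀, hv0, hvt, htr.mono (hR₁.trans fun x hx =>
    ⟨by linarith [hx.1, le_max_left R₀ Rf], hx.2⟩) htη le_rfl⟩

/-- Volume can be moved arbitrarily cheaply and arbitrarily far from the label `a` to `b`. -/
def FarTransfer (ν γ : Measure (Pt (n + 1))) (c : Pt (n + 1) → L) (k : Fin (n + 1)) (σ : ℝ)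
    (a b : L) : Prop :=
  ∀ η : ℝ≥0∞, η ≠ 0 → ∀ R₀, ∃ R₁, ∃ v₀, v₀ ≠ 0 ∧ v₀ ≠ ⊤ ∧
    CanTransfer ν γ c (slabSp k σ R₀ R₁) a b η v₀

lemma FarTransfer.trans {ν γ : Measure (Pt (n + 1))} {c : Pt (n + 1) → L} {k : Fin (n + 1)}
    {σ : ℝ} {a b d : L} (h₁ : FarTransfer ν γ c k σ a b) (h₂ : FarTransfer ν γ c k σ b d)
    (hab : a ≠ b) (hbd : b ≠ d) (had : a ≠ d) : FarTransfer ν γ c k σ a d := by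
  intro η hη R₀
  have hη2 : η / 2 ≠ 0 := by simpa using hη
  obtain ⟨R₁, v₁, hv1, hv1t, t1⟩ := h₁ _ hη2 R₀
  obtain ⟨R₂, v₂, hv2, hv2t, t2⟩ := h₂ _ hη2 (max R₀ R₁)
  refine ⟨max R₁ R₂, min v₁ v₂, (lt_min (pos_iff_ne_zero.2 hv1) (pos_iff_ne_zero.2 hv2)).ne',
    ne_top_of_le_ne_top hv1t (min_le_left _ _), ?_⟩
  have hd : Disjoint (slabSp k σ R₀ R₁) (slabSp k σ (max R₀ R₁) R₂) :=
    disjoint_left.2 fun x hx hx' => ((le_max_right R₀ R₁).trans_lt hx'.1).not_gt hx.2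
  refine ((t1.mono subset_rfl le_rfl (min_le_left _ _)).comp
    (t2.mono subset_rfl le_rfl (min_le_right _ _)) hd
    (ne_top_of_le_ne_top hv1t (min_le_left _ _)) hab hbd had).mono ?_
    (ENNReal.add_halves η).le le_rfl
  rintro x (hx | hx)
  · exact ⟨hx.1, lt_max_of_lt_left hx.2⟩
  · exact ⟨(le_max_left _ _).trans_lt hx.1, lt_max_of_lt_right hx.2⟩

lemma FarTransfer.volume_ne_zero {ν γ : Measure (Pt (n + 1))} {M : ℝ≥0∞} {z : L}
    {c : Pt (n + 1) → L} (h : MinimalLab ν γ M z c) {k : Fin (n + 1)} {σ : ℝ} {a b : L}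
    (hab : FarTransfer ν γ c k σ a b) (ha : a ≠ z) (R : ℝ) :
    volume (c ⁻¹' {a} ∩ halfSp k σ R) ≠ 0 := by
  intro h0
  obtain ⟨R₁, v₀, hv, -, ht⟩ := hab 1 one_ne_zero R
  obtain ⟨c', -, hc', hva, -⟩ := ht v₀ le_rfl c h.meas fun _ _ => rfl
  have hνt : ν (c ⁻¹' {a}) ≠ ⊤ := ne_top_of_le_ne_top
    (ENNReal.mul_ne_top h.weights.ne_top (h.vol_ne_top a ha)) (h.weights.vol_le _)
  have hν0 : ν (c ⁻¹' {a} ∩ halfSp k σ R) = 0 := by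
    simpa [h0] using h.weights.vol_le (c ⁻¹' {a} ∩ halfSp k σ R)
  have hle : ν (c ⁻¹' {a}) ≤ ν (c' ⁻¹' {a}) := by
    rw [← measure_sdiff_null hν0]
    refine measure_mono fun x hx => ?_
    have hx1 : x ∉ slabSp k σ R R₁ := fun hs => hx.2 ⟨hx.1, hs.1⟩
    simpa [hc' x hx1] using hx.1
  have := hva.le.trans hle
  rw [← add_zero (ν (c' ⁻¹' {a})), add_assoc, zero_add] at this
  exact hv (by simpa using (ENNReal.add_le_add_iff_left (ne_top_of_le_ne_top hνt
    (le_self_add.trans hva.le))).1 this)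

lemma MinimalLab.exists_farTransfer (hn : 1 ≤ n) {ν γ : Measure (Pt (n + 1))} {M : ℝ≥0∞} {z : L}
    {c : Pt (n + 1) → L} (h : MinimalLab ν γ M z c) {S : Finset L} (hz : z ∉ S)
    {k : Fin (n + 1)} {σ : ℝ} (hσ : σ = 1 ∨ σ = -1)
    (hpos : ∀ R, volume (c ⁻¹' S ∩ halfSp k σ R) ≠ 0) :
    ∃ i ∈ S, ∃ j ∉ S, FarTransfer ν γ c k σ j i := by
  by_contra! hcon
  have hex : ∀ q : L × L, ∃ η : ℝ≥0∞, ∃ R₀, η ≠ 0 ∧ (q.1 ∈ S → q.2 ∉ S → ∀ R₁ v₀, v₀ ≠ 0 →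
      v₀ ≠ ⊤ → ¬ CanTransfer ν γ c (slabSp k σ R₀ R₁) q.2 q.1 η v₀) := by
    intro q
    by_cases hq : q.1 ∈ S ∧ q.2 ∉ S
    · have := hcon q.1 hq.1 q.2 hq.2
      simp only [FarTransfer] at this
      push Not at this
      obtain ⟨η, hη, R₀, h1⟩ := this
      exact ⟨η, R₀, hη, fun _ _ => h1⟩
    · exact ⟨1, 0, one_ne_zero, fun h1 h2 => absurd ⟨h1, h2⟩ hq⟩
  choose η R₀ hη hno using hex
  obtain ⟨η', hη', -, hle⟩ := exists_pos_le η hη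
  obtain ⟨R', hR'⟩ := (Set.finite_range R₀).bddAbove
  obtain ⟨i, hi, j, hj, R₁, v₀, hv, hvt, ht⟩ := h.exists_cheap_transfer hn hz hσ hpos hη' R'
  exact hno (i, j) hi hj R₁ v₀ hv hvt (ht.mono
    (fun x hx => ⟨(hR' (mem_range_self (i, j))).trans_lt hx.1, hx.2⟩) (hle _) le_rfl)

/-- Every label reaching arbitrarily far can be supplied cheaply with volume of the exterior. -/
lemma MinimalLab.farTransfer_of_pos (hn : 1 ≤ n) {ν γ : Measure (Pt (n + 1))} {M : ℝ≥0∞} {z : L}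
    {c : Pt (n + 1) → L} (h : MinimalLab ν γ M z c) {k : Fin (n + 1)} {σ : ℝ}
    (hσ : σ = 1 ∨ σ = -1) {l : L} (hl : l ≠ z)
    (hpos : ∀ R, volume (c ⁻¹' {l} ∩ halfSp k σ R) ≠ 0) : FarTransfer ν γ c k σ z l := by
  classical
  by_contra hno
  let S := Finset.univ.filter fun l : L => l ≠ z ∧ ¬ FarTransfer ν γ c k σ z l ∧
    ∀ R, volume (c ⁻¹' {l} ∩ halfSp k σ R) ≠ 0
  have hS : ∀ {l}, l ∈ S ↔ l ≠ z ∧ ¬ FarTransfer ν γ c k σ z l ∧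
      ∀ R, volume (c ⁻¹' {l} ∩ halfSp k σ R) ≠ 0 := by simp [S]
  have hlS : l ∈ S := hS.2 ⟨hl, hno, hpos⟩
  have hSpos : ∀ R, volume (c ⁻¹' S ∩ halfSp k σ R) ≠ 0 := fun R h0 =>
    hpos R (measure_mono_null (inter_subset_inter_left _
      (preimage_mono (singleton_subset_iff.2 hlS))) h0)
  obtain ⟨i, hi, j, hj, hji⟩ := h.exists_farTransfer hn (fun hz => (hS.1 hz).1 rfl) hσ hSpos
  have hi' := hS.1 hi
  by_cases hjz : j = z
  · exact hi'.2.1 (hjz ▸ hji)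
  · have hzj : FarTransfer ν γ c k σ z j := by
      by_contra hzj
      exact hj (hS.2 ⟨hjz, hzj, hji.volume_ne_zero h hjz⟩)
    exact hi'.2.1 (hzj.trans hji (Ne.symm hjz) (fun hij => hj (hij ▸ hi)) hi'.1.symm)

lemma exists_disjoint_farTransfer {ν γ : Measure (Pt (n + 1))} {c : Pt (n + 1) → L}
    {k : Fin (n + 1)} {σ : ℝ} {z : L} {η : ℝ≥0∞} (hη : η ≠ 0) (S : Finset L)
    (hS : ∀ l ∈ S, FarTransfer ν γ c k σ z l) :
    ∃ R₁, ∃ W : L → Set (Pt (n + 1)), ∃ v₀ ≠ 0, v₀ ≠ ⊤ ∧ (S : Set L).PairwiseDisjoint W ∧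
      (∀ l ∈ S, Disjoint (W l) (halfSp k σ R₁)) ∧ ∀ l ∈ S, CanTransfer ν γ c (W l) z l η v₀ := by
  induction S using Finset.induction_on with
  | empty => exact ⟨0, fun _ => ∅, 1, one_ne_zero, ENNReal.one_ne_top, by simp, by simp, by simp⟩
  | insert a S ha ih =>
    obtain ⟨R, W, v, hv, hvt, hW, hd, ht⟩ := ih fun l hl => hS l (Finset.mem_insert_of_mem hl)
    obtain ⟨R₁, v₁, hv1, hv1t, t1⟩ := hS a (Finset.mem_insert_self _ _) η hη R
    have hne : ∀ l ∈ S, l ≠ a := fun l hl h => ha (h ▸ hl)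
    refine ⟨max R R₁, Function.update W a (slabSp k σ R R₁), min v v₁,
      (lt_min (pos_iff_ne_zero.2 hv) (pos_iff_ne_zero.2 hv1)).ne',
      ne_top_of_le_ne_top hvt (min_le_left _ _), ?_, ?_, ?_⟩
    · rw [Finset.coe_insert, pairwiseDisjoint_insert_of_notMem (by simpa using ha)]
      refine ⟨fun l hl l' hl' hll => ?_, fun l hl => ?_⟩
      · simp only [Function.onFun, Function.update_of_ne (hne l hl), Function.update_of_ne (hne l' hl')]
        exact hW hl hl' hll
      · rw [Function.update_self, Function.update_of_ne (hne l hl)]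
        exact (disjoint_left.2 fun x hx hx' => disjoint_left.1 (hd l hl) hx' hx.1)
    · intro l hl
      rcases Finset.mem_insert.1 hl with rfl | hl
      · rw [Function.update_self]
        exact disjoint_left.2 fun x hx hx' =>
          ((le_max_right R R₁).trans_lt (show max R R₁ < σ * x k from hx')).not_gt hx.2
      · rw [Function.update_of_ne (hne l hl)]
        exact (hd l hl).mono_right (halfSp_anti k σ (le_max_left _ _))
    · intro l hl
      rcases Finset.mem_insert.1 hl with rfl | hl
      · rw [Function.update_self]
        exact t1.mono subset_rfl le_rfl (min_le_right _ _)
      · rw [Function.update_of_ne (hne l hl)]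
        exact (ht l hl).mono subset_rfl le_rfl (min_le_left _ _)

lemma MinimalLab.exists_volume_halfSp_eq_zero (hn : 1 ≤ n) {ν γ : Measure (Pt (n + 1))}
    {M : ℝ≥0∞} {z : L} {c : Pt (n + 1) → L} (h : MinimalLab ν γ M z c) (k : Fin (n + 1)) {σ : ℝ}
    (hσ : σ = 1 ∨ σ = -1) {l : L} (hl : l ≠ z) : ∃ R, volume (c ⁻¹' {l} ∩ halfSp k σ R) = 0 := by
  classical
  by_contra! hpos
  let S := Finset.univ.filter fun l : L => l ≠ z ∧ ∀ R, volume (c ⁻¹' {l} ∩ halfSp k σ R) ≠ 0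
  have hS : ∀ {l}, l ∈ S ↔ l ≠ z ∧ ∀ R, volume (c ⁻¹' {l} ∩ halfSp k σ R) ≠ 0 := by simp [S]
  have hex : ∀ l : L, ∃ R, l ∉ S → l ≠ z → volume (c ⁻¹' {l} ∩ halfSp k σ R) = 0 := by
    intro l
    by_cases h1 : l ∉ S ∧ l ≠ z
    · rw [hS, not_and] at h1
      have := h1.1 h1.2
      push Not at this
      exact this.imp fun _ h0 _ _ => h0
    · exact ⟨0, fun h2 h3 => absurd ⟨h2, h3⟩ h1⟩
  choose R hR using hex
  obtain ⟨R₀, hR₀⟩ := (Set.finite_range R).bddAbove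
  obtain ⟨R', hR'⟩ := h.exists_tail_eq_zero hn (S := S) (fun hz => (hS.1 hz).1 rfl) hσ (R₀ := R₀)
    (fun l h1 h2 => measure_mono_null (inter_subset_inter_right _
      (halfSp_anti k σ (hR₀ (mem_range_self l)))) (hR l h1 h2))
    (fun η hη => exists_disjoint_farTransfer hη S fun l hl =>
      h.farTransfer_of_pos hn hσ (hS.1 hl).1 (hS.1 hl).2)
  exact hpos R' (measure_mono_null (inter_subset_inter_left _
    (preimage_mono (singleton_subset_iff.2 (hS.2 ⟨hl, hpos⟩)))) hR')

/-- The cells of a minimal labelling are essentially bounded. -/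
lemma MinimalLab.exists_volume_diff_ball_eq_zero (hn : 1 ≤ n) {ν γ : Measure (Pt (n + 1))}
    {M : ℝ≥0∞} {z : L} {c : Pt (n + 1) → L} (h : MinimalLab ν γ M z c) :
    ∃ R : ℝ, 0 < R ∧ ∀ l ≠ z, volume (c ⁻¹' {l} \ ball 0 R) = 0 := by
  have hex : ∀ q : Fin (n + 1) × Bool × L, ∃ R, q.2.2 ≠ z →
      volume (c ⁻¹' {q.2.2} ∩ halfSp q.1 (if q.2.1 then 1 else -1) R) = 0 := by
    intro q
    by_cases hq : q.2.2 = z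
    · exact ⟨0, fun h' => absurd hq h'⟩
    · obtain ⟨R, hR⟩ := h.exists_volume_halfSp_eq_zero hn q.1
        (σ := if q.2.1 then 1 else -1) (by split_ifs <;> simp) hq
      exact ⟨R, fun _ => hR⟩
  choose R hR using hex
  obtain ⟨R₀, hR₀⟩ := (Set.finite_range R).bddAbove
  refine ⟨√(n + 1) * |R₀| + 1, by positivity, fun l hl => ?_⟩
  refine measure_mono_null ?_ (measure_iUnion_null fun q : Fin (n + 1) × Bool => hR (q.1, q.2, l) hl)
  intro x hx
  by_contra hno
  have hle : ∀ k, |x k| ≤ |R₀| := by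
    intro k
    by_contra! hk
    rcases lt_abs.1 ((le_abs_self R₀).trans_lt hk) with hk | hk
    · exact hno (mem_iUnion.2 ⟨(k, true), hx.1,
        (hR₀ (mem_range_self (k, true, l))).trans_lt (by simpa using hk)⟩)
    · exact hno (mem_iUnion.2 ⟨(k, false), hx.1,
        (hR₀ (mem_range_self (k, false, l))).trans_lt (by simpa using hk)⟩)
  have hd : dist x 0 ≤ √(n + 1) * |R₀| := by
    refine dist_le_of_coord 0 (by simpa using hle 0) ?_
    exact (dist_pi_le_iff (abs_nonneg _)).2 fun i => by
      simpa [shadow, Real.dist_eq] using hle (Fin.succAbove 0 i)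
  exact hx.2 (mem_ball.2 (by linarith))

end Labellings

lemma exists_labelling {X ι : Type*} {D : ι → Set X} (hD : Pairwise fun i j => Disjoint (D i) (D j)) :
    ∃ c : X → Option ι, (∀ i, c ⁻¹' {some i} = D i) ∧ c ⁻¹' {none} = (⋃ i, D i)ᶜ := by
  classical
  let c : X → Option ι := fun x => if h : ∃ i, x ∈ D i then some h.choose else none
  refine ⟨c, fun i => ?_, ?_⟩
  · ext x
    by_cases h : ∃ i, x ∈ D i
    · have h1 : c x = some h.choose := dif_pos h
      simp only [mem_preimage, mem_singleton_iff, h1, Option.some.injEq]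
      constructor
      · rintro rfl
        exact h.choose_spec
      · intro hx
        by_contra hne
        exact disjoint_left.1 (hD hne) h.choose_spec hx
    · have h1 : c x = none := dif_neg h
      simpa [h1] using fun hx => h ⟨i, hx⟩
  · ext x
    by_cases h : ∃ i, x ∈ D i
    · have h1 : c x = some h.choose := dif_pos h
      simpa [h1] using h
    · have h1 : c x = none := dif_neg h
      simpa [h1] using h

/-- The volume measure with density `f`. -/
def volDens (f : Pt N → ℝ) : Measure (Pt N) :=
  (μH[(N : ℝ)]).withDensity fun x => ENNReal.ofReal (f x)

/-- The perimeter measure with density `g`. -/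
def perDens (g : Pt N → ℝ) : Measure (Pt N) :=
  (μH[(N : ℝ) - 1]).withDensity fun x => ENNReal.ofReal (g x)

lemma wVolE_eq (f : Pt N → ℝ) {E : Set (Pt N)} (hE : MeasurableSet E) :
    wVolE f E = volDens f E := (withDensity_apply _ hE).symm

lemma wPer_eq (g : Pt N → ℝ) {E : Set (Pt N)} (hE : MeasurableSet E) :
    wPer g E = (perDens g (essBdry E)).toReal := by
  rw [wPer, perDens, withDensity_apply _ (measurableSet_essBdry hE)]

lemma withDensity_le_and_le {X : Type*} [MeasurableSpace X] (μ : Measure X) {f : X → ℝ} {M : ℝ}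
    (hM : 0 < M) (hf : ∀ x, M⁻¹ ≤ f x ∧ f x ≤ M) (A : Set X) :
    (μ.withDensity fun x => ENNReal.ofReal (f x)) A ≤ ENNReal.ofReal M * μ A ∧
      μ A ≤ ENNReal.ofReal M * (μ.withDensity fun x => ENNReal.ofReal (f x)) A := by
  have h1 := withDensity_mono (μ := μ) (f := fun x => ENNReal.ofReal (f x))
    (g := fun _ => ENNReal.ofReal M) (Eventually.of_forall fun x => ENNReal.ofReal_le_ofReal (hf x).2)
  have h2 := withDensity_mono (μ := μ) (f := fun _ => ENNReal.ofReal M⁻¹)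
    (g := fun x => ENNReal.ofReal (f x))
    (Eventually.of_forall fun x => ENNReal.ofReal_le_ofReal (hf x).1)
  rw [withDensity_const] at h1 h2
  refine ⟨h1 A, ?_⟩
  have h3 : ENNReal.ofReal M⁻¹ * μ A ≤ _ := h2 A
  calc μ A = ENNReal.ofReal M * (ENNReal.ofReal M⁻¹ * μ A) := by
        rw [← mul_assoc, ← ENNReal.ofReal_mul hM.le, mul_inv_cancel₀ hM.ne', ENNReal.ofReal_one,
          one_mul]
    _ ≤ _ := by gcongr

lemma exists_weights {f g : Pt (n + 1) → ℝ} {M : ℝ} (hM : 1 ≤ M)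
    (hbound : ∀ x, M⁻¹ ≤ f x ∧ f x ≤ M ∧ M⁻¹ ≤ g x ∧ g x ≤ M) {a : ℝ} (ha : 0 < a)
    (hlim : Tendsto g (cocompact (Pt (n + 1))) (𝓝 a)) :
    ∃ M', Weights (volDens f) (perDens g) M' := by
  obtain ⟨κ, hκ0, hκt, hκ⟩ := exists_hausdorff_eq_smul (n + 1)
  have hM0 : 0 < M := by linarith
  have hcast : (((n + 1 : ℕ) : ℝ) - 1) = n := by push_cast; ring
  have hf := withDensity_le_and_le (μH[((n + 1 : ℕ) : ℝ)] : Measure (Pt (n + 1))) hM0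
    fun x => ⟨(hbound x).1, (hbound x).2.1⟩
  have hg := withDensity_le_and_le (μH[(n : ℝ)] : Measure (Pt (n + 1))) hM0
    fun x => ⟨(hbound x).2.2.1, (hbound x).2.2.2⟩
  have hκi : κ⁻¹ ≠ ⊤ := ENNReal.inv_ne_top.2 hκ0
  set M' : ℝ≥0∞ := ENNReal.ofReal M * (κ + κ⁻¹ + 1) with hM'
  have hMM' : ENNReal.ofReal M ≤ M' := le_mul_of_one_le_right bot_le le_add_self
  refine ⟨M', ?_⟩
  constructor
  · finiteness
  · exact (ENNReal.one_le_ofReal.2 hM).trans hMM'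
  · intro A
    refine (hf A).1.trans ?_
    rw [hκ, Measure.smul_apply, smul_eq_mul, ← mul_assoc]
    rw [hM', add_assoc]
    gcongr
    exact le_self_add
  · intro A
    have h1 := (hf A).2
    calc volume A = κ⁻¹ * (μH[((n + 1 : ℕ) : ℝ)] A) := by
          rw [hκ, Measure.smul_apply, smul_eq_mul, ← mul_assoc, ENNReal.inv_mul_cancel hκ0 hκt,
            one_mul]
      _ ≤ κ⁻¹ * (ENNReal.ofReal M * volDens f A) := by gcongr; exact h1
      _ = ENNReal.ofReal M * κ⁻¹ * volDens f A := by ring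
      _ ≤ _ := by
        rw [hM']
        gcongr
        exact le_add_self.trans le_self_add
  · intro A
    rw [perDens, hcast]
    exact (hg A).1.trans (by gcongr)
  · intro A
    rw [perDens, hcast]
    exact (hg A).2.trans (by gcongr)
  · intro δ hδ
    set d := min a (min δ 1).toReal with hd
    have hmin : (min δ 1) ≠ ⊤ := ne_top_of_le_ne_top ENNReal.one_ne_top (min_le_right _ _)
    have hd0 : 0 < d := lt_min ha (ENNReal.toReal_pos
      (lt_min (pos_iff_ne_zero.2 hδ) one_pos).ne' hmin)
    have hda : d ≤ a := min_le_left _ _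
    have hdδ : ENNReal.ofReal d ≤ δ := by
      refine (ENNReal.ofReal_le_ofReal (min_le_right _ _)).trans ?_
      rw [ENNReal.ofReal_toReal hmin]
      exact min_le_left _ _
    have haM : a ≤ M := le_of_tendsto hlim (Eventually.of_forall fun x => (hbound x).2.2.2)
    rw [← Metric.cobounded_eq_cocompact] at hlim
    obtain ⟨R₀, -, hR₀⟩ := (Metric.hasBasis_cobounded_compl_ball (0 : Pt (n + 1))).eventually_iff.1
      (hlim.eventually (Metric.ball_mem_nhds a (half_pos hd0)))
    have hR : ∀ x ∈ (ball (0 : Pt (n + 1)) R₀)ᶜ, a - d / 2 ≤ g x ∧ g x ≤ a - d / 2 + d := by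
      intro x hx
      have := hR₀ hx
      rw [Real.dist_eq, abs_lt] at this
      constructor <;> linarith
    refine ⟨R₀, ENNReal.ofReal (a - d / 2),
      (ENNReal.ofReal_le_ofReal (by linarith)).trans hMM', fun A hA hAR => ?_⟩
    rw [perDens, hcast, withDensity_apply _ hA]
    constructor
    · rw [← setLIntegral_const]
      exact setLIntegral_mono' hA fun x hx => ENNReal.ofReal_le_ofReal (hR x (hAR hx)).1
    · rw [← setLIntegral_const]
      refine setLIntegral_mono' hA fun x hx => ?_
      refine (ENNReal.ofReal_le_ofReal (hR x (hAR hx)).2).trans ?_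
      rw [ENNReal.ofReal_add (by linarith) hd0.le]
      gcongr

lemma clPer_eq_totalPer (g : Pt N → ℝ) {m : ℕ} {F : Fin m → Set (Pt N)}
    (hF : ∀ i, MeasurableSet (F i)) {c : Pt N → Option (Fin m)} (hc : MeasLab c)
    (hFc : ∀ i, F i =ᵐ[volume] c ⁻¹' {some i})
    (hU : ⋃ i, F i =ᵐ[volume] ((c ⁻¹' {none})ᶜ : Set (Pt N))) (hfin : totalPer (perDens g) c ≠ ⊤) :
    clPer g F = (totalPer (perDens g) c).toReal / 2 := by
  have h1 : ∀ i, wPer g (F i) = (perDens g (cellBdry c (some i))).toReal := fun i => by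
    rw [wPer_eq g (hF i), essBdry_congr (hFc i), cellBdry]
  have h2 : wPer g (⋃ i, F i) = (perDens g (cellBdry c none)).toReal := by
    rw [wPer_eq g (MeasurableSet.iUnion hF), essBdry_congr hU, essBdry_compl (hc none), cellBdry]
  rw [clPer, h2, totalPer, ENNReal.toReal_sum (ENNReal.sum_ne_top.1 hfin), Fintype.sum_option]
  simp only [h1]
  ring

lemma bounded_of_weights (hn : 1 ≤ n) {m : ℕ} {f g : Pt (n + 1) → ℝ} {M : ℝ≥0∞}
    (hw : Weights (volDens f) (perDens g) M) {E : Fin m → Set (Pt (n + 1))} (hE : IsCluster E)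
    (hEnd : Nondegenerate E) (hEper : FinPerCluster E) (hEvol : FinVolCluster f E)
    (hmin : IsIsoperimetric f g E) :
    ∃ R : ℝ, 0 < R ∧ ∀ i, volume (E i \ ball (0 : Pt (n + 1)) R) = 0 := by
  have hcast : (((n + 1 : ℕ) : ℝ) - 1) = n := by push_cast; ring
  obtain ⟨c, hcs, hcn⟩ := exists_labelling (disjoint_disjointed E)
  rw [iUnion_disjointed] at hcn
  have hDm : ∀ i, MeasurableSet (disjointed E i) := fun i => by
    rw [disjointed_apply, Finset.sup_set_eq_biUnion]
    exact (hE.1 i).diff (Finset.measurableSet_biUnion _ fun j _ => hE.1 j)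
  have hc : MeasLab c := by
    rintro (_ | i)
    · rw [hcn]; exact (MeasurableSet.iUnion hE.1).compl
    · rw [hcs]; exact hDm i
  have hED : ∀ i, E i =ᵐ[volume] c ⁻¹' {some i} := by
    intro i
    rw [hcs]
    have h0 : ∀ᵐ x : Pt (n + 1), ∀ j, j ≠ i → ¬ (x ∈ E i ∧ x ∈ E j) := by
      refine ae_all_iff.2 fun j => ?_
      by_cases hj : j = i
      · exact Eventually.of_forall fun x h => absurd hj h
      · have : ∀ᵐ x, x ∉ E i ∩ E j := compl_mem_ae_iff.2 (hE.2 i j (Ne.symm hj))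
        filter_upwards [this] with x hx _ using hx
    refine eventuallyEq_set.2 ?_
    filter_upwards [h0] with x hx
    rw [disjointed_apply, Finset.sup_set_eq_biUnion]
    refine ⟨fun h => ⟨h, fun h' => ?_⟩, fun h => h.1⟩
    obtain ⟨j, hj, hxj⟩ := mem_iUnion₂.1 h'
    exact hx j (Finset.mem_Iio.1 hj).ne ⟨h, hxj⟩
  have hUE : ⋃ i, E i =ᵐ[volume] ((c ⁻¹' {none})ᶜ : Set (Pt (n + 1))) := by
    rw [hcn, compl_compl]
    exact EventuallyEq.rfl
  have hcell : ∀ i, cellBdry c (some i) = essBdry (E i) := fun i => (essBdry_congr (hED i)).symm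
  have hγs : ∀ i, perDens g (cellBdry c (some i)) ≠ ⊤ := fun i => by
    refine ne_top_of_le_ne_top (ENNReal.mul_ne_top hw.ne_top ?_) (hw.per_le _)
    have := hEper i
    rw [hcast] at this
    rw [hcell]
    exact this.ne
  have hγn : perDens g (cellBdry c none) ≠ ⊤ := by
    have hsub : cellBdry c none ⊆ ⋃ i, cellBdry c (some i) := by
      refine (essBdry_preimage_subset_compl hc {none}).trans ?_
      refine iUnion₂_subset fun l hl => ?_
      rcases l with _ | i
      · exact absurd rfl hl
      · exact subset_iUnion (fun i => cellBdry c (some i)) i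
    refine ne_top_of_le_ne_top ?_ ((measure_mono hsub).trans (measure_iUnion_le _))
    rw [tsum_fintype]
    exact ENNReal.sum_ne_top.2 fun i _ => hγs i
  have hper : totalPer (perDens g) c ≠ ⊤ := by
    rw [totalPer, Fintype.sum_option]
    exact ENNReal.add_ne_top.2 ⟨hγn, ENNReal.sum_ne_top.2 fun i _ => hγs i⟩
  have hνac : volDens f ≪ volume := Measure.AbsolutelyContinuous.mk fun A _ hA => by
    simpa [hA] using hw.vol_le A
  have hνE : ∀ i, volDens f (c ⁻¹' {some i}) = wVolE f (E i) := fun i => by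
    rw [wVolE_eq f (hE.1 i)]
    exact (measure_congr (hνac.ae_eq (hED i))).symm
  have hML : MinimalLab (volDens f) (perDens g) M none c := by
    refine ⟨hw, hc, fun c' hc' hvol => ?_, hper, ?_, ?_⟩
    · by_cases htop : totalPer (perDens g) c' = ⊤
      · rw [htop]; exact le_top
      have hU : ⋃ i, c' ⁻¹' {some i} = (c' ⁻¹' {none})ᶜ := by
        ext x
        rcases hx : c' x with _ | i <;> simp [hx]
      have hle := hmin (fun i => c' ⁻¹' {some i}) ⟨fun i => hc' _, fun i j hij => by
          rw [((disjoint_singleton.2 (by simpa using hij)).preimage c').inter_eq, measure_empty]⟩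
        (fun i => by
          rw [hcast]
          refine lt_of_le_of_lt (hw.le_per _) ?_
          exact (ENNReal.mul_ne_top hw.ne_top
            (ENNReal.sum_ne_top.1 htop (some i) (Finset.mem_univ _))).lt_top)
        (fun i => by
          rw [wVol, wVol, wVolE_eq f (hc' _), hvol (some i) (by simp), hνE])
      rw [clPer_eq_totalPer g hE.1 hc hED hUE hper,
        clPer_eq_totalPer g (fun i => hc' _) hc' (fun i => .rfl) (.of_eq hU) htop] at hle
      exact (ENNReal.toReal_le_toReal hper htop).1 (by linarith)
    · rintro (_ | i)
      · rw [hcn]; exact hEnd.1.ne'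
      · rw [← measure_congr (hED i)]; exact (hEnd.2 i).ne'
    · rintro (_ | i) hl
      · exact absurd rfl hl
      · refine ne_top_of_le_ne_top (ENNReal.mul_ne_top hw.ne_top ?_) (hw.le_vol _)
        rw [hνE]
        exact (hEvol i).ne
  obtain ⟨R, hR, h0⟩ := hML.exists_volume_diff_ball_eq_zero hn
  refine ⟨R, hR, fun i => ?_⟩
  rw [measure_congr ((hED i).diff (ae_eq_refl (ball 0 R)))]
  exact h0 (some i) (by simp)

end

/-- an isoperimetric cluster is (essentially) bounded, provided the densities
are bounded from above and below and `g` converges at infinity to a finite limit `a > 0`. -/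
theorem isoperimetric_cluster_bounded_of_limit (N m : ℕ) (hN : 2 ≤ N) (hm : 1 ≤ m)
    (f g : Pt N → ℝ) (hfg : IsDensityPair f g)
    (M : ℝ) (hM : 1 ≤ M)
    (hbound : ∀ x : Pt N, M⁻¹ ≤ f x ∧ f x ≤ M ∧ M⁻¹ ≤ g x ∧ g x ≤ M)
    (a : ℝ) (ha : 0 < a) (hlim : Tendsto g (cocompact (Pt N)) (nhds a))
    (E : Fin m → Set (Pt N)) (hE : IsCluster E) (hEnd : Nondegenerate E)
    (hEper : FinPerCluster E) (hEvol : FinVolCluster f E)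
    (hmin : IsIsoperimetric f g E) :
    ∃ R : ℝ, 0 < R ∧ ∀ i, volume (E i \ ball (0 : Pt N) R) = 0 := by
  obtain ⟨n, rfl⟩ : ∃ n, N = n + 1 := ⟨N - 1, by omega⟩
  obtain ⟨M', hw⟩ := exists_weights hM hbound ha hlim
  exact bounded_of_weights (by omega) hw hE hEnd hEper hEvol hmin
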